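/- Let Ω ⊂ 𝔻 be a hyperbolically convex semi-ideal polygonal domain with vertices p₁, …, p_{2k}, where p_{2i−1} is ideal and p_{2i} is interior. Suppose there exist pairwise disjoint horocycles H_{2i−1} at the ideal vertices such that d(p_{2i−2}, H_{2i−1}) = d(p_{2i}, H_{2i−1}) for every i; for each i let D_{2i−1} denote the horodisk at p_{2i−1} whose boundary horocycle passes through both p_{2i−2} and p_{2i} (this horodisk exists by the hypothesis). Then Ω is admissible if, and only if, p_{2j} ∈ 𝔻 ∖ closure(D_{2i−1}) for all indices i, j (mod k) with j ≠ i and j ≠ i − 1. -/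

import Mathlib

noncomputable section

open Filter MeasureTheory Set Topology
open scoped RealInnerProductSpace Topology

/-- The Euclidean plane, as a Euclidean space. -/
abbrev E2 : Type := EuclideanSpace ℝ (Fin 2)

/-- The Poincaré disk. -/
def Disk : Set E2 := {p : E2 | ‖p‖ < 1}

/-- Conformal factor of the hyperbolic metric. -/
def lam (p : E2) : ℝ := 2 / (1 - ‖p‖ ^ 2)

/-- Inverse hyperbolic cosine. -/
def arcosh (x : ℝ) : ℝ := Real.log (x + Real.sqrt (x ^ 2 - 1))

/-- Hyperbolic distance on the Poincaré disk. -/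
def hDist (p q : E2) : ℝ :=
  arcosh (1 + 2 * ‖p - q‖ ^ 2 / ((1 - ‖p‖ ^ 2) * (1 - ‖q‖ ^ 2)))

/-- Hyperbolic distance from a point to a set. -/
def hDistSet (a : E2) (S : Set E2) : ℝ := sInf (hDist a '' S)

/-- Hyperbolic length of a subset of the disk, via the 1-dimensional Hausdorff measure. -/
def hLen (S : Set E2) : ℝ := ∫ p in S, lam p ∂(μH[1])

/-- Hyperbolic length of a parametrized curve. -/
def hLength (γ : ℝ → E2) (a b : ℝ) : ℝ := ∫ t in a..b, lam (γ t) * ‖deriv γ t‖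

/-- The Poincaré-to-Klein point transfer map. -/
def toKlein (p : E2) : E2 := (2 / (1 + ‖p‖ ^ 2)) • p

/-- The geodesic arc of the Poincaré disk joining two points of the closed disk:
the preimage in the disk of the Euclidean segment joining the corresponding Klein-model
points.  (It contains its endpoints when these are interior, and an ideal endpoint is
automatically excluded.) -/
def geodArc (a b : E2) : Set E2 :=
  {p : E2 | p ∈ Disk ∧ ∃ t ∈ Icc (0:ℝ) 1, toKlein p = (1 - t) • toKlein a + t • toKlein b}

/-- Hyperbolic convexity. -/
def HypConvex (S : Set E2) : Prop := ∀ a ∈ S, ∀ b ∈ S, geodArc a b ⊆ S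

/-- The open hyperbolic disk of radius `R` centered at the origin. -/
def hBall (R : ℝ) : Set E2 := {p ∈ Disk | hDist 0 p < R}

/-- The normalized horizontal projection of the downward normal of the graph of `u`:
`X_u = ∇₀u / √(1 + λ⁻²·|∇₀u|²)`. -/
def Xfield (u : E2 → ℝ) (p : E2) : E2 :=
  (Real.sqrt (1 + ((lam p)⁻¹) ^ 2 * ‖gradient u p‖ ^ 2))⁻¹ • gradient u p

/-- Euclidean divergence of a planar vector field. -/
def div0 (X : E2 → E2) (p : E2) : ℝ :=
  ∑ i : Fin 2, fderiv ℝ X p (EuclideanSpace.single i 1) i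

/-- `u` is a minimal graph on `Ω`: smooth and satisfying the minimal surface equation
`div₀(∇₀u / √(1 + λ⁻²·|∇₀u|²)) = 0`. -/
def IsMinimalGraph (Ω : Set E2) (u : E2 → ℝ) : Prop :=
  ContDiffOn ℝ (⊤ : ℕ∞) u Ω ∧ ∀ p ∈ Ω, div0 (Xfield u) p = 0

/-- Rotation by `-90°`, turning a tangent vector into a normal vector of the same length. -/
def Jrot (v : E2) : E2 :=
  v 1 • EuclideanSpace.single (0 : Fin 2) (1:ℝ) - v 0 • EuclideanSpace.single (1 : Fin 2) (1:ℝ)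

/-- Flux of the vector field `X` along the curve `γ : [a,b] → E2`, with respect to the
normal `Jrot (γ')`:  `∫ ⟨X, η₀⟩ ds₀`. -/
def fluxV (X : E2 → E2) (γ : ℝ → E2) (a b : ℝ) : ℝ :=
  ∫ t in a..b, ⟪X (γ t), Jrot (deriv γ t)⟫

/-- A piecewise `C¹` curve on `[a,b]`. -/
def PiecewiseC1On (γ : ℝ → E2) (a b : ℝ) : Prop :=
  ContinuousOn γ (Icc a b) ∧
  ∃ s : Finset ℝ, ∀ t ∈ Icc a b, t ∉ s → DifferentiableAt ℝ γ t ∧ ContinuousAt (deriv γ) t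

/-- `η` points outward from `Ω` at the boundary point `x`. -/
def OutwardNormalAt (Ω : Set E2) (x η : E2) : Prop :=
  ∀ᶠ ε : ℝ in 𝓝[>] (0:ℝ), x - ε • η ∈ Ω ∧ x + ε • η ∉ closure Ω

/-- A horocycle at an ideal point: a Euclidean circle tangent to the unit circle
from inside at `pt`, with Euclidean radius `r`. -/
structure Horocycle where
  pt : E2
  r : ℝ
  hpt : ‖pt‖ = 1
  hr0 : 0 < r
  hr1 : r < 1

/-- The horocycle as a subset of the disk (the circle itself). -/
def Horocycle.circle (H : Horocycle) : Set E2 := {p : E2 | ‖p - (1 - H.r) • H.pt‖ = H.r}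

/-- The open horodisk bounded by a horocycle. -/
def Horocycle.horodisk (H : Horocycle) : Set E2 := {p : E2 | ‖p - (1 - H.r) • H.pt‖ < H.r}

/-- A semi-ideal polygonal domain with `k` ideal vertices `pI i` and `k` interior
vertices `pB i`, cyclically ordered as `pI 0, pB 0, pI 1, pB 1, …`; its edges are
`A i = geodArc (pI i) (pB i)` and `B i = geodArc (pB i) (pI (i+1))`, and its boundary
inside the disk is exactly the union of the edges. -/
structure SemiIdealDomain (k : ℕ) where
  Ω : Set E2
  pI : ZMod k → E2
  pB : ZMod k → E2
  k_pos : 0 < k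
  isOpen : IsOpen Ω
  conn : IsConnected Ω
  subset : Ω ⊆ Disk
  ideal : ∀ i, ‖pI i‖ = 1
  inter : ∀ i, pB i ∈ Disk
  injI : Function.Injective pI
  injB : Function.Injective pB
  boundary : frontier Ω ∩ Disk =
    (⋃ i, geodArc (pI i) (pB i)) ∪ (⋃ i, geodArc (pB i) (pI (i + 1)))

/-- The edge `A i` of a semi-ideal domain. -/
def SemiIdealDomain.edgeA {k : ℕ} (D : SemiIdealDomain k) (i : ZMod k) : Set E2 :=
  geodArc (D.pI i) (D.pB i)

/-- The edge `B i` of a semi-ideal domain. -/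
def SemiIdealDomain.edgeB {k : ℕ} (D : SemiIdealDomain k) (i : ZMod k) : Set E2 :=
  geodArc (D.pB i) (D.pI (i + 1))

/-- The open edge `A i` (without its endpoints). -/
def SemiIdealDomain.intEdgeA {k : ℕ} (D : SemiIdealDomain k) (i : ZMod k) : Set E2 :=
  D.edgeA i \ {D.pI i, D.pB i}

/-- The open edge `B i` (without its endpoints). -/
def SemiIdealDomain.intEdgeB {k : ℕ} (D : SemiIdealDomain k) (i : ZMod k) : Set E2 :=
  D.edgeB i \ {D.pB i, D.pI (i + 1)}

/-- A general polygonal domain in the Poincaré disk, with cyclically ordered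
vertices `q j` (interior or ideal) and geodesic edges. -/
structure PolygonalDomain where
  P : Set E2
  m : ℕ
  q : ZMod m → E2
  m_pos : 0 < m
  isOpen : IsOpen P
  conn : IsConnected P
  subset : P ⊆ Disk
  vtx : ∀ j, ‖q j‖ ≤ 1
  boundary : frontier P ∩ Disk = ⋃ j, geodArc (q j) (q (j + 1))

/-- A polygonal domain inscribed in a semi-ideal domain: contained in it and all of its
vertices are vertices of the ambient domain. -/
def InscribedIn {k : ℕ} (Q : PolygonalDomain) (D : SemiIdealDomain k) : Prop :=
  Q.P ⊆ D.Ω ∧ ∀ j, Q.q j ∈ Set.range D.pI ∪ Set.range D.pB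

/-- `Γ(𝒫)`: the part of `∂𝒫` (inside the disk) lying outside the horodisks. -/
def GammaSet {k : ℕ} (Q : PolygonalDomain) (H : ZMod k → Horocycle) : Set E2 :=
  (frontier Q.P ∩ Disk) \ ⋃ i, (H i).horodisk

/-- `|Γ(𝒫)|`. -/
def gammaLen {k : ℕ} (Q : PolygonalDomain) (H : ZMod k → Horocycle) : ℝ :=
  hLen (GammaSet Q H)

/-- `α(𝒫) = Σ_i |A_i ∩ Γ(𝒫)|`. -/
def alphaVal {k : ℕ} (D : SemiIdealDomain k) (H : ZMod k → Horocycle)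
    (Q : PolygonalDomain) : ℝ :=
  letI : NeZero k := ⟨D.k_pos.ne'⟩
  ∑ i : ZMod k, hLen (D.edgeA i ∩ GammaSet Q H)

/-- `β(𝒫) = Σ_i |B_i ∩ Γ(𝒫)|`. -/
def betaVal {k : ℕ} (D : SemiIdealDomain k) (H : ZMod k → Horocycle)
    (Q : PolygonalDomain) : ℝ :=
  letI : NeZero k := ⟨D.k_pos.ne'⟩
  ∑ i : ZMod k, hLen (D.edgeB i ∩ GammaSet Q H)

/-- An admissible domain. -/
def Admissible {k : ℕ} (D : SemiIdealDomain k) : Prop :=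
  HypConvex D.Ω ∧
  ∃ H : ZMod k → Horocycle,
    (∀ i, (H i).pt = D.pI i) ∧
    (∀ i j, i ≠ j → Disjoint (H i).circle (H j).circle) ∧
    (∀ i, hDistSet (D.pB (i - 1)) (H i).circle = hDistSet (D.pB i) (H i).circle) ∧
    (∀ Q : PolygonalDomain, InscribedIn Q D → Q.P ≠ D.Ω →
      2 * alphaVal D H Q < gammaLen Q H ∧ 2 * betaVal D H Q < gammaLen Q H)

/-- The Jenkins–Serrin boundary conditions: `u → +∞` on the interior of each edge `A i`,
and `u → −∞` on the interior of each edge `B i`. -/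
def JSBoundary {k : ℕ} (D : SemiIdealDomain k) (u : E2 → ℝ) : Prop :=
  (∀ i, ∀ x ∈ D.intEdgeA i, Tendsto u (𝓝[D.Ω] x) atTop) ∧
  (∀ i, ∀ x ∈ D.intEdgeB i, Tendsto u (𝓝[D.Ω] x) atBot)

/-- An admissible pair. -/
def AdmissiblePair {k : ℕ} (D : SemiIdealDomain k) (u : E2 → ℝ) : Prop :=
  Admissible D ∧ (0 : E2) ∈ D.Ω ∧ u 0 = 0 ∧ IsMinimalGraph D.Ω u ∧ JSBoundary D u

/-- The divergence set of a sequence of minimal graphs. -/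
def DivergenceSet (Ω : Set E2) (u : ℕ → E2 → ℝ) : Set E2 :=
  {p ∈ Ω | ¬ ∃ C : ℝ, ∀ k, ‖gradient (u k) p‖ ≤ C}

/-! ### Unit speed parametrization of geodesics -/

theorem E2.norm_sq (p : E2) : ‖p‖ ^ 2 = p 0 ^ 2 + p 1 ^ 2 := by
  rw [EuclideanSpace.real_norm_sq_eq, Fin.sum_univ_two]

/-- Unit speed parametrization of the complete geodesic from `n₁` to `n₂`. -/
def geo (n₁ n₂ : E2) (t : ℝ) : E2 :=
  (Real.exp t + Real.exp (-t) + ‖n₁ - n₂‖)⁻¹ • (Real.exp t • n₂ + Real.exp (-t) • n₁)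

theorem exp_add_exp_neg_ratio {a s η : ℝ} (h : |s - a| ≤ η) {c : ℝ} (hc : 0 ≤ c) :
    Real.exp s + Real.exp (-s) + c ≤ Real.exp η * (Real.exp a + Real.exp (-a) + c) := by
  have h1 := abs_le.1 h
  have h2 : Real.exp s ≤ Real.exp η * Real.exp a := by
    rw [← Real.exp_add]; exact Real.exp_le_exp.2 (by linarith)
  have h3 : Real.exp (-s) ≤ Real.exp η * Real.exp (-a) := by
    rw [← Real.exp_add]; exact Real.exp_le_exp.2 (by linarith)
  have h4 : c ≤ Real.exp η * c :=
    le_mul_of_one_le_left hc (Real.one_le_exp (le_trans (abs_nonneg _) h))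
  linarith

theorem sq_le_exp_add_exp_neg (x : ℝ) : x ^ 2 ≤ Real.exp x + Real.exp (-x) - 2 := by
  have h1 : Real.exp x + Real.exp (-x) - 2 = (2 * Real.sinh (x / 2)) ^ 2 := by
    have e1 : Real.exp x = Real.exp (x / 2) ^ 2 := by
      rw [← Real.exp_nat_mul]; congr 1; push_cast; ring
    have e2 : Real.exp (-x) = Real.exp (-(x / 2)) ^ 2 := by
      rw [← Real.exp_nat_mul]; congr 1; push_cast; ring
    have e3 : Real.exp (x / 2) * Real.exp (-(x / 2)) = 1 := by
      rw [← Real.exp_add]; simp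
    rw [Real.sinh_eq, e1, e2]; linear_combination 2 * e3
  rw [h1, sq_le_sq, abs_mul, abs_two]
  have h2 : |x / 2| ≤ |Real.sinh (x / 2)| := by
    rcases le_total 0 (x / 2) with h | h
    · rw [abs_of_nonneg h, abs_of_nonneg (Real.sinh_nonneg_iff.2 h)]
      exact Real.self_le_sinh_iff.2 h
    · rw [abs_of_nonpos h, abs_of_nonpos (Real.sinh_nonpos_iff.2 h)]
      exact neg_le_neg (Real.sinh_le_self_iff.2 h)
  rw [abs_div, abs_two] at h2
  linarith

theorem exp_add_exp_neg_le {x η : ℝ} (hx : |x| ≤ η) :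
    Real.exp x + Real.exp (-x) - 2 ≤ x ^ 2 * Real.exp η := by
  have key : ∀ y : ℝ, 0 ≤ y → Real.exp y + Real.exp (-y) - 2 ≤ y ^ 2 * Real.exp y := by
    intro y hy
    have e3 : Real.exp y * Real.exp (-y) = 1 := by rw [← Real.exp_add]; simp
    have h1 : 1 - y ≤ Real.exp (-y) := by linarith [Real.add_one_le_exp (-y)]
    have h2 : Real.exp y - 1 ≤ y * Real.exp y := by
      nlinarith [Real.exp_pos y]
    have h3 : 0 ≤ Real.exp y - 1 := by linarith [Real.one_le_exp hy]
    have h4 : (Real.exp y - 1) ^ 2 ≤ (y * Real.exp y) ^ 2 := by gcongr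
    calc _ = Real.exp (-y) * (Real.exp y - 1) ^ 2 := by linear_combination (2 - Real.exp y) * e3
      _ ≤ Real.exp (-y) * (y * Real.exp y) ^ 2 := by gcongr
      _ = _ := by linear_combination (y ^ 2 * Real.exp y) * e3
  have h1 : Real.exp x + Real.exp (-x) - 2 ≤ x ^ 2 * Real.exp |x| := by
    rcases le_total 0 x with h | h
    · rw [abs_of_nonneg h]; exact key x h
    · rw [abs_of_nonpos h]
      have := key (-x) (by linarith)
      rw [neg_neg] at this
      nlinarith
  exact h1.trans (by gcongr)

section geo
variable {n₁ n₂ : E2}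

theorem geo_denom_pos (n₁ n₂ : E2) (t : ℝ) :
    0 < Real.exp t + Real.exp (-t) + ‖n₁ - n₂‖ := by positivity

theorem exp_mul_exp_neg (t : ℝ) : Real.exp t * Real.exp (-t) = 1 := by
  rw [← Real.exp_add]; simp

theorem norm_geo_aux (h₁ : ‖n₁‖ = 1) (h₂ : ‖n₂‖ = 1) (a b : ℝ) :
    ‖a • n₂ + b • n₁‖ ^ 2 = (a + b) ^ 2 - a * b * ‖n₁ - n₂‖ ^ 2 := by
  have e1 := E2.norm_sq n₁
  have e2 := E2.norm_sq n₂
  rw [h₁] at e1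
  rw [h₂] at e2
  rw [E2.norm_sq, E2.norm_sq]
  simp only [PiLp.add_apply, PiLp.smul_apply, PiLp.sub_apply, smul_eq_mul]
  linear_combination (-(b ^ 2) - a * b) * e1 - (a ^ 2 + a * b) * e2

theorem one_sub_norm_geo_sq (h₁ : ‖n₁‖ = 1) (h₂ : ‖n₂‖ = 1) (t : ℝ) :
    1 - ‖geo n₁ n₂ t‖ ^ 2 =
      2 * ‖n₁ - n₂‖ / (Real.exp t + Real.exp (-t) + ‖n₁ - n₂‖) := by
  have hp := geo_denom_pos n₁ n₂ t
  rw [geo, norm_smul, mul_pow, norm_geo_aux h₁ h₂, Real.norm_eq_abs, sq_abs, exp_mul_exp_neg]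
  field_simp
  ring

theorem geo_mem_disk (h₁ : ‖n₁‖ = 1) (h₂ : ‖n₂‖ = 1) (h : n₁ ≠ n₂) (t : ℝ) :
    geo n₁ n₂ t ∈ Disk := by
  have hp := geo_denom_pos n₁ n₂ t
  have hc : 0 < ‖n₁ - n₂‖ := norm_pos_iff.2 (sub_ne_zero.2 h)
  have := one_sub_norm_geo_sq h₁ h₂ t
  have h3 : 0 < 1 - ‖geo n₁ n₂ t‖ ^ 2 := by rw [this]; positivity
  show ‖geo n₁ n₂ t‖ < 1
  nlinarith [norm_nonneg (geo n₁ n₂ t)]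

theorem lam_geo (h₁ : ‖n₁‖ = 1) (h₂ : ‖n₂‖ = 1) (h : n₁ ≠ n₂) (t : ℝ) :
    lam (geo n₁ n₂ t) = (Real.exp t + Real.exp (-t) + ‖n₁ - n₂‖) / ‖n₁ - n₂‖ := by
  have hp := geo_denom_pos n₁ n₂ t
  have hc : 0 < ‖n₁ - n₂‖ := norm_pos_iff.2 (sub_ne_zero.2 h)
  rw [lam, one_sub_norm_geo_sq h₁ h₂]
  field_simp

theorem toKlein_geo (h₁ : ‖n₁‖ = 1) (h₂ : ‖n₂‖ = 1) (t : ℝ) :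
    toKlein (geo n₁ n₂ t) =
      (Real.exp t + Real.exp (-t))⁻¹ • (Real.exp t • n₂ + Real.exp (-t) • n₁) := by
  have hp := geo_denom_pos n₁ n₂ t
  have hE : 0 < Real.exp t + Real.exp (-t) := by positivity
  have h3 : ‖geo n₁ n₂ t‖ ^ 2 =
      1 - 2 * ‖n₁ - n₂‖ / (Real.exp t + Real.exp (-t) + ‖n₁ - n₂‖) := by
    linarith [one_sub_norm_geo_sq h₁ h₂ t]
  rw [toKlein, h3, geo, smul_smul]
  congr 1
  have h4 : (1 + (1 - 2 * ‖n₁ - n₂‖ / (Real.exp t + Real.exp (-t) + ‖n₁ - n₂‖))) =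
    2 * (Real.exp t + Real.exp (-t)) / (Real.exp t + Real.exp (-t) + ‖n₁ - n₂‖) := by
    field_simp; ring
  rw [h4]
  field_simp

theorem norm_geo_sub_sq (h₁ : ‖n₁‖ = 1) (h₂ : ‖n₂‖ = 1) (s t : ℝ) :
    ‖geo n₁ n₂ s - geo n₁ n₂ t‖ ^ 2 * ((Real.exp s + Real.exp (-s) + ‖n₁ - n₂‖) *
      (Real.exp t + Real.exp (-t) + ‖n₁ - n₂‖)) =
      ‖n₁ - n₂‖ ^ 2 * (Real.exp (s - t) + Real.exp (-(s - t)) - 2) := by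
  have hs := geo_denom_pos n₁ n₂ s
  have ht := geo_denom_pos n₁ n₂ t
  set c := ‖n₁ - n₂‖ with hc
  set S := Real.exp s + Real.exp (-s) + c with hS
  set T := Real.exp t + Real.exp (-t) + c with hT
  have e : geo n₁ n₂ s - geo n₁ n₂ t =
      (S⁻¹ * Real.exp s - T⁻¹ * Real.exp t) • n₂ +
      (S⁻¹ * Real.exp (-s) - T⁻¹ * Real.exp (-t)) • n₁ := by
    simp only [geo, ← hc, ← hS, ← hT]; module
  rw [e, norm_geo_aux h₁ h₂, ← hc, neg_sub, Real.exp_sub, Real.exp_sub]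
  have hes := exp_mul_exp_neg s
  have het := exp_mul_exp_neg t
  have hneg : Real.exp (-s) = (Real.exp s)⁻¹ := Real.exp_neg s
  have hneg' : Real.exp (-t) = (Real.exp t)⁻¹ := Real.exp_neg t
  have p1 := (Real.exp_pos s).ne'
  have p2 := (Real.exp_pos t).ne'
  have hsum : (S⁻¹ * Real.exp s - T⁻¹ * Real.exp t) +
      (S⁻¹ * Real.exp (-s) - T⁻¹ * Real.exp (-t)) = c * (T⁻¹ - S⁻¹) := by
    have q1 : Real.exp s + Real.exp (-s) = S - c := by rw [hS]; ring
    have q2 : Real.exp t + Real.exp (-t) = T - c := by rw [hT]; ring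
    calc _ = S⁻¹ * (Real.exp s + Real.exp (-s)) - T⁻¹ * (Real.exp t + Real.exp (-t)) := by ring
      _ = _ := by rw [q1, q2]; field_simp; ring
  have hprod : (S⁻¹ * Real.exp s - T⁻¹ * Real.exp t) *
      (S⁻¹ * Real.exp (-s) - T⁻¹ * Real.exp (-t)) = S⁻¹ ^ 2 + T⁻¹ ^ 2 -
        S⁻¹ * T⁻¹ * (Real.exp s / Real.exp t + Real.exp t / Real.exp s) := by
    rw [hneg, hneg']; field_simp; ring
  rw [hsum, hprod]
  clear_value S T
  have hs := hs.ne'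
  have ht := ht.ne'
  field_simp
  ring

theorem continuous_geo (n₁ n₂ : E2) : Continuous (geo n₁ n₂) := by
  unfold geo
  refine Continuous.smul (Continuous.inv₀ (by fun_prop) fun t => (geo_denom_pos n₁ n₂ t).ne')
    (by fun_prop)

/-- The unit speed parametrization is almost an isometry, up to the conformal factor, on
short intervals. -/
theorem dist_geo_bounds (h₁ : ‖n₁‖ = 1) (h₂ : ‖n₂‖ = 1) {a s t η : ℝ}
    (hs : |s - a| ≤ η) (ht : |t - a| ≤ η) (hst : |s - t| ≤ η) :
    ‖n₁ - n₂‖ / (Real.exp a + Real.exp (-a) + ‖n₁ - n₂‖) * Real.exp (-(2 * η)) * |s - t|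
      ≤ ‖geo n₁ n₂ s - geo n₁ n₂ t‖ ∧
    ‖geo n₁ n₂ s - geo n₁ n₂ t‖ ≤
      ‖n₁ - n₂‖ / (Real.exp a + Real.exp (-a) + ‖n₁ - n₂‖) * Real.exp (2 * η) * |s - t| := by
  have hη : 0 ≤ η := le_trans (abs_nonneg _) hs
  have pS := geo_denom_pos n₁ n₂ s
  have pT := geo_denom_pos n₁ n₂ t
  have pA := geo_denom_pos n₁ n₂ a
  have key := norm_geo_sub_sq h₁ h₂ s t
  have c0 := norm_nonneg (n₁ - n₂)
  have hs1 := exp_add_exp_neg_ratio hs c0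
  have ht1 := exp_add_exp_neg_ratio ht c0
  have hs2 := exp_add_exp_neg_ratio (s := a) (a := s) (η := η) (by rwa [abs_sub_comm] at hs) c0
  have ht2 := exp_add_exp_neg_ratio (s := a) (a := t) (η := η) (by rwa [abs_sub_comm] at ht) c0
  have x1 := sq_le_exp_add_exp_neg (s - t)
  have x2 := exp_add_exp_neg_le hst
  set c := ‖n₁ - n₂‖
  set S := Real.exp s + Real.exp (-s) + c
  set T := Real.exp t + Real.exp (-t) + c
  set A := Real.exp a + Real.exp (-a) + c
  set X := Real.exp (s - t) + Real.exp (-(s - t)) - 2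
  have hE1 : 1 ≤ Real.exp η := Real.one_le_exp hη
  have hEE : Real.exp (2 * η) = Real.exp η * Real.exp η := by rw [← Real.exp_add]; ring_nf
  have hEn : Real.exp (-(2 * η)) * (Real.exp η * Real.exp η) = 1 := by
    rw [← hEE, mul_comm, exp_mul_exp_neg]
  have hN : Real.exp (-(2 * η)) ≤ 1 := Real.exp_le_one_iff.2 (by linarith)
  have hNp := Real.exp_pos (-(2 * η))
  set e := Real.exp η
  set ν := Real.exp (-(2 * η))
  have hST : S * T ≤ (e * e) * A ^ 2 := by
    calc S * T ≤ (e * A) * (e * A) := by gcongr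
      _ = _ := by ring
  have hAA : A ^ 2 ≤ (e * e) * (S * T) := by
    calc A ^ 2 = A * A := by ring
      _ ≤ (e * S) * (e * T) := by gcongr
      _ = _ := by ring
  have hd : ‖geo n₁ n₂ s - geo n₁ n₂ t‖ ^ 2 = c ^ 2 * X / (S * T) := by
    field_simp; linarith
  have hX : 0 ≤ X := le_trans (sq_nonneg _) x1
  constructor
  · refine (pow_le_pow_iff_left₀ (by positivity) (norm_nonneg _) two_ne_zero).1 ?_
    rw [hd, mul_pow, mul_pow, sq_abs, div_pow, le_div_iff₀ (by positivity)]
    calc c ^ 2 / A ^ 2 * ν ^ 2 * (s - t) ^ 2 * (S * T)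
        ≤ c ^ 2 / A ^ 2 * ν ^ 2 * X * ((e * e) * A ^ 2) := by gcongr
      _ = c ^ 2 * X * (ν * (ν * (e * e))) := by field_simp
      _ = c ^ 2 * X * ν := by rw [hEn, mul_one]
      _ ≤ c ^ 2 * X * 1 := by gcongr
      _ = _ := by ring
  · refine (pow_le_pow_iff_left₀ (norm_nonneg _) (by positivity) two_ne_zero).1 ?_
    rw [hd, mul_pow, mul_pow, sq_abs, div_pow, div_le_iff₀ (by positivity)]
    calc c ^ 2 * X ≤ c ^ 2 / A ^ 2 * A ^ 2 * ((s - t) ^ 2 * e) := by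
          rw [div_mul_cancel₀ _ (by positivity)]; gcongr
      _ ≤ c ^ 2 / A ^ 2 * ((e * e) * (S * T)) * ((s - t) ^ 2 * e) := by gcongr
      _ = c ^ 2 / A ^ 2 * (s - t) ^ 2 * (S * T) * (e * e * e * 1) := by ring
      _ ≤ c ^ 2 / A ^ 2 * (s - t) ^ 2 * (S * T) * (e * e * e * e) := by gcongr
      _ = _ := by rw [hEE]; ring

theorem geo_injective (h₁ : ‖n₁‖ = 1) (h₂ : ‖n₂‖ = 1) (h : n₁ ≠ n₂) :
    Function.Injective (geo n₁ n₂) := by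
  intro s t hst
  have hc : 0 < ‖n₁ - n₂‖ := norm_pos_iff.2 (sub_ne_zero.2 h)
  have key := norm_geo_sub_sq h₁ h₂ s t
  rw [hst, sub_self, norm_zero] at key
  have h2 : Real.exp (s - t) + Real.exp (-(s - t)) - 2 = 0 := by
    have : ‖n₁ - n₂‖ ^ 2 ≠ 0 := by positivity
    have h3 : ‖n₁ - n₂‖ ^ 2 * (Real.exp (s - t) + Real.exp (-(s - t)) - 2) = 0 := by
      rw [← key]; simp
    exact (mul_eq_zero.1 h3).resolve_left this
  have h3 := sq_le_exp_add_exp_neg (s - t)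
  have : (s - t) ^ 2 = 0 := le_antisymm (by linarith) (sq_nonneg _)
  exact sub_eq_zero.1 (pow_eq_zero_iff (two_ne_zero)|>.1 this)

end geo

/-! ### The hyperbolic length measure -/

/-- The hyperbolic length measure. -/
def hypMeas : Measure E2 := (μH[1] : Measure E2).withDensity fun p => ENNReal.ofReal (lam p)

theorem measurable_lam : Measurable lam := by
  unfold lam; fun_prop

theorem lam_pos {p : E2} (hp : p ∈ Disk) : 0 < lam p := by
  have : ‖p‖ < 1 := hp
  have : ‖p‖ ^ 2 < 1 := by nlinarith [norm_nonneg p]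
  unfold lam
  apply div_pos <;> linarith

theorem hLen_eq {S : Set E2} (hS : MeasurableSet S) (hd : S ⊆ Disk) :
    hLen S = (hypMeas S).toReal := by
  rw [hLen, hypMeas, withDensity_apply _ hS, integral_eq_lintegral_of_nonneg_ae]
  · filter_upwards [ae_restrict_mem hS] with p hp using (lam_pos (hd hp)).le
  · exact measurable_lam.aestronglyMeasurable

section geoMeas
variable {n₁ n₂ : E2}

theorem measurableSet_geo_image (h₁ : ‖n₁‖ = 1) (h₂ : ‖n₂‖ = 1) (h : n₁ ≠ n₂) {S : Set ℝ}
    (hS : MeasurableSet S) : MeasurableSet (geo n₁ n₂ '' S) :=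
  hS.image_of_continuousOn_injOn (continuous_geo _ _).continuousOn
    (geo_injective h₁ h₂ h).injOn

theorem hypMeas_geo_image_aux (h₁ : ‖n₁‖ = 1) (h₂ : ‖n₂‖ = 1) (h : n₁ ≠ n₂) {a η : ℝ}
    (hη : 0 < η) {S : Set ℝ} (hS : MeasurableSet S) (hSa : S ⊆ Ico a (a + η)) :
    hypMeas (geo n₁ n₂ '' S) ≤ ENNReal.ofReal (Real.exp (3 * η)) * volume S ∧
    volume S ≤ ENNReal.ofReal (Real.exp (3 * η)) * hypMeas (geo n₁ n₂ '' S) := by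
  have hc : 0 < ‖n₁ - n₂‖ := norm_pos_iff.2 (sub_ne_zero.2 h)
  have pA := geo_denom_pos n₁ n₂ a
  have hb : ∀ s ∈ S, ∀ t ∈ S, _ := fun s hs t ht => dist_geo_bounds h₁ h₂ (a := a) (s := s) (t := t)
    (η := η) (by have := hSa hs; rw [abs_le]; constructor <;> linarith [this.1, this.2])
    (by have := hSa ht; rw [abs_le]; constructor <;> linarith [this.1, this.2])
    (by have := hSa hs; have := hSa ht; rw [abs_le]; constructor <;>
          linarith [(hSa hs).1, (hSa hs).2, (hSa ht).1, (hSa ht).2])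
  have hl : ∀ s ∈ S, lam (geo n₁ n₂ s) ≤ Real.exp η *
        ((Real.exp a + Real.exp (-a) + ‖n₁ - n₂‖) / ‖n₁ - n₂‖) ∧
      (Real.exp a + Real.exp (-a) + ‖n₁ - n₂‖) / ‖n₁ - n₂‖ ≤ Real.exp η *
        lam (geo n₁ n₂ s) := by
    intro s hs
    have hsa : |s - a| ≤ η := by
      have := hSa hs; rw [abs_le]; constructor <;> linarith [this.1, this.2]
    rw [lam_geo h₁ h₂ h, ← mul_div_assoc, ← mul_div_assoc]
    exact ⟨by gcongr; exact exp_add_exp_neg_ratio hsa hc.le,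
      by gcongr; exact exp_add_exp_neg_ratio (by rwa [abs_sub_comm] at hsa) hc.le⟩
  set K := ‖n₁ - n₂‖ / (Real.exp a + Real.exp (-a) + ‖n₁ - n₂‖) with hK
  have hKi : (Real.exp a + Real.exp (-a) + ‖n₁ - n₂‖) / ‖n₁ - n₂‖ = K⁻¹ := by rw [hK, inv_div]
  rw [hKi] at hl
  have hK0 : 0 < K := by positivity
  have hm := measurableSet_geo_image h₁ h₂ h hS
  have hU : (μH[1] : Measure E2) (geo n₁ n₂ '' S) ≤
      ENNReal.ofReal (K * Real.exp (2 * η)) * volume S := by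
    have hL : LipschitzOnWith (K * Real.exp (2 * η)).toNNReal (geo n₁ n₂) S := by
      refine LipschitzOnWith.of_dist_le_mul fun s hs t ht => ?_
      rw [dist_eq_norm, Real.dist_eq, Real.coe_toNNReal _ (by positivity)]
      exact (hb s hs t ht).2
    have := hL.hausdorffMeasure_image_le (d := 1) zero_le_one
    rwa [hausdorffMeasure_real, ENNReal.rpow_one] at this
  have hD : volume S ≤ ENNReal.ofReal (K⁻¹ * Real.exp (2 * η)) *
      (μH[1] : Measure E2) (geo n₁ n₂ '' S) := by
    have hinv := Function.leftInverse_invFun (geo_injective h₁ h₂ h)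
    have hL : LipschitzOnWith (K⁻¹ * Real.exp (2 * η)).toNNReal (Function.invFun (geo n₁ n₂))
        (geo n₁ n₂ '' S) := by
      refine LipschitzOnWith.of_dist_le_mul ?_
      rintro _ ⟨s, hs, rfl⟩ _ ⟨t, ht, rfl⟩
      rw [hinv, hinv, dist_eq_norm (geo n₁ n₂ s), Real.dist_eq,
        Real.coe_toNNReal _ (by positivity)]
      have h1 := (hb s hs t ht).1
      have h2 := exp_mul_exp_neg (2 * η)
      calc |s - t| = K⁻¹ * (Real.exp (2 * η)) * (K * Real.exp (-(2 * η)) * |s - t|) := by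
            field_simp; rw [mul_assoc, h2, mul_one]
        _ ≤ _ := by gcongr
    have := hL.hausdorffMeasure_image_le (d := 1) zero_le_one
    rwa [ENNReal.rpow_one, hinv.image_image, hausdorffMeasure_real] at this
  have e3 : Real.exp (3 * η) = Real.exp η * Real.exp (2 * η) := by
    rw [← Real.exp_add]; ring_nf
  constructor
  · have h1 : hypMeas (geo n₁ n₂ '' S) ≤
        ENNReal.ofReal (Real.exp η * K⁻¹) * (μH[1] : Measure E2) (geo n₁ n₂ '' S) := by
      rw [hypMeas, withDensity_apply _ hm, ← setLIntegral_const]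
      refine setLIntegral_mono measurable_const ?_
      rintro _ ⟨s, hs, rfl⟩
      exact ENNReal.ofReal_le_ofReal (hl s hs).1
    calc _ ≤ _ := h1
      _ ≤ ENNReal.ofReal (Real.exp η * K⁻¹) *
          (ENNReal.ofReal (K * Real.exp (2 * η)) * volume S) := by gcongr
      _ = _ := by
        rw [← mul_assoc, ← ENNReal.ofReal_mul (by positivity), e3]
        congr 2; field_simp
  · have h1 : (μH[1] : Measure E2) (geo n₁ n₂ '' S) ≤
        ENNReal.ofReal (Real.exp η * K) * hypMeas (geo n₁ n₂ '' S) := by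
      have h2 : ENNReal.ofReal (Real.exp (-η) * K⁻¹) * (μH[1] : Measure E2) (geo n₁ n₂ '' S) ≤
          hypMeas (geo n₁ n₂ '' S) := by
        rw [hypMeas, withDensity_apply _ hm, ← setLIntegral_const]
        refine setLIntegral_mono measurable_lam.ennreal_ofReal ?_
        rintro _ ⟨s, hs, rfl⟩
        refine ENNReal.ofReal_le_ofReal ?_
        calc Real.exp (-η) * K⁻¹ ≤ Real.exp (-η) * (Real.exp η * lam (geo n₁ n₂ s)) := by
              gcongr; exact (hl s hs).2
          _ = lam (geo n₁ n₂ s) := by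
              rw [← mul_assoc, mul_comm (Real.exp (-η)), exp_mul_exp_neg, one_mul]
      calc _ = ENNReal.ofReal (Real.exp η * K) * (ENNReal.ofReal (Real.exp (-η) * K⁻¹) *
            (μH[1] : Measure E2) (geo n₁ n₂ '' S)) := by
            rw [← mul_assoc, ← ENNReal.ofReal_mul (by positivity)]
            have : Real.exp η * K * (Real.exp (-η) * K⁻¹) = 1 := by
              field_simp; rw [exp_mul_exp_neg]
            rw [this, ENNReal.ofReal_one, one_mul]
        _ ≤ _ := by gcongr
    calc _ ≤ _ := hD
      _ ≤ ENNReal.ofReal (K⁻¹ * Real.exp (2 * η)) *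
          (ENNReal.ofReal (Real.exp η * K) * hypMeas (geo n₁ n₂ '' S)) := by gcongr
      _ = _ := by
        rw [← mul_assoc, ← ENNReal.ofReal_mul (by positivity), e3]
        congr 2; field_simp

/-- Hyperbolic length along a geodesic is the length in the unit speed parameter. -/
theorem hypMeas_geo_image (h₁ : ‖n₁‖ = 1) (h₂ : ‖n₂‖ = 1) (h : n₁ ≠ n₂) {S : Set ℝ}
    (hS : MeasurableSet S) : hypMeas (geo n₁ n₂ '' S) = volume S := by
  have key : ∀ η : ℝ, 0 < η →
      hypMeas (geo n₁ n₂ '' S) ≤ ENNReal.ofReal (Real.exp (3 * η)) * volume S ∧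
      volume S ≤ ENNReal.ofReal (Real.exp (3 * η)) * hypMeas (geo n₁ n₂ '' S) := by
    intro η hη
    have hU : S = ⋃ n : ℤ, S ∩ Ico (n • η) ((n + 1) • η) := by
      rw [← inter_iUnion, iUnion_Ico_zsmul hη, inter_univ]
    have hdis : Pairwise (Function.onFun Disjoint fun n : ℤ => S ∩ Ico (n • η) ((n + 1) • η)) :=
      fun i j hij => (pairwise_disjoint_Ico_zsmul η hij).mono inter_subset_right inter_subset_right
    have hme : ∀ n : ℤ, MeasurableSet (S ∩ Ico (n • η) ((n + 1) • η)) :=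
      fun n => hS.inter measurableSet_Ico
    have hv : volume S = ∑' n : ℤ, volume (S ∩ Ico (n • η) ((n + 1) • η)) := by
      conv_lhs => rw [hU]
      exact measure_iUnion hdis hme
    have hg : hypMeas (geo n₁ n₂ '' S) =
        ∑' n : ℤ, hypMeas (geo n₁ n₂ '' (S ∩ Ico (n • η) ((n + 1) • η))) := by
      conv_lhs => rw [hU, image_iUnion]
      refine measure_iUnion (fun i j hij => ?_) fun n => measurableSet_geo_image h₁ h₂ h (hme n)
      exact (disjoint_image_iff (geo_injective h₁ h₂ h)).2 (hdis hij)
    have haux := fun n : ℤ => hypMeas_geo_image_aux h₁ h₂ h hη (hme n) (a := n • η) (by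
      rw [add_smul, one_smul]; exact inter_subset_right)
    rw [hv, hg, ← ENNReal.tsum_mul_left, ← ENNReal.tsum_mul_left]
    exact ⟨ENNReal.tsum_le_tsum fun n => (haux n).1, ENNReal.tsum_le_tsum fun n => (haux n).2⟩
  have hlim : ∀ x : ENNReal, Tendsto (fun η : ℝ => ENNReal.ofReal (Real.exp (3 * η)) * x)
      (𝓝[>] 0) (𝓝 x) := by
    intro x
    have h1 : Tendsto (fun η : ℝ => ENNReal.ofReal (Real.exp (3 * η))) (𝓝[>] 0) (𝓝 1) := by
      have : Continuous fun η : ℝ => ENNReal.ofReal (Real.exp (3 * η)) :=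
        ENNReal.continuous_ofReal.comp (by fun_prop)
      have h2 := (this.tendsto 0).mono_left (nhdsWithin_le_nhds (s := Ioi 0))
      simpa using h2
    have := ENNReal.Tendsto.mul_const (b := x) h1 (Or.inl one_ne_zero)
    rwa [one_mul] at this
  apply le_antisymm
  · exact ge_of_tendsto (hlim _) (eventually_nhdsWithin_of_forall fun η hη => (key η hη).1)
  · exact ge_of_tendsto (hlim _) (eventually_nhdsWithin_of_forall fun η hη => (key η hη).2)

end geoMeas

/-! ### The Klein model -/

/-- The inverse of `toKlein` on the disk. -/
def fromKlein (y : E2) : E2 := (1 + Real.sqrt (1 - ‖y‖ ^ 2))⁻¹ • y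

theorem continuous_toKlein : Continuous toKlein := by
  unfold toKlein
  refine Continuous.smul (Continuous.div (f := fun _ : E2 => (2 : ℝ)) (g := fun p : E2 => 1 + ‖p‖ ^ 2)
    continuous_const (by fun_prop) fun p => ?_) continuous_id
  positivity

theorem continuous_fromKlein : Continuous fromKlein := by
  unfold fromKlein
  refine Continuous.smul (Continuous.inv₀ (f := fun y : E2 => 1 + Real.sqrt (1 - ‖y‖ ^ 2))
    (by fun_prop) fun p => ?_) continuous_id
  positivity

theorem mem_disk {p : E2} : p ∈ Disk ↔ ‖p‖ < 1 := Iff.rfl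

theorem isOpen_disk : IsOpen Disk := isOpen_lt continuous_norm continuous_const

theorem norm_sq_lt_one {p : E2} (hp : p ∈ Disk) : ‖p‖ ^ 2 < 1 := by
  have : ‖p‖ < 1 := hp
  nlinarith [norm_nonneg p]

theorem norm_toKlein (p : E2) : ‖toKlein p‖ = 2 * ‖p‖ / (1 + ‖p‖ ^ 2) := by
  rw [toKlein, norm_smul, Real.norm_eq_abs, abs_of_pos (by positivity)]; ring

theorem toKlein_mem_disk {p : E2} (hp : p ∈ Disk) : toKlein p ∈ Disk := by
  have : ‖p‖ < 1 := hp
  rw [mem_disk, norm_toKlein, div_lt_one (by positivity)]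
  nlinarith

theorem toKlein_of_norm_eq_one {p : E2} (hp : ‖p‖ = 1) : toKlein p = p := by
  rw [toKlein, hp]; norm_num

theorem fromKlein_toKlein {p : E2} (hp : ‖p‖ ≤ 1) : fromKlein (toKlein p) = p := by
  have h1 : 1 - ‖toKlein p‖ ^ 2 = ((1 - ‖p‖ ^ 2) / (1 + ‖p‖ ^ 2)) ^ 2 := by
    rw [norm_toKlein]; field_simp; ring
  have h0 : 0 ≤ 1 - ‖p‖ ^ 2 := by nlinarith [norm_nonneg p]
  rw [fromKlein, h1, Real.sqrt_sq (by positivity), toKlein, smul_smul]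
  have : (1 + (1 - ‖p‖ ^ 2) / (1 + ‖p‖ ^ 2))⁻¹ * (2 / (1 + ‖p‖ ^ 2)) = 1 := by
    field_simp; ring
  rw [this, one_smul]

theorem toKlein_fromKlein {y : E2} (hy : ‖y‖ ≤ 1) : toKlein (fromKlein y) = y := by
  have h0 : 0 ≤ 1 - ‖y‖ ^ 2 := by nlinarith [norm_nonneg y]
  have hs := Real.sq_sqrt h0
  have hs0 := Real.sqrt_nonneg (1 - ‖y‖ ^ 2)
  set s := Real.sqrt (1 - ‖y‖ ^ 2)
  have h2 : ‖fromKlein y‖ ^ 2 = (1 - s) / (1 + s) := by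
    have : ‖y‖ ^ 2 = (1 - s) * (1 + s) := by linear_combination hs
    rw [fromKlein, norm_smul, mul_pow, Real.norm_eq_abs, sq_abs]
    change ((1 + s)⁻¹) ^ 2 * ‖y‖ ^ 2 = _
    rw [this]
    field_simp
  rw [toKlein, h2, fromKlein, smul_smul]
  have : 2 / (1 + (1 - s) / (1 + s)) * (1 + s)⁻¹ = 1 := by field_simp; ring
  rw [this, one_smul]

theorem fromKlein_mem_disk {y : E2} (hy : y ∈ Disk) : fromKlein y ∈ Disk := by
  have h0 : 0 < Real.sqrt (1 - ‖y‖ ^ 2) := Real.sqrt_pos.2 (by linarith [norm_sq_lt_one hy])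
  rw [mem_disk, fromKlein, norm_smul, Real.norm_eq_abs, abs_of_pos (by positivity)]
  have : ‖y‖ < 1 := hy
  rw [inv_mul_lt_iff₀ (by positivity)]
  linarith

theorem toKlein_injOn : InjOn toKlein {p : E2 | ‖p‖ ≤ 1} := fun p hp q hq h => by
  rw [← fromKlein_toKlein hp, ← fromKlein_toKlein hq, h]

theorem mem_geodArc {a b p : E2} :
    p ∈ geodArc a b ↔ p ∈ Disk ∧ toKlein p ∈ segment ℝ (toKlein a) (toKlein b) := by
  rw [segment_eq_image]
  constructor
  · rintro ⟨h, t, ht, e⟩; exact ⟨h, t, ht, e.symm⟩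
  · rintro ⟨h, t, ht, e⟩; exact ⟨h, t, ht, e.symm⟩

theorem geodArc_comm (a b : E2) : geodArc a b = geodArc b a := by
  ext p; rw [mem_geodArc, mem_geodArc, segment_symm]

theorem geodArc_subset_disk (a b : E2) : geodArc a b ⊆ Disk := fun _ h => h.1

theorem isClosed_segment (x y : E2) : IsClosed (segment ℝ x y) := by
  rw [segment_eq_image]
  refine (isCompact_Icc.image ?_).isClosed
  fun_prop

theorem measurableSet_geodArc (a b : E2) : MeasurableSet (geodArc a b) := by
  have : geodArc a b = Disk ∩ toKlein ⁻¹' (segment ℝ (toKlein a) (toKlein b)) := by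
    ext p; exact mem_geodArc
  rw [this]
  exact isOpen_disk.measurableSet.inter
    ((isClosed_segment _ _).preimage continuous_toKlein).measurableSet

/-! ### Parametrization of geodesic arcs -/

/-- The affine parameter in the Klein model of the point at arclength `t`. -/
def sig (t : ℝ) : ℝ := (Real.exp t + Real.exp (-t))⁻¹ * Real.exp t

theorem sig_pos (t : ℝ) : 0 < sig t := by unfold sig; positivity

theorem one_sub_sig (t : ℝ) : 1 - sig t = (Real.exp t + Real.exp (-t))⁻¹ * Real.exp (-t) := by
  have : 0 < Real.exp t + Real.exp (-t) := by positivity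
  unfold sig; field_simp; ring

theorem sig_lt_one (t : ℝ) : sig t < 1 := by
  have : 0 < 1 - sig t := by rw [one_sub_sig]; positivity
  linarith

theorem sig_strictMono : StrictMono sig := by
  intro s t h
  unfold sig
  rw [inv_mul_eq_div, inv_mul_eq_div, div_lt_div_iff₀ (by positivity) (by positivity)]
  have h1 : Real.exp s < Real.exp t := Real.exp_lt_exp.2 h
  have h2 : Real.exp (-t) < Real.exp (-s) := Real.exp_lt_exp.2 (by linarith)
  nlinarith [Real.exp_pos s, Real.exp_pos (-t)]

theorem exists_sig_eq {θ : ℝ} (h0 : 0 < θ) (h1 : θ < 1) : ∃ t, sig t = θ := by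
  refine ⟨Real.log (θ / (1 - θ)) / 2, ?_⟩
  set t := Real.log (θ / (1 - θ)) / 2
  have h1' : 0 < 1 - θ := by linarith
  have e : Real.exp t * Real.exp t = θ / (1 - θ) := by
    rw [← Real.exp_add, ← Real.exp_log (div_pos h0 h1')]; congr 1; simp only [t]; ring
  have hp := Real.exp_pos t
  rw [sig, Real.exp_neg]
  have : Real.exp t ^ 2 * (1 - θ) = θ := by rw [sq, e]; field_simp
  field_simp
  linarith

section param
variable {n₁ n₂ : E2}

theorem toKlein_geo' (h₁ : ‖n₁‖ = 1) (h₂ : ‖n₂‖ = 1) (t : ℝ) :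
    toKlein (geo n₁ n₂ t) = AffineMap.lineMap n₁ n₂ (sig t) := by
  rw [toKlein_geo h₁ h₂, AffineMap.lineMap_apply_module, one_sub_sig, sig, smul_add, smul_smul,
    smul_smul, add_comm]

theorem toKlein_lineMap_iff (h₁ : ‖n₁‖ = 1) (h₂ : ‖n₂‖ = 1) (h : n₁ ≠ n₂) {p : E2} (hp : p ∈ Disk)
    (t : ℝ) : toKlein p = AffineMap.lineMap n₁ n₂ (sig t) ↔ geo n₁ n₂ t = p := by
  rw [← toKlein_geo' h₁ h₂]
  constructor
  · intro e
    exact (toKlein_injOn (mem_disk.1 hp).le (mem_disk.1 (geo_mem_disk h₁ h₂ h t)).le e).symm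
  · rintro rfl; rfl

/-- If `x` and `y` lie in the closed disk, the ray from `x` through `y` leaves it. -/
theorem exists_exit {x y : E2} (hy : ‖y‖ ≤ 1) (h : x ≠ y) :
    ∃ τ : ℝ, 1 ≤ τ ∧ ‖AffineMap.lineMap x y τ‖ = 1 := by
  have hpos : 0 < ‖y - x‖ := norm_pos_iff.2 (sub_ne_zero.2 h.symm)
  set T := 1 + (1 + ‖x‖) / ‖y - x‖ with hT
  have hT1 : 1 ≤ T := by rw [hT]; have : 0 ≤ (1 + ‖x‖) / ‖y - x‖ := by positivity
                         linarith
  have hc : ContinuousOn (fun τ : ℝ => ‖AffineMap.lineMap x y τ‖) (Icc 1 T) := by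
    refine Continuous.continuousOn ?_
    have : Continuous fun τ : ℝ => AffineMap.lineMap x y τ := AffineMap.lineMap_continuous
    exact this.norm
  have hTn : 1 ≤ ‖AffineMap.lineMap x y T‖ := by
    rw [AffineMap.lineMap_apply, vsub_eq_sub, vadd_eq_add]
    have h1 : ‖T • (y - x)‖ - ‖x‖ ≤ ‖T • (y - x) + x‖ := by
      have := norm_sub_norm_le (T • (y - x)) (-x)
      rwa [norm_neg, sub_neg_eq_add] at this
    have h2 : ‖T • (y - x)‖ = ‖y - x‖ + (1 + ‖x‖) := by
      rw [norm_smul, Real.norm_eq_abs, abs_of_pos (by linarith), hT]; field_simp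
    linarith
  obtain ⟨τ, hτ, e⟩ := intermediate_value_Icc hT1 hc
    (show (1:ℝ) ∈ Icc _ _ from ⟨by simpa using hy, hTn⟩)
  exact ⟨τ, hτ.1, e⟩

theorem lineMap_mem_disk (h₁ : ‖n₁‖ ≤ 1) (h₂ : ‖n₂‖ ≤ 1) (h : n₁ ≠ n₂) {θ : ℝ} (h0 : 0 < θ)
    (h1 : θ < 1) : AffineMap.lineMap n₁ n₂ θ ∈ Disk := by
  have := norm_combo_lt_of_ne h₁ h₂ h (sub_pos.2 h1) h0 (by ring)
  rwa [← AffineMap.lineMap_apply_module] at this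

theorem segment_eq_lineMap (x y : E2) : segment ℝ x y = AffineMap.lineMap x y '' Icc (0:ℝ) 1 :=
  segment_eq_image_lineMap ℝ x y

theorem geodArc_ideal_ideal (h₁ : ‖n₁‖ = 1) (h₂ : ‖n₂‖ = 1) (h : n₁ ≠ n₂) :
    geodArc n₁ n₂ = range (geo n₁ n₂) := by
  ext p
  rw [mem_geodArc, toKlein_of_norm_eq_one h₁, toKlein_of_norm_eq_one h₂, segment_eq_lineMap]
  constructor
  · rintro ⟨hp, θ, ⟨h0, h1⟩, e⟩
    have hk : ‖toKlein p‖ < 1 := toKlein_mem_disk hp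
    have h0' : 0 < θ := by
      refine lt_of_le_of_ne h0 fun h' => ?_
      rw [← e, ← h', AffineMap.lineMap_apply_zero, h₁] at hk; exact lt_irrefl _ hk
    have h1' : θ < 1 := by
      refine lt_of_le_of_ne h1 fun h' => ?_
      rw [← e, h', AffineMap.lineMap_apply_one, h₂] at hk; exact lt_irrefl _ hk
    obtain ⟨t, rfl⟩ := exists_sig_eq h0' h1'
    exact ⟨t, (toKlein_lineMap_iff h₁ h₂ h hp t).1 e.symm⟩
  · rintro ⟨t, rfl⟩
    exact ⟨geo_mem_disk h₁ h₂ h t, sig t, ⟨(sig_pos t).le, (sig_lt_one t).le⟩,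
      (toKlein_geo' h₁ h₂ t).symm⟩

theorem segment_lineMap (n₁ n₂ : E2) {a b : ℝ} (hab : a ≤ b) :
    segment ℝ (AffineMap.lineMap n₁ n₂ a) (AffineMap.lineMap n₁ n₂ b) =
      AffineMap.lineMap n₁ n₂ '' Icc a b := by
  rw [← segment_eq_Icc hab]
  exact (image_segment ℝ (AffineMap.lineMap n₁ n₂ : ℝ →ᵃ[ℝ] E2) a b).symm

theorem lineMap_inj (h : n₁ ≠ n₂) : Function.Injective (AffineMap.lineMap n₁ n₂ : ℝ → E2) :=
  AffineMap.lineMap_injective ℝ h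

theorem geodArc_ray {q u : E2} (hq : ‖q‖ = 1) (hu : u ∈ Disk) :
    ∃ n, ‖n‖ = 1 ∧ n ≠ q ∧ ∃ t₀, geo n q t₀ = u ∧ geodArc q u = geo n q '' Ici t₀ := by
  have hku : ‖toKlein u‖ < 1 := toKlein_mem_disk hu
  have hne : q ≠ toKlein u := fun h => by rw [← h, hq] at hku; exact lt_irrefl _ hku
  obtain ⟨τ, hτ, e⟩ := exists_exit hku.le hne
  set n := AffineMap.lineMap q (toKlein u) τ with hn
  have hτ1 : 1 < τ := by
    refine lt_of_le_of_ne hτ fun h' => ?_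
    rw [hn, ← h', AffineMap.lineMap_apply_one] at e; linarith
  have hnq : n ≠ q := by
    intro h'
    have : (AffineMap.lineMap q (toKlein u) τ : E2) = AffineMap.lineMap q (toKlein u) (0:ℝ) := by
      rw [← hn, h', AffineMap.lineMap_apply_zero]
    have := lineMap_inj hne this
    linarith
  have hu' : toKlein u = AffineMap.lineMap n q (1 - 1 / τ) := by
    have : (1 - (1 - 1 / τ)) * τ = 1 := by field_simp; ring
    rw [AffineMap.lineMap_apply_module, hn, AffineMap.lineMap_apply_module, smul_add, smul_smul,
      smul_smul, this, add_right_comm, ← add_smul]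
    have : (1 - (1 - 1 / τ)) * (1 - τ) + (1 - 1 / τ) = 0 := by field_simp; ring
    rw [this, zero_smul, one_smul, zero_add]
  have hτi : 1 / τ < 1 := by rw [div_lt_one (by linarith)]; exact hτ1
  have hτp : 0 < 1 / τ := by positivity
  obtain ⟨t₀, ht₀⟩ := exists_sig_eq (θ := 1 - 1 / τ) (by linarith) (by linarith)
  rw [← ht₀] at hu'
  refine ⟨n, e, hnq, t₀, (toKlein_lineMap_iff e hq hnq hu t₀).1 hu', ?_⟩
  ext p
  have h1 : q = AffineMap.lineMap n q (1:ℝ) := (AffineMap.lineMap_apply_one _ _).symm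
  have hs : segment ℝ (toKlein q) (toKlein u) = AffineMap.lineMap n q '' Icc (sig t₀) 1 := by
    rw [toKlein_of_norm_eq_one hq, hu', segment_symm, ← segment_lineMap _ _ (sig_lt_one t₀).le,
      AffineMap.lineMap_apply_one]
  rw [mem_geodArc, hs]
  constructor
  · rintro ⟨hp, θ, ⟨h0, h1⟩, e'⟩
    have hk : ‖toKlein p‖ < 1 := toKlein_mem_disk hp
    have h1' : θ < 1 := by
      refine lt_of_le_of_ne h1 fun h' => ?_
      rw [← e', h', AffineMap.lineMap_apply_one, hq] at hk; exact lt_irrefl _ hk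
    obtain ⟨t, rfl⟩ := exists_sig_eq ((sig_pos t₀).trans_le h0) h1'
    exact ⟨t, sig_strictMono.le_iff_le.1 h0, (toKlein_lineMap_iff e hq hnq hp t).1 e'.symm⟩
  · rintro ⟨t, ht, rfl⟩
    exact ⟨geo_mem_disk e hq hnq t, sig t, ⟨sig_strictMono.monotone ht, (sig_lt_one t).le⟩,
      (toKlein_geo' e hq t).symm⟩

theorem geodArc_seg {u v : E2} (hu : u ∈ Disk) (hv : v ∈ Disk) (huv : u ≠ v) :
    ∃ n₁ n₂, ‖n₁‖ = 1 ∧ ‖n₂‖ = 1 ∧ n₁ ≠ n₂ ∧ ∃ a b, a < b ∧ geo n₁ n₂ a = u ∧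
      geo n₁ n₂ b = v ∧ geodArc u v = geo n₁ n₂ '' Icc a b := by
  have hku : ‖toKlein u‖ < 1 := toKlein_mem_disk hu
  have hkv : ‖toKlein v‖ < 1 := toKlein_mem_disk hv
  have hne : toKlein u ≠ toKlein v := fun h => huv (toKlein_injOn (mem_disk.1 hu).le (mem_disk.1 hv).le h)
  obtain ⟨τ, hτ, e⟩ := exists_exit hkv.le hne
  set n := AffineMap.lineMap (toKlein u) (toKlein v) τ with hn
  have hτ1 : 1 < τ := by
    refine lt_of_le_of_ne hτ fun h' => ?_
    rw [hn, ← h', AffineMap.lineMap_apply_one] at e; linarith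
  obtain ⟨m, hm, hmn, a, ha, harc⟩ := geodArc_ray e hu
  have hka : toKlein u = AffineMap.lineMap m n (sig a) := by rw [← ha, toKlein_geo' hm e]
  have hv' : toKlein v = AffineMap.lineMap m n (sig a + (1 - sig a) / τ) := by
    have h1 : toKlein v = toKlein u + (1 / τ) • (n - toKlein u) := by
      rw [hn, AffineMap.lineMap_apply, vsub_eq_sub, vadd_eq_add, add_sub_cancel_right, smul_smul]
      have : 1 / τ * τ = 1 := by field_simp
      rw [this, one_smul]; abel
    rw [h1, hka, AffineMap.lineMap_apply_module, AffineMap.lineMap_apply_module]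
    (match_scalars <;> field_simp); all_goals ring
  have hs1 := sig_lt_one a
  have hs0 := sig_pos a
  have hpos : 0 < (1 - sig a) / τ := div_pos (by linarith) (by linarith)
  have hlt : (1 - sig a) / τ < 1 - sig a := div_lt_self (by linarith) hτ1
  obtain ⟨b, hb⟩ := exists_sig_eq (θ := sig a + (1 - sig a) / τ) (by linarith) (by linarith)
  rw [← hb] at hv'
  have hab : a < b := sig_strictMono.lt_iff_lt.1 (by rw [hb]; linarith)
  refine ⟨m, n, hm, e, hmn, a, b, hab, ha, (toKlein_lineMap_iff hm e hmn hv b).1 hv', ?_⟩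
  ext p
  rw [mem_geodArc, hka, hv', segment_lineMap _ _ (sig_strictMono.monotone hab.le)]
  constructor
  · rintro ⟨hp, θ, ⟨h0, h1⟩, e'⟩
    obtain ⟨t, rfl⟩ := exists_sig_eq (hs0.trans_le h0) (h1.trans_lt (sig_lt_one b))
    exact ⟨t, ⟨sig_strictMono.le_iff_le.1 h0, sig_strictMono.le_iff_le.1 h1⟩,
      (toKlein_lineMap_iff hm e hmn hp t).1 e'.symm⟩
  · rintro ⟨t, ht, rfl⟩
    exact ⟨geo_mem_disk hm e hmn t, sig t,
      ⟨sig_strictMono.monotone ht.1, sig_strictMono.monotone ht.2⟩, (toKlein_geo' hm e t).symm⟩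

end param

theorem hypMeas_singleton (p : E2) : hypMeas {p} = 0 :=
  withDensity_absolutelyContinuous _ _ (by
    have := Measure.nullSingletonClass_hausdorff E2 (d := 1) one_pos
    exact measure_singleton p)

theorem hypMeas_subsingleton {S : Set E2} (hS : S.Subsingleton) : hypMeas S = 0 := by
  rcases hS.eq_empty_or_singleton with rfl | ⟨p, rfl⟩
  · exact measure_empty
  · exact hypMeas_singleton p

/-! ### Heights over horocycles -/

/-- The planar cross product. -/
def cr (u v : E2) : ℝ := u 0 * v 1 - u 1 * v 0

/-- The exponential of the Busemann function of the ideal point `q`. -/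
def busW (q p : E2) : ℝ := ‖p - q‖ ^ 2 / (1 - ‖p‖ ^ 2)

/-- The height of the horocycle above the normalized one. -/
def Horocycle.lev (H : Horocycle) : ℝ := Real.log (H.r / (1 - H.r))

/-- The signed hyperbolic distance to a horocycle, negative inside the horodisk. -/
def Horocycle.ht (H : Horocycle) (p : E2) : ℝ := Real.log (busW H.pt p) - H.lev

/-- The length of the part outside two horodisks of the geodesic joining their ideal points. -/
def Horocycle.gap (H H' : Horocycle) : ℝ :=
  Real.log (‖H.pt - H'.pt‖ ^ 2 / 4) - H.lev - H'.lev

theorem Horocycle.gap_comm (H H' : Horocycle) : H.gap H' = H'.gap H := by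
  unfold Horocycle.gap; rw [norm_sub_rev]; ring

theorem E2.norm_sub_sq (p q : E2) (hq : ‖q‖ = 1) :
    ‖p - q‖ ^ 2 = p 0 ^ 2 + p 1 ^ 2 + 1 - 2 * (q 0 * p 0 + q 1 * p 1) := by
  have h := E2.norm_sq q
  rw [hq] at h
  rw [E2.norm_sq]
  simp only [PiLp.sub_apply]
  linear_combination -h

theorem busW_pos {q p : E2} (hq : ‖q‖ = 1) (hp : p ∈ Disk) : 0 < busW q p := by
  have hne : p ≠ q := fun h => by rw [h, mem_disk, hq] at hp; exact lt_irrefl _ hp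
  have := norm_pos_iff.2 (sub_ne_zero.2 hne)
  have := norm_sq_lt_one hp
  exact div_pos (by positivity) (by linarith)

theorem Horocycle.sub_sq_formula (H : Horocycle) (p : E2) :
    H.r ^ 2 - ‖p - (1 - H.r) • H.pt‖ ^ 2 =
      H.r * (1 - ‖p‖ ^ 2) - (1 - H.r) * ‖p - H.pt‖ ^ 2 := by
  have h := E2.norm_sq H.pt
  rw [H.hpt] at h
  rw [E2.norm_sub_sq p _ H.hpt, E2.norm_sq, E2.norm_sq p]
  simp only [PiLp.sub_apply, PiLp.smul_apply, smul_eq_mul]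
  linear_combination (1 - H.r) ^ 2 * h

theorem Horocycle.ht_neg_iff (H : Horocycle) {p : E2} (hp : p ∈ Disk) :
    H.ht p < 0 ↔ p ∈ H.horodisk := by
  have h0 := H.hr0
  have h1 : 0 < 1 - H.r := by linarith [H.hr1]
  have hd : 0 < 1 - ‖p‖ ^ 2 := by linarith [norm_sq_lt_one hp]
  rw [Horocycle.ht, sub_neg, Horocycle.lev, Real.log_lt_log_iff (busW_pos H.hpt hp)
    (div_pos h0 h1), busW, div_lt_div_iff₀ hd h1]
  show _ ↔ ‖p - (1 - H.r) • H.pt‖ < H.r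
  rw [← sq_lt_sq₀ (norm_nonneg _) h0.le]
  have := H.sub_sq_formula p
  constructor <;> intro h <;> nlinarith

theorem Horocycle.ht_eq_zero_iff (H : Horocycle) {p : E2} (hp : p ∈ Disk) :
    H.ht p = 0 ↔ p ∈ H.circle := by
  have h0 := H.hr0
  have h1 : 0 < 1 - H.r := by linarith [H.hr1]
  have hd : 0 < 1 - ‖p‖ ^ 2 := by linarith [norm_sq_lt_one hp]
  rw [Horocycle.ht, sub_eq_zero, Horocycle.lev,
    (Real.log_injOn_pos).eq_iff (busW_pos H.hpt hp) (div_pos h0 h1), busW,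
    div_eq_div_iff hd.ne' h1.ne']
  show _ ↔ ‖p - (1 - H.r) • H.pt‖ = H.r
  rw [← sq_eq_sq₀ (norm_nonneg _) h0.le]
  have := H.sub_sq_formula p
  constructor <;> intro h <;> linarith

theorem Horocycle.ht_nonpos_iff (H : Horocycle) {p : E2} (hp : p ∈ Disk) :
    H.ht p ≤ 0 ↔ p ∈ closure H.horodisk := by
  have e : H.horodisk = Metric.ball ((1 - H.r) • H.pt) H.r := by
    ext p; simp [Horocycle.horodisk, Metric.mem_ball, dist_eq_norm]
  rw [e, closure_ball _ H.hr0.ne', le_iff_lt_or_eq, H.ht_neg_iff hp, H.ht_eq_zero_iff hp,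
    Metric.mem_closedBall, dist_eq_norm, le_iff_lt_or_eq]
  exact Iff.rfl

theorem Horocycle.isOpen_horodisk (H : Horocycle) : IsOpen H.horodisk :=
  isOpen_lt (by fun_prop) continuous_const

section geo
variable {n₁ n₂ : E2}

theorem busW_geo (h₁ : ‖n₁‖ = 1) (h₂ : ‖n₂‖ = 1) (h : n₁ ≠ n₂) {q : E2} (hq : ‖q‖ = 1) (t : ℝ) :
    busW q (geo n₁ n₂ t) =
      (Real.exp t * ‖n₂ - q‖ ^ 2 + Real.exp (-t) * ‖n₁ - q‖ ^ 2) / (2 * ‖n₁ - n₂‖) := by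
  have hc : 0 < ‖n₁ - n₂‖ := norm_pos_iff.2 (sub_ne_zero.2 h)
  have hp := geo_denom_pos n₁ n₂ t
  have e0 : ‖geo n₁ n₂ t - q‖ ^ 2 =
      (Real.exp t * ‖n₂ - q‖ ^ 2 + Real.exp (-t) * ‖n₁ - q‖ ^ 2) /
        (Real.exp t + Real.exp (-t) + ‖n₁ - n₂‖) := by
    have f0 := one_sub_norm_geo_sq h₁ h₂ t
    rw [E2.norm_sq] at f0
    have f1 := E2.norm_sq n₁
    have f2 := E2.norm_sq n₂
    rw [h₁] at f1
    rw [h₂] at f2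
    rw [E2.norm_sub_sq _ _ hq, E2.norm_sub_sq n₂ _ hq, E2.norm_sub_sq n₁ _ hq, ← f1, ← f2]
    have g : geo n₁ n₂ t 0 ^ 2 + geo n₁ n₂ t 1 ^ 2 =
      1 - 2 * ‖n₁ - n₂‖ / (Real.exp t + Real.exp (-t) + ‖n₁ - n₂‖) := by linarith
    rw [g, geo]
    simp only [PiLp.add_apply, PiLp.smul_apply, smul_eq_mul]
    field_simp
    ring
  rw [busW, one_sub_norm_geo_sq h₁ h₂, e0]
  field_simp

theorem ht_geo_right (H : Horocycle) (h₁ : ‖n₁‖ = 1) (h : n₁ ≠ H.pt) (t : ℝ) :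
    H.ht (geo n₁ H.pt t) = Real.log (‖n₁ - H.pt‖ / 2) - t - H.lev := by
  have hc : 0 < ‖n₁ - H.pt‖ := norm_pos_iff.2 (sub_ne_zero.2 h)
  have e : busW H.pt (geo n₁ H.pt t) = ‖n₁ - H.pt‖ / 2 * Real.exp (-t) := by
    rw [busW_geo h₁ H.hpt h H.hpt, sub_self, norm_zero]
    field_simp; ring
  rw [Horocycle.ht, e, Real.log_mul (by positivity) (Real.exp_pos _).ne', Real.log_exp]
  ring

theorem ht_geo_left (H : Horocycle) (h₂ : ‖n₂‖ = 1) (h : H.pt ≠ n₂) (t : ℝ) :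
    H.ht (geo H.pt n₂ t) = Real.log (‖H.pt - n₂‖ / 2) + t - H.lev := by
  have hc : 0 < ‖H.pt - n₂‖ := norm_pos_iff.2 (sub_ne_zero.2 h)
  have e : busW H.pt (geo H.pt n₂ t) = ‖H.pt - n₂‖ / 2 * Real.exp t := by
    rw [busW_geo H.hpt h₂ h H.hpt, sub_self, norm_zero, norm_sub_rev]
    field_simp; ring
  rw [Horocycle.ht, e, Real.log_mul (by positivity) (Real.exp_pos _).ne', Real.log_exp]

theorem ht_geo_lipschitz (H : Horocycle) (h₁ : ‖n₁‖ = 1) (h₂ : ‖n₂‖ = 1) (h : n₁ ≠ n₂)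
    (s t : ℝ) : |H.ht (geo n₁ n₂ s) - H.ht (geo n₁ n₂ t)| ≤ |s - t| := by
  have hc : 0 < ‖n₁ - n₂‖ := norm_pos_iff.2 (sub_ne_zero.2 h)
  have key : ∀ s t : ℝ, H.ht (geo n₁ n₂ s) - H.ht (geo n₁ n₂ t) ≤ |s - t| := by
    intro s t
    have ps := busW_pos H.hpt (geo_mem_disk h₁ h₂ h s)
    have pt := busW_pos H.hpt (geo_mem_disk h₁ h₂ h t)
    have : busW H.pt (geo n₁ n₂ s) ≤ Real.exp |s - t| * busW H.pt (geo n₁ n₂ t) := by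
      rw [busW_geo h₁ h₂ h H.hpt, busW_geo h₁ h₂ h H.hpt, ← mul_div_assoc]
      gcongr
      have a1 : Real.exp s ≤ Real.exp |s - t| * Real.exp t := by
        rw [← Real.exp_add]; exact Real.exp_le_exp.2 (by linarith [le_abs_self (s - t)])
      have a2 : Real.exp (-s) ≤ Real.exp |s - t| * Real.exp (-t) := by
        rw [← Real.exp_add]; exact Real.exp_le_exp.2 (by linarith [neg_abs_le (s - t)])
      nlinarith [sq_nonneg ‖n₂ - H.pt‖, sq_nonneg ‖n₁ - H.pt‖]
    have h3 := Real.log_le_log ps this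
    rw [Real.log_mul (Real.exp_pos _).ne' pt.ne', Real.log_exp] at h3
    simp only [Horocycle.ht]
    linarith
  rw [abs_le]
  have := key t s
  rw [abs_sub_comm] at this
  exact ⟨by linarith, key s t⟩

theorem continuous_ht_geo (H : Horocycle) (h₁ : ‖n₁‖ = 1) (h₂ : ‖n₂‖ = 1) (h : n₁ ≠ n₂) :
    Continuous fun t => H.ht (geo n₁ n₂ t) := by
  have : LipschitzWith 1 fun t => H.ht (geo n₁ n₂ t) :=
    LipschitzWith.of_dist_le_mul fun s t => by
      simpa [Real.dist_eq] using ht_geo_lipschitz H h₁ h₂ h s t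
  exact this.continuous

end geo

theorem chord_identity {a b c d x y : ℝ} (e1 : a ^ 2 + b ^ 2 = 1) (e2 : c ^ 2 + d ^ 2 = 1) :
    (2 - 2 * (a * c + b * d)) * (4 * (x ^ 2 + y ^ 2 + 1 - 2 * (a * x + b * y)) *
      (x ^ 2 + y ^ 2 + 1 - 2 * (c * x + d * y)) -
        (2 - 2 * (a * c + b * d)) * (1 - (x ^ 2 + y ^ 2)) ^ 2) =
      4 * ((1 + x ^ 2 + y ^ 2) * (a * d - b * c) - 2 * (a * y - b * x) -
        2 * (x * d - y * c)) ^ 2 := by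
  grind

theorem busW_mul_identity {q q' x : E2} (hq : ‖q‖ = 1) (hq' : ‖q'‖ = 1) (hx : x ∈ Disk) :
    ‖q - q'‖ ^ 2 * (busW q x * busW q' x - ‖q - q'‖ ^ 2 / 4) =
      (((1 + ‖x‖ ^ 2) * cr (q' - q) (toKlein x - q)) / (1 - ‖x‖ ^ 2)) ^ 2 := by
  have hd : 1 - ‖x‖ ^ 2 ≠ 0 := by linarith [norm_sq_lt_one hx]
  have e1 := E2.norm_sq q
  have e2 := E2.norm_sq q'
  rw [hq] at e1
  rw [hq'] at e2
  have hS : (1 + ‖x‖ ^ 2) * cr (q' - q) (toKlein x - q) =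
      (1 + ‖x‖ ^ 2) * (q 0 * q' 1 - q 1 * q' 0) - 2 * (q 0 * x 1 - q 1 * x 0)
        - 2 * (x 0 * q' 1 - x 1 * q' 0) := by
    simp only [cr, toKlein, PiLp.sub_apply, PiLp.smul_apply, smul_eq_mul]
    field_simp
    ring
  rw [hS, busW, busW, div_pow, E2.norm_sub_sq x _ hq, E2.norm_sub_sq x _ hq',
    E2.norm_sub_sq q _ hq', ← e1]
  rw [E2.norm_sq x] at hd ⊢
  have key := chord_identity (x := x 0) (y := x 1) (e1.symm.trans (one_pow 2))
    (e2.symm.trans (one_pow 2))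
  field_simp
  linear_combination key

theorem gap_le_ht_add_ht (H H' : Horocycle) (hne : H.pt ≠ H'.pt) {x : E2} (hx : x ∈ Disk) :
    H.gap H' ≤ H.ht x + H'.ht x := by
  have h := busW_mul_identity H.hpt H'.hpt hx
  have hc : 0 < ‖H.pt - H'.pt‖ ^ 2 := by
    have := norm_pos_iff.2 (sub_ne_zero.2 hne); positivity
  have h1 : ‖H.pt - H'.pt‖ ^ 2 / 4 ≤ busW H.pt x * busW H'.pt x := by
    have : 0 ≤ ‖H.pt - H'.pt‖ ^ 2 * (busW H.pt x * busW H'.pt x - ‖H.pt - H'.pt‖ ^ 2 / 4) := by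
      rw [h]; positivity
    linarith [nonneg_of_mul_nonneg_right this hc]
  have h2 := Real.log_le_log (by positivity) h1
  rw [Real.log_mul (busW_pos H.hpt hx).ne' (busW_pos H'.hpt hx).ne'] at h2
  simp only [Horocycle.gap, Horocycle.ht]
  linarith

theorem cr_eq_zero_of_gap_eq (H H' : Horocycle) (hne : H.pt ≠ H'.pt) {x : E2} (hx : x ∈ Disk)
    (he : H.gap H' = H.ht x + H'.ht x) : cr (H'.pt - H.pt) (toKlein x - H.pt) = 0 := by
  have h := busW_mul_identity H.hpt H'.hpt hx
  have hc : 0 < ‖H.pt - H'.pt‖ ^ 2 := by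
    have := norm_pos_iff.2 (sub_ne_zero.2 hne); positivity
  have p1 := busW_pos H.hpt hx
  have p2 := busW_pos H'.hpt hx
  have h1 : busW H.pt x * busW H'.pt x = ‖H.pt - H'.pt‖ ^ 2 / 4 := by
    refine Real.log_injOn_pos (mul_pos p1 p2) (by show (0:ℝ) < _; positivity) ?_
    rw [Real.log_mul p1.ne' p2.ne']
    simp only [Horocycle.gap, Horocycle.ht] at he
    linarith
  rw [h1, sub_self, mul_zero] at h
  have h2 := pow_eq_zero_iff (two_ne_zero) |>.1 h.symm
  have hd : 1 - ‖x‖ ^ 2 ≠ 0 := by linarith [norm_sq_lt_one hx]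
  rw [div_eq_zero_iff] at h2
  have h3 := h2.resolve_right hd
  exact (mul_eq_zero.1 h3).resolve_left (by positivity)

theorem rank_E2 : 1 < Module.rank ℝ E2 := by
  rw [← Module.finrank_eq_rank, finrank_euclideanSpace_fin]; norm_num

/-- Horocycles at distinct ideal points which are disjoint bound disjoint horodisks. -/
theorem gap_pos (H H' : Horocycle) (hne : H.pt ≠ H'.pt) (hd : Disjoint H.circle H'.circle) :
    0 < H.gap H' := by
  by_contra hcon
  rw [not_lt] at hcon
  have hc : 0 < ‖H.pt - H'.pt‖ := norm_pos_iff.2 (sub_ne_zero.2 hne)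
  set t := H.lev - Real.log (‖H.pt - H'.pt‖ / 2) with ht
  have hD := geo_mem_disk H.hpt H'.hpt hne t
  have m1 : geo H.pt H'.pt t ∈ H.circle := by
    rw [← H.ht_eq_zero_iff hD, ht_geo_left H H'.hpt hne]; linarith
  have m2 : H'.ht (geo H.pt H'.pt t) ≤ 0 := by
    rw [ht_geo_right H' H.hpt hne]
    have : Real.log (‖H.pt - H'.pt‖ ^ 2 / 4) = 2 * Real.log (‖H.pt - H'.pt‖ / 2) := by
      rw [← Real.log_rpow (by positivity)]
      congr 1; rw [Real.rpow_two]; ring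
    rw [Horocycle.gap, this] at hcon
    linarith
  have m3 : ‖geo H.pt H'.pt t - (1 - H'.r) • H'.pt‖ ≤ H'.r := by
    rcases m2.lt_or_eq with h | h
    · exact ((H'.ht_neg_iff hD).1 h).le
    · exact ((H'.ht_eq_zero_iff hD).1 h).le
  have m4 : H.pt ∈ H.circle := by
    show ‖H.pt - (1 - H.r) • H.pt‖ = H.r
    have : H.pt - (1 - H.r) • H.pt = H.r • H.pt := by module
    rw [this, norm_smul, H.hpt, Real.norm_eq_abs, abs_of_pos H.hr0, mul_one]
  have m5 : H'.r ≤ ‖H.pt - (1 - H'.r) • H'.pt‖ := by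
    have := norm_sub_norm_le H.pt ((1 - H'.r) • H'.pt)
    rw [norm_smul, H.hpt, H'.hpt, Real.norm_eq_abs, abs_of_pos (by linarith [H'.hr1])] at this
    linarith
  have hs : IsPreconnected H.circle := by
    have : H.circle = Metric.sphere ((1 - H.r) • H.pt) H.r := by
      ext p; simp [Horocycle.circle]
    rw [this]; exact isPreconnected_sphere rank_E2 _ _
  obtain ⟨x, hx, hx'⟩ := hs.intermediate_value m1 m4
    (f := fun p => ‖p - (1 - H'.r) • H'.pt‖) (by fun_prop) ⟨m3, m5⟩
  exact disjoint_left.1 hd hx hx'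

/-! ### Truncated lengths -/

/-- The length of a geodesic arc outside a family of horodisks. -/
def trunc {k : ℕ} (H : ZMod k → Horocycle) (u v : E2) : ENNReal :=
  hypMeas (geodArc u v \ ⋃ i, (H i).horodisk)

theorem trunc_comm {k : ℕ} (H : ZMod k → Horocycle) (u v : E2) : trunc H u v = trunc H v u := by
  rw [trunc, geodArc_comm, trunc]

theorem measurableSet_horodisks {k : ℕ} (H : ZMod k → Horocycle) :
    MeasurableSet (⋃ i, (H i).horodisk) :=
  (isOpen_iUnion fun i => (H i).isOpen_horodisk).measurableSet

theorem image_geo_diff {k : ℕ} (H : ZMod k → Horocycle) {n₁ n₂ : E2} (h₁ : ‖n₁‖ = 1)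
    (h₂ : ‖n₂‖ = 1) (h : n₁ ≠ n₂) (J : Set ℝ) :
    geo n₁ n₂ '' J \ (⋃ i, (H i).horodisk) =
      geo n₁ n₂ '' {t ∈ J | ∀ i, 0 ≤ (H i).ht (geo n₁ n₂ t)} := by
  ext p
  simp only [Set.mem_sdiff, mem_image, mem_iUnion, not_exists, mem_ofPred_eq]
  constructor
  · rintro ⟨⟨t, ht, rfl⟩, hn⟩
    refine ⟨t, ⟨ht, fun i => ?_⟩, rfl⟩
    by_contra hlt
    exact hn i (((H i).ht_neg_iff (geo_mem_disk h₁ h₂ h t)).1 (not_le.1 hlt))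
  · rintro ⟨t, ⟨ht, hn⟩, rfl⟩
    refine ⟨⟨t, ht, rfl⟩, fun i hi => ?_⟩
    have := ((H i).ht_neg_iff (geo_mem_disk h₁ h₂ h t)).2 hi
    exact absurd (hn i) (not_le.2 this)

theorem measurableSet_good {k : ℕ} [NeZero k] (H : ZMod k → Horocycle) {n₁ n₂ : E2}
    (h₁ : ‖n₁‖ = 1) (h₂ : ‖n₂‖ = 1) (h : n₁ ≠ n₂) {J : Set ℝ} (hJ : MeasurableSet J) :
    MeasurableSet {t ∈ J | ∀ i, 0 ≤ (H i).ht (geo n₁ n₂ t)} := by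
  refine hJ.inter ?_
  have : {t | ∀ i, 0 ≤ (H i).ht (geo n₁ n₂ t)} = ⋂ i, {t | 0 ≤ (H i).ht (geo n₁ n₂ t)} := by
    ext; simp
  show MeasurableSet {t | ∀ i, 0 ≤ (H i).ht (geo n₁ n₂ t)}
  rw [this]
  exact MeasurableSet.iInter fun i =>
    (isClosed_le continuous_const (continuous_ht_geo (H i) h₁ h₂ h)).measurableSet

theorem hypMeas_image_geo_diff {k : ℕ} [NeZero k] (H : ZMod k → Horocycle) {n₁ n₂ : E2}
    (h₁ : ‖n₁‖ = 1) (h₂ : ‖n₂‖ = 1) (h : n₁ ≠ n₂) {J : Set ℝ} (hJ : MeasurableSet J) :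
    hypMeas (geo n₁ n₂ '' J \ (⋃ i, (H i).horodisk)) =
      volume {t ∈ J | ∀ i, 0 ≤ (H i).ht (geo n₁ n₂ t)} := by
  rw [image_geo_diff H h₁ h₂ h, hypMeas_geo_image h₁ h₂ h (measurableSet_good H h₁ h₂ h hJ)]

theorem trunc_ideal_ideal_le {k : ℕ} [NeZero k] (H : ZMod k → Horocycle) {m n : ZMod k}
    (hne : (H m).pt ≠ (H n).pt) :
    trunc H (H m).pt (H n).pt ≤ ENNReal.ofReal ((H m).gap (H n)) := by
  have hc : 0 < ‖(H m).pt - (H n).pt‖ := norm_pos_iff.2 (sub_ne_zero.2 hne)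
  rw [trunc, geodArc_ideal_ideal (H m).hpt (H n).hpt hne, ← image_univ,
    hypMeas_image_geo_diff H (H m).hpt (H n).hpt hne MeasurableSet.univ]
  set l := Real.log (‖(H m).pt - (H n).pt‖ / 2) with hl
  have hg : (H m).gap (H n) = (l - (H n).lev) - ((H m).lev - l) := by
    have : Real.log (‖(H m).pt - (H n).pt‖ ^ 2 / 4) = 2 * l := by
      rw [hl, ← Real.log_rpow (by positivity)]
      congr 1; rw [Real.rpow_two]; ring
    rw [Horocycle.gap, this]; ring
  rw [hg, ← Real.volume_Icc]
  refine measure_mono ?_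
  rintro t ⟨-, ht⟩
  have t1 := ht m
  have t2 := ht n
  rw [ht_geo_left _ (H n).hpt hne] at t1
  rw [ht_geo_right _ (H m).hpt hne] at t2
  exact ⟨by linarith, by linarith⟩

/-- Structure of a ray towards an ideal point carrying a horocycle. -/
theorem exists_ray (H : Horocycle) {u : E2} (hu : u ∈ Disk) :
    ∃ n, ‖n‖ = 1 ∧ n ≠ H.pt ∧ ∃ t₀, geo n H.pt t₀ = u ∧
      geodArc H.pt u = geo n H.pt '' Ici t₀ ∧
      ∀ t, H.ht (geo n H.pt t) = H.ht u - (t - t₀) := by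
  obtain ⟨n, hn, hne, t₀, e, harc⟩ := geodArc_ray H.hpt hu
  refine ⟨n, hn, hne, t₀, e, harc, fun t => ?_⟩
  rw [← e, ht_geo_right _ hn hne, ht_geo_right _ hn hne]; ring

theorem trunc_ideal_inter_le {k : ℕ} [NeZero k] (H : ZMod k → Horocycle) (m n : ZMod k) {u : E2}
    (hu : u ∈ Disk) :
    trunc H (H m).pt u ≤ ENNReal.ofReal ((H m).ht u - max (-(H n).ht u) 0) := by
  obtain ⟨q, hq, hne, t₀, e, harc, hht⟩ := exists_ray (H m) hu
  rw [trunc, harc, hypMeas_image_geo_diff H hq (H m).hpt hne measurableSet_Ici]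
  have : (H m).ht u - max (-(H n).ht u) 0 = (t₀ + (H m).ht u) - (t₀ + max (-(H n).ht u) 0) := by
    ring
  rw [this, ← Real.volume_Icc]
  refine measure_mono ?_
  rintro t ⟨ht0, ht⟩
  have ht0 : t₀ ≤ t := ht0
  have t1 := ht m
  have t2 := ht n
  rw [hht] at t1
  have t3 := ht_geo_lipschitz (H n) hq (H m).hpt hne t t₀
  rw [e, abs_of_nonneg (sub_nonneg.2 ht0)] at t3
  have t4 := (abs_le.1 t3).2
  refine ⟨?_, by linarith⟩
  have : max (-(H n).ht u) 0 ≤ t - t₀ := max_le (by linarith) (by linarith)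
  linarith

theorem trunc_inter_inter_lt_top {k : ℕ} (H : ZMod k → Horocycle) {u v : E2}
    (hu : u ∈ Disk) (hv : v ∈ Disk) : trunc H u v < ⊤ := by
  by_cases huv : u = v
  · have : trunc H u v = 0 := by
      refine hypMeas_subsingleton ((Set.subsingleton_singleton (a := u)).anti ?_)
      rintro p ⟨hp, -⟩
      rw [mem_geodArc, ← huv, segment_same] at hp
      exact toKlein_injOn (mem_disk.1 hp.1).le (mem_disk.1 hu).le hp.2
    rw [this]; exact ENNReal.zero_lt_top
  · obtain ⟨n₁, n₂, h₁, h₂, h, a, b, hab, -, -, harc⟩ := geodArc_seg hu hv huv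
    calc trunc H u v ≤ hypMeas (geo n₁ n₂ '' Icc a b) := by
          rw [trunc, harc]; exact measure_mono sdiff_subset
      _ = volume (Icc a b) := hypMeas_geo_image h₁ h₂ h measurableSet_Icc
      _ < ⊤ := by rw [Real.volume_Icc]; exact ENNReal.ofReal_lt_top

/-! ### Plane geometry with the cross product -/

theorem cr_add_right (u v w : E2) : cr u (v + w) = cr u v + cr u w := by
  simp only [cr, PiLp.add_apply]; ring

theorem cr_smul_right (a : ℝ) (u v : E2) : cr u (a • v) = a * cr u v := by
  simp only [cr, PiLp.smul_apply, smul_eq_mul]; ring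

theorem cr_smul_left (a : ℝ) (u v : E2) : cr (a • u) v = a * cr u v := by
  simp only [cr, PiLp.smul_apply, smul_eq_mul]; ring

theorem cr_self (u : E2) : cr u u = 0 := by simp only [cr]; ring

theorem cr_swap (u v : E2) : cr u v = -cr v u := by simp only [cr]; ring

theorem cr_zero_right (u : E2) : cr u 0 = 0 := by
  simp only [cr, PiLp.zero_apply]; ring

theorem continuous_cr (u c : E2) : Continuous fun x : E2 => cr u (x - c) := by
  simp only [cr, PiLp.sub_apply]; fun_prop

/-- The Cramer rule. -/
theorem cr_decomp (e g v : E2) : cr e g • v = cr v g • e + cr e v • g := by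
  ext i
  fin_cases i <;> simp [cr] <;> ring

theorem exists_lineMap_of_cr {x y w : E2} (h : x ≠ y) (hw : cr (y - x) (w - x) = 0) :
    ∃ τ : ℝ, w = AffineMap.lineMap x y τ := by
  have hne : y - x ≠ 0 := sub_ne_zero.2 h.symm
  have hn : ‖y - x‖ ^ 2 ≠ 0 := by have := norm_pos_iff.2 hne; positivity
  refine ⟨(‖y - x‖ ^ 2)⁻¹ * ((y 0 - x 0) * (w 0 - x 0) + (y 1 - x 1) * (w 1 - x 1)), ?_⟩
  have hs : ‖y - x‖ ^ 2 • (w - x) =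
      ((y 0 - x 0) * (w 0 - x 0) + (y 1 - x 1) * (w 1 - x 1)) • (y - x) := by
    simp only [cr, PiLp.sub_apply] at hw
    rw [E2.norm_sq]
    ext i
    fin_cases i
    · simp; linear_combination -(y 1 - x 1) * hw
    · simp; linear_combination (y 0 - x 0) * hw
  rw [AffineMap.lineMap_apply, vsub_eq_sub, vadd_eq_add, mul_smul, ← hs, smul_smul,
    inv_mul_cancel₀ hn, one_smul, sub_add_cancel]

theorem cr_lineMap (u c x y : E2) (τ : ℝ) : cr u (AffineMap.lineMap x y τ - c) =
    (1 - τ) * cr u (x - c) + τ * cr u (y - c) := by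
  rw [AffineMap.lineMap_apply_module]
  simp only [cr, PiLp.sub_apply, PiLp.add_apply, PiLp.smul_apply, smul_eq_mul]; ring

theorem cr_lineMap_self (x y : E2) (τ : ℝ) : cr (y - x) (AffineMap.lineMap x y τ - x) = 0 := by
  rw [cr_lineMap, sub_self, cr_zero_right, cr_self]; ring

theorem norm_lineMap_sq {x y : E2} (hx : ‖x‖ = 1) (hy : ‖y‖ = 1) (τ : ℝ) :
    ‖AffineMap.lineMap x y τ‖ ^ 2 = 1 - τ * (1 - τ) * ‖x - y‖ ^ 2 := by
  rw [AffineMap.lineMap_apply_module, add_comm, norm_geo_aux hx hy]; ring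

theorem lineMap_param_mem {x y : E2} (hx : ‖x‖ = 1) (hy : ‖y‖ = 1) {τ : ℝ}
    (h : (AffineMap.lineMap x y τ : E2) ∈ Disk) : 0 < τ ∧ τ < 1 := by
  have h1 := norm_sq_lt_one h
  rw [norm_lineMap_sq hx hy] at h1
  have h2 : 0 < τ * (1 - τ) := by
    by_contra hc
    nlinarith [sq_nonneg ‖x - y‖]
  rcases pos_and_pos_or_neg_and_neg_of_mul_pos h2 with h3 | h3
  · exact ⟨h3.1, by linarith [h3.2]⟩
  · linarith [h3.1, h3.2]

theorem eq_or_eq_of_unit_lineMap {x y : E2} (hx : ‖x‖ = 1) (hy : ‖y‖ = 1) (hxy : x ≠ y) {τ : ℝ}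
    (h : ‖(AffineMap.lineMap x y τ : E2)‖ = 1) : τ = 0 ∨ τ = 1 := by
  have h1 := norm_lineMap_sq hx hy τ
  have hc : ‖x - y‖ ^ 2 ≠ 0 := by
    have := norm_pos_iff.2 (sub_ne_zero.2 hxy); positivity
  rw [h] at h1
  have h2 : τ * (1 - τ) * ‖x - y‖ ^ 2 = 0 := by linarith
  rcases mul_eq_zero.1 ((mul_eq_zero.1 h2).resolve_right hc) with h3 | h3
  · exact Or.inl h3
  · exact Or.inr (by linarith)

theorem openSegment_eq_lineMap (x y : E2) :
    openSegment ℝ x y = AffineMap.lineMap x y '' Ioo (0:ℝ) 1 :=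
  openSegment_eq_image_lineMap ℝ x y

theorem mem_openSegment_lineMap (x y : E2) {a b c : ℝ} (h1 : a < b) (h2 : b < c) :
    (AffineMap.lineMap x y b : E2) ∈
      openSegment ℝ (AffineMap.lineMap x y a : E2) (AffineMap.lineMap x y c) := by
  have : (AffineMap.lineMap x y : ℝ →ᵃ[ℝ] E2) '' openSegment ℝ a c =
      openSegment ℝ (AffineMap.lineMap x y a : E2) (AffineMap.lineMap x y c) :=
    image_openSegment ℝ _ a c
  rw [← this, openSegment_eq_Ioo (h1.trans h2)]
  exact ⟨b, ⟨h1, h2⟩, rfl⟩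

theorem openSegment_subset_disk {x y : E2} (hx : ‖x‖ ≤ 1) (hy : ‖y‖ ≤ 1) (h : x ≠ y) :
    openSegment ℝ x y ⊆ Disk := by
  rw [openSegment_eq_lineMap]
  rintro _ ⟨τ, hτ, rfl⟩
  exact lineMap_mem_disk hx hy h hτ.1 hτ.2

section convex
variable {K : Set E2}

theorem openSegment_subset_of_mem {x y : E2} (ho : IsOpen K) (hc : Convex ℝ K) (hx : x ∈ K)
    (hy : y ∈ closure K) : openSegment ℝ x y ⊆ K := by
  have := hc.openSegment_interior_closure_subset_interior (x := x) (y := y)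
    (by rwa [ho.interior_eq]) hy
  rwa [ho.interior_eq] at this

theorem openSegment_subset_of_mem' {x y : E2} (ho : IsOpen K) (hc : Convex ℝ K)
    (hx : x ∈ closure K) (hy : y ∈ K) : openSegment ℝ x y ⊆ K := by
  rw [openSegment_symm]; exact openSegment_subset_of_mem ho hc hy hx

theorem openSegment_subset_of_inter {x y z : E2} (ho : IsOpen K) (hc : Convex ℝ K)
    (hx : x ∈ closure K) (hy : y ∈ closure K) (hz : z ∈ openSegment ℝ x y) (hzK : z ∈ K) :
    openSegment ℝ x y ⊆ K := by
  rw [openSegment_eq_lineMap] at hz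
  obtain ⟨θ, hθ, rfl⟩ := hz
  rw [openSegment_eq_lineMap]
  rintro _ ⟨τ, hτ, rfl⟩
  rcases lt_trichotomy τ θ with h | rfl | h
  · have := mem_openSegment_lineMap x y hτ.1 h
    rw [AffineMap.lineMap_apply_zero] at this
    exact openSegment_subset_of_mem' ho hc hx hzK this
  · exact hzK
  · have := mem_openSegment_lineMap x y h hτ.2
    rw [AffineMap.lineMap_apply_one] at this
    exact openSegment_subset_of_mem ho hc hzK hy this

theorem le_of_mem_closure {f : E2 → ℝ} (hf : Continuous f) (h : ∀ w ∈ K, 0 ≤ f w) {x : E2}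
    (hx : x ∈ closure K) : 0 ≤ f x :=
  closure_minimal (fun w hw => h w hw : K ⊆ {w | 0 ≤ f w}) (isClosed_le continuous_const hf) hx

/-- A segment of the closure with a point outside the open convex set spans a supporting line. -/
theorem exists_sign (ho : IsOpen K) (hc : Convex ℝ K) {x y z : E2} (hxy : x ≠ y)
    (hx : x ∈ closure K) (hy : y ∈ closure K) (hz : z ∈ openSegment ℝ x y) (hzK : z ∉ K) :
    ∃ σ : ℝ, (σ = 1 ∨ σ = -1) ∧ ∀ w ∈ K, 0 < σ * cr (y - x) (w - x) := by
  have h0 : ∀ w ∈ K, cr (y - x) (w - x) ≠ 0 := by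
    intro w hw h
    obtain ⟨τ, rfl⟩ := exists_lineMap_of_cr hxy h
    rw [openSegment_eq_lineMap] at hz
    obtain ⟨θ, hθ, rfl⟩ := hz
    rcases lt_trichotomy τ θ with h | rfl | h
    · have := mem_openSegment_lineMap x y h hθ.2
      rw [AffineMap.lineMap_apply_one] at this
      exact hzK (openSegment_subset_of_mem ho hc hw hy this)
    · exact hzK hw
    · have := mem_openSegment_lineMap x y hθ.1 h
      rw [AffineMap.lineMap_apply_zero] at this
      exact hzK (openSegment_subset_of_mem' ho hc hx hw this)
  by_cases hpos : ∀ w ∈ K, 0 < cr (y - x) (w - x)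
  · exact ⟨1, Or.inl rfl, fun w hw => by rw [one_mul]; exact hpos w hw⟩
  · push Not at hpos
    obtain ⟨w₀, hw₀, h₀⟩ := hpos
    refine ⟨-1, Or.inr rfl, fun w hw => ?_⟩
    by_contra hcon
    have h1 : 0 ≤ cr (y - x) (w - x) := by linarith
    have hp : IsPreconnected K := hc.isPreconnected
    obtain ⟨v, hv, hv0⟩ := hp.intermediate_value hw₀ hw
      (f := fun w => cr (y - x) (w - x)) (continuous_cr _ _).continuousOn ⟨h₀, h1⟩
    exact h0 v hv hv0

/-- Interior points of a nondegenerate triangle inscribed in an open convex set lie in it. -/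
theorem triangle_mem (ho : IsOpen K) (hc : Convex ℝ K) {p e g : E2} {a b : ℝ}
    (hp : p ∈ closure K) (he : p + e ∈ closure K) (hg : p + g ∈ closure K) (ha : 0 < a)
    (hb : 0 < b) (hab : a + b < 1) (hcr : cr e g ≠ 0) : p + a • e + b • g ∈ K := by
  by_contra hn
  obtain ⟨f, hf⟩ := geometric_hahn_banach_open_point hc ho hn
  have hcl : ∀ w ∈ closure K, f w ≤ f (p + a • e + b • g) := by
    intro w hw
    have := le_of_mem_closure (f := fun w => f (p + a • e + b • g) - f w) (by fun_prop)
      (fun w hw => by linarith [hf w hw]) hw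
    linarith
  have h1 := hcl p hp
  have h2 := hcl _ he
  have h3 := hcl _ hg
  simp only [map_add, map_smul, smul_eq_mul] at h1 h2 h3
  have hfe : f e = 0 := by nlinarith
  have hfg : f g = 0 := by nlinarith
  have hf0 : ∀ v, f v = 0 := by
    intro v
    have h := congrArg f (cr_decomp e g v)
    simp only [map_add, map_smul, smul_eq_mul, hfe, hfg, mul_zero, add_zero] at h
    exact (mul_eq_zero.1 h).resolve_left hcr
  have hne : K.Nonempty := closure_nonempty_iff.1 ⟨p, hp⟩
  obtain ⟨w, hw⟩ := hne
  have := hf w hw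
  rw [hf0, hf0] at this
  exact lt_irrefl _ this

end convex

/-! ### Convex semi-ideal polygons in the Klein model -/

/-- The Klein model of a convex semi-ideal polygon with `N ≥ 4` vertices, indexed by `ℤ`. -/
structure KPoly (N : ℤ) (K : Set E2) (V : ℤ → E2) : Prop where
  four_le : 4 ≤ N
  isOpen : IsOpen K
  convex : Convex ℝ K
  nonempty : K.Nonempty
  subset : K ⊆ Disk
  per : ∀ n, V (n + N) = V n
  inj : ∀ m n, V m = V n → N ∣ n - m
  even : ∀ n, Even n → ‖V n‖ = 1
  odd : ∀ n, Odd n → V n ∈ Disk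
  bdry : frontier K ∩ Disk = (⋃ n, segment ℝ (V n) (V (n + 1))) ∩ Disk
  ncol : ∀ n, Even n → cr (V (n + 1) - V n) (V (n - 1) - V n) ≠ 0

namespace KPoly
variable {N : ℤ} {K : Set E2} {V : ℤ → E2}

theorem rev (h : KPoly N K V) : KPoly N K (fun n => V (-n)) where
  four_le := h.four_le
  isOpen := h.isOpen
  convex := h.convex
  nonempty := h.nonempty
  subset := h.subset
  per n := by rw [← h.per (-(n + N)), show -(n + N) + N = -n by ring]
  inj m n hmn := by
    have := dvd_neg.2 (h.inj _ _ hmn)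
    rwa [show -(-n - -m) = n - m by ring] at this
  even n hn := h.even _ hn.neg
  odd n hn := h.odd _ hn.neg
  bdry := by
    rw [h.bdry]
    congr 1
    ext x
    simp only [mem_iUnion]
    constructor
    · rintro ⟨n, hx⟩
      refine ⟨-n - 1, ?_⟩
      rw [segment_symm, show -(-n - 1 + 1) = n by ring, show -(-n - 1) = n + 1 by ring]
      exact hx
    · rintro ⟨n, hx⟩
      refine ⟨-n - 1, ?_⟩
      rw [segment_symm, show -n - 1 + 1 = -n by ring, show -n - 1 = -(n + 1) by ring]
      exact hx
  ncol n hn := by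
    have := h.ncol (-n) hn.neg
    rw [cr_swap, neg_ne_zero] at this
    rwa [show -(n + 1) = -n - 1 by ring, show -(n - 1) = -n + 1 by ring]

theorem norm_le (h : KPoly N K V) (n : ℤ) : ‖V n‖ ≤ 1 := by
  rcases Int.even_or_odd n with hn | hn
  · exact (h.even n hn).le
  · exact (mem_disk.1 (h.odd n hn)).le

theorem per_mul (h : KPoly N K V) (n j : ℤ) : V (n + j * N) = V n := by
  induction j using Int.induction_on with
  | zero => simp
  | succ j ih => rw [← ih, ← h.per (n + j * N)]; congr 1; ring
  | pred j ih => rw [← ih, ← h.per (n + (-j - 1) * N)]; congr 1; ring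

theorem eq_of_dvd (h : KPoly N K V) {m n : ℤ} (hd : N ∣ n - m) : V m = V n := by
  obtain ⟨j, hj⟩ := hd
  rw [← h.per_mul m j]; congr 1; rw [mul_comm]; omega

theorem ne_of_lt (h : KPoly N K V) {m n : ℤ} (h1 : m < n) (h2 : n < m + N) : V m ≠ V n := by
  intro e
  have := Int.le_of_dvd (by omega) (h.inj _ _ e)
  omega

theorem ne_succ (h : KPoly N K V) (n : ℤ) : V n ≠ V (n + 1) :=
  h.ne_of_lt (by omega) (by have := h.four_le; omega)

theorem openEdge_subset_disk (h : KPoly N K V) (n : ℤ) :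
    openSegment ℝ (V n) (V (n + 1)) ⊆ Disk :=
  openSegment_subset_disk (h.norm_le _) (h.norm_le _) (h.ne_succ n)

theorem openEdge_subset (h : KPoly N K V) (n : ℤ) :
    openSegment ℝ (V n) (V (n + 1)) ⊆ frontier K := fun x hx => by
  have : x ∈ frontier K ∩ Disk := by
    rw [h.bdry]
    exact ⟨mem_iUnion.2 ⟨n, openSegment_subset_segment ℝ _ _ hx⟩, h.openEdge_subset_disk n hx⟩
  exact this.1

theorem edge_subset (h : KPoly N K V) (n : ℤ) :
    segment ℝ (V n) (V (n + 1)) ⊆ frontier K :=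
  segment_subset_closure_openSegment.trans
    (closure_minimal (h.openEdge_subset n) isClosed_frontier)

theorem mem_frontier (h : KPoly N K V) (n : ℤ) : V n ∈ frontier K :=
  h.edge_subset n (left_mem_segment ℝ _ _)

theorem mem_closure (h : KPoly N K V) (n : ℤ) : V n ∈ closure K :=
  frontier_subset_closure (h.mem_frontier n)

theorem notMem_of_frontier (h : KPoly N K V) {x : E2} (hx : x ∈ frontier K) : x ∉ K := by
  rw [h.isOpen.frontier_eq] at hx; exact hx.2

theorem notMem (h : KPoly N K V) (n : ℤ) : V n ∉ K := h.notMem_of_frontier (h.mem_frontier n)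

/-- The neighbours of a vertex inside a segment of the boundary lie on its line. -/
theorem cr_neighbour (h : KPoly N K V) {x y : E2} (hx : x ∈ closure K) (hy : y ∈ closure K)
    {n m : ℤ} (hn : V n ∈ openSegment ℝ x y) (hm : m = n + 1 ∨ m = n - 1) :
    cr (y - x) (V m - x) = 0 := by
  by_contra hne
  obtain ⟨θ, hθ, e⟩ : V n ∈ AffineMap.lineMap x y '' Ioo (0:ℝ) 1 := by
    rwa [← openSegment_eq_lineMap]
  have hmid : V n + (1/2 : ℝ) • (V m - V n) ∈ K := by
    have e1 : V n + (1/2 : ℝ) • (V m - V n) = x + (θ / 2) • (y - x) + (1/2 : ℝ) • (V m - x) := by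
      rw [← e, AffineMap.lineMap_apply, vsub_eq_sub, vadd_eq_add]; module
    rw [e1]
    refine triangle_mem h.isOpen h.convex hx (by simpa using hy)
      (by simpa using h.mem_closure m) (by linarith [hθ.1]) (by norm_num)
      (by linarith [hθ.2]) hne
  have e2 : V n + (1/2 : ℝ) • (V m - V n) ∈ openSegment ℝ (V n) (V m) := by
    rw [openSegment_eq_lineMap]
    refine ⟨1/2, by norm_num, ?_⟩
    rw [AffineMap.lineMap_apply, vsub_eq_sub, vadd_eq_add, add_comm]
  rcases hm with rfl | rfl
  · exact h.notMem_of_frontier (h.openEdge_subset n e2) hmid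
  · have := h.openEdge_subset (n - 1)
    rw [sub_add_cancel, openSegment_symm] at this
    exact h.notMem_of_frontier (this e2) hmid

theorem odd_of_mem_disk (h : KPoly N K V) {n : ℤ} (hn : V n ∈ Disk) : Odd n := by
  rcases Int.even_or_odd n with he | ho
  · rw [mem_disk, h.even n he] at hn; exact absurd hn (lt_irrefl _)
  · exact ho

theorem vertex_notMem_openEdge_aux (h : KPoly N K V) {m n d : ℤ} (hn : Even n)
    (hd : d = n + 1 ∨ d = n - 1) : V m ∉ openSegment ℝ (V n) (V d) := by
  intro hm
  have hnd : V n ≠ V d := by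
    rcases hd with rfl | rfl
    · exact h.ne_succ n
    · have := h.ne_succ (n - 1); rw [sub_add_cancel] at this; exact this.symm
  have hmo := h.odd_of_mem_disk
    (openSegment_subset_disk (h.norm_le _) (h.norm_le _) hnd hm)
  have e1 := h.cr_neighbour (h.mem_closure n) (h.mem_closure d) hm (Or.inl rfl)
  have e2 := h.cr_neighbour (h.mem_closure n) (h.mem_closure d) hm (Or.inr rfl)
  have hN := h.four_le
  have hne : V (m - 1) ≠ V (m + 1) := h.ne_of_lt (by omega) (by omega)
  have u1 := h.even (m + 1) hmo.add_one
  have u2 := h.even (m - 1) (hmo.sub_odd odd_one)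
  obtain ⟨τ₁, t1⟩ := exists_lineMap_of_cr hnd e1
  obtain ⟨τ₂, t2⟩ := exists_lineMap_of_cr hnd e2
  have hτ : τ₁ - τ₂ ≠ 0 := by
    intro h0
    apply hne
    rw [t1, t2, sub_eq_zero.1 h0]
  have e0 : cr (V (m + 1) - V (m - 1)) (V n - V (m - 1)) = 0 := by
    rw [t1, t2]
    simp only [AffineMap.lineMap_apply_module, cr, PiLp.sub_apply, PiLp.add_apply,
      PiLp.smul_apply, smul_eq_mul]
    ring
  obtain ⟨τ, t0⟩ := exists_lineMap_of_cr hne e0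
  have hendp : V m ≠ V n ∧ V m ≠ V d := by
    rw [openSegment_eq_lineMap] at hm
    obtain ⟨θ, hθ, e⟩ := hm
    constructor
    · intro h'
      rw [h'] at e
      have := lineMap_inj hnd (e.trans (AffineMap.lineMap_apply_zero _ _).symm)
      linarith [hθ.1]
    · intro h'
      rw [h'] at e
      have := lineMap_inj hnd (e.trans (AffineMap.lineMap_apply_one _ _).symm)
      linarith [hθ.2]
  have hcol : ∀ c : ℤ, c = m + 1 ∨ c = m - 1 → V n = V c → False := by
    intro c hc hcn
    have hdv := h.inj _ _ hcn
    have hdd : V d = V (c + (d - n)) := h.eq_of_dvd (by convert hdv using 1; ring)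
    have hncol := h.ncol c (by rcases hc with rfl | rfl
                               · exact hmo.add_one
                               · exact hmo.sub_odd odd_one)
    have hcrm : cr (V d - V n) (V m - V n) = 0 := by
      rw [openSegment_eq_lineMap] at hm
      obtain ⟨θ, hθ, e⟩ := hm
      rw [← e, cr_lineMap_self]
    have hs : c + (d - n) ≠ m := fun hs => hendp.2 (by rw [hdd, hs])
    rw [hdd, hcn] at hcrm
    rcases hc with rfl | rfl <;> rcases hd with rfl | rfl
    · apply hncol
      convert hcrm using 4 <;> ring
    · exact hs (by ring)
    · exact hs (by ring)
    · apply hncol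
      rw [cr_swap, neg_eq_zero]
      convert hcrm using 4 <;> ring
  have hun := h.even n hn
  rw [t0] at hun
  rcases eq_or_eq_of_unit_lineMap u2 u1 hne hun with rfl | rfl
  · exact hcol (m - 1) (Or.inr rfl) (by rw [t0, AffineMap.lineMap_apply_zero])
  · exact hcol (m + 1) (Or.inl rfl) (by rw [t0, AffineMap.lineMap_apply_one])

theorem vertex_notMem_openEdge (h : KPoly N K V) (m n : ℤ) :
    V m ∉ openSegment ℝ (V n) (V (n + 1)) := by
  rcases Int.even_or_odd n with hn | hn
  · exact h.vertex_notMem_openEdge_aux hn (Or.inl rfl)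
  · rw [openSegment_symm]
    exact h.vertex_notMem_openEdge_aux hn.add_one (Or.inr (by ring))

/-- The vertices on the line through an edge. -/
theorem on_edge_line (h : KPoly N K V) {n b : ℤ} (hn : Even n)
    (hb : cr (V (n + 1) - V n) (V b - V n) = 0) :
    V b = V n ∨ V b = V (n + 1) ∨
      (V b = V (n + 2) ∧ V (n + 1) ∈ openSegment ℝ (V n) (V (n + 2))) := by
  have hne := h.ne_succ n
  have hN := h.four_le
  have hnn : ∀ {x y : E2}, x ≠ y → ‖x‖ ≤ 1 → ‖y‖ ≤ 1 → ∀ j, Even j → V j ∉ openSegment ℝ x y := by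
    intro x y hxy hx hy j hj hm
    have := openSegment_subset_disk hx hy hxy hm
    rw [mem_disk, h.even j hj] at this
    exact lt_irrefl _ this
  obtain ⟨τ, t⟩ := exists_lineMap_of_cr hne hb
  rcases lt_trichotomy τ 0 with h0 | rfl | h0
  · exfalso
    have hm := mem_openSegment_lineMap (V n) (V (n + 1)) h0 one_pos
    rw [AffineMap.lineMap_apply_zero, AffineMap.lineMap_apply_one, ← t] at hm
    refine hnn (fun e => ?_) (h.norm_le b) (h.norm_le (n + 1)) n hn hm
    have := lineMap_inj hne (t.symm.trans (e.trans (AffineMap.lineMap_apply_one _ _).symm))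
    linarith
  · left; rw [t, AffineMap.lineMap_apply_zero]
  rcases lt_trichotomy τ 1 with h1 | rfl | h1
  · exfalso
    apply h.vertex_notMem_openEdge b n
    rw [openSegment_eq_lineMap, t]
    exact ⟨τ, ⟨h0, h1⟩, rfl⟩
  · right; left; rw [t, AffineMap.lineMap_apply_one]
  right; right
  have hnb : V n ≠ V b := by
    intro e
    have := lineMap_inj hne (t.symm.trans (e.symm.trans (AffineMap.lineMap_apply_zero _ _).symm))
    linarith
  have hm := mem_openSegment_lineMap (V n) (V (n + 1)) one_pos h1
  rw [AffineMap.lineMap_apply_zero, AffineMap.lineMap_apply_one, ← t] at hm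
  have hc := h.cr_neighbour (h.mem_closure n) (h.mem_closure b) hm (Or.inl rfl)
  rw [add_assoc, one_add_one_eq_two] at hc
  obtain ⟨ρ, r⟩ := exists_lineMap_of_cr hnb hc
  have hn2 : Even (n + 2) := hn.add even_two
  have hne2 : V n ≠ V (n + 2) := h.ne_of_lt (by omega) (by omega)
  rcases lt_trichotomy ρ 0 with r0 | rfl | r0
  · exfalso
    have hm2 := mem_openSegment_lineMap (V n) (V b) r0 one_pos
    rw [AffineMap.lineMap_apply_zero, AffineMap.lineMap_apply_one, ← r] at hm2
    refine hnn (fun e => ?_) (h.norm_le (n + 2)) (h.norm_le b) n hn hm2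
    have := lineMap_inj hnb (r.symm.trans (e.trans (AffineMap.lineMap_apply_one _ _).symm))
    linarith
  · rw [AffineMap.lineMap_apply_zero] at r; exact absurd r.symm hne2
  rcases lt_trichotomy ρ 1 with r1 | rfl | r1
  · exfalso
    refine hnn hnb (h.norm_le n) (h.norm_le b) (n + 2) hn2 ?_
    rw [openSegment_eq_lineMap, r]
    exact ⟨ρ, ⟨r0, r1⟩, rfl⟩
  · rw [AffineMap.lineMap_apply_one] at r
    exact ⟨r.symm, r ▸ hm⟩
  · exfalso
    rw [openSegment_eq_lineMap] at hm
    obtain ⟨θ, hθ, e⟩ := hm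
    have hm2 := mem_openSegment_lineMap (V n) (V b) hθ.2 r1
    rw [AffineMap.lineMap_apply_one, ← r, e] at hm2
    have := h.vertex_notMem_openEdge b (n + 1)
    rw [add_assoc, one_add_one_eq_two] at this
    exact this hm2

/-- A chord from an ideal vertex is proper unless it runs along an adjacent edge. -/
theorem openSegment_subset (h : KPoly N K V) {n b : ℤ} (hn : Even n)
    (h1 : cr (V (n + 1) - V n) (V b - V n) ≠ 0) (h2 : cr (V (n - 1) - V n) (V b - V n) ≠ 0) :
    openSegment ℝ (V n) (V b) ⊆ K := by
  have hsgn : ∀ d : ℤ, d = n + 1 ∨ d = n - 1 → ∃ σ : ℝ, ∀ w ∈ closure K,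
      0 ≤ σ * cr (V d - V n) (w - V n) ∧ (cr (V d - V n) (w - V n) ≠ 0 →
        0 < σ * cr (V d - V n) (w - V n)) := by
    intro d hd
    have hnd : V n ≠ V d := by
      rcases hd with rfl | rfl
      · exact h.ne_succ n
      · have := h.ne_succ (n - 1); rw [sub_add_cancel] at this; exact this.symm
    have hz : ∃ z ∈ openSegment ℝ (V n) (V d), z ∉ K := by
      refine ⟨midpoint ℝ (V n) (V d), midpoint_mem_openSegment _ _, ?_⟩
      rcases hd with rfl | rfl
      · exact h.notMem_of_frontier (h.openEdge_subset n (midpoint_mem_openSegment _ _))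
      · have := h.openEdge_subset (n - 1)
        rw [sub_add_cancel, openSegment_symm] at this
        exact h.notMem_of_frontier (this (midpoint_mem_openSegment _ _))
    obtain ⟨z, hz, hzK⟩ := hz
    obtain ⟨σ, hσ, hw⟩ := exists_sign h.isOpen h.convex hnd (h.mem_closure n) (h.mem_closure d)
      hz hzK
    have hσ0 : σ ≠ 0 := by rcases hσ with rfl | rfl <;> norm_num
    refine ⟨σ, fun w hwc => ?_⟩
    have h0 : 0 ≤ σ * cr (V d - V n) (w - V n) :=
      le_of_mem_closure (f := fun w => σ * cr (V d - V n) (w - V n))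
        (continuous_const.mul (continuous_cr _ _)) (fun w h' => (hw w h').le) hwc
    exact ⟨h0, fun hne => lt_of_le_of_ne h0 (mul_ne_zero hσ0 hne).symm⟩
  obtain ⟨σ₁, s1⟩ := hsgn (n + 1) (Or.inl rfl)
  obtain ⟨σ₂, s2⟩ := hsgn (n - 1) (Or.inr rfl)
  have hc0 := h.ncol n hn
  have p1 := (s1 _ (h.mem_closure (n - 1))).2 hc0
  have p2 := (s1 _ (h.mem_closure b)).2 h1
  have p3 := (s2 _ (h.mem_closure (n + 1))).2 (by rw [cr_swap, neg_ne_zero]; exact hc0)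
  have p4 := (s2 _ (h.mem_closure b)).2 h2
  set e := V (n + 1) - V n
  set g := V (n - 1) - V n
  set v := V b - V n
  have hA : 0 < cr e v / cr e g := by
    rw [show cr e v / cr e g = (σ₁ * cr e v) / (σ₁ * cr e g) from
      (mul_div_mul_left _ _ (left_ne_zero_of_mul p1.ne')).symm]
    positivity
  have hB : 0 < cr v g / cr e g := by
    rw [show cr v g / cr e g = (σ₂ * cr g v) / (σ₂ * cr g e) by
      rw [mul_div_mul_left _ _ (left_ne_zero_of_mul p3.ne'), cr_swap g v, cr_swap g e, neg_div_neg_eq]]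
    positivity
  set A := cr e v / cr e g
  set B := cr v g / cr e g
  have hv : v = B • e + A • g := by
    have hd := cr_decomp e g v
    have : v = (cr e g)⁻¹ • (cr v g • e + cr e v • g) := by
      rw [← hd, smul_smul, inv_mul_cancel₀ hc0, one_smul]
    rw [this, smul_add, smul_smul, smul_smul, inv_mul_eq_div, inv_mul_eq_div]
  set δ := 1 / (1 + A + B + 1) with hδ
  have hδ0 : 0 < δ := by positivity
  have hδ1 : δ < 1 := by rw [hδ, div_lt_one (by positivity)]; linarith
  have hδ2 : δ * B + δ * A < 1 := by
    have : δ * B + δ * A = (A + B) / (1 + A + B + 1) := by rw [hδ]; ring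
    rw [this, div_lt_one (by positivity)]; linarith
  have hz : V n + (δ * B) • e + (δ * A) • g ∈ K := by
    refine triangle_mem h.isOpen h.convex (h.mem_closure n) ?_ ?_ (by positivity)
      (by positivity) hδ2 hc0
    · simpa [e] using h.mem_closure (n + 1)
    · simpa [g] using h.mem_closure (n - 1)
  refine openSegment_subset_of_inter h.isOpen h.convex (h.mem_closure n) (h.mem_closure b) ?_ hz
  rw [openSegment_eq_lineMap]
  refine ⟨δ, ⟨hδ0, hδ1⟩, ?_⟩
  rw [AffineMap.lineMap_apply, vsub_eq_sub, vadd_eq_add]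
  change δ • v + V n = _
  rw [hv]; module

end KPoly

namespace KPoly
variable {N : ℤ} {K : Set E2} {V : ℤ → E2}

/-! ### Orientation -/

theorem orient_edge (h : KPoly N K V) (n : ℤ) : ∃ σ : ℝ, (σ = 1 ∨ σ = -1) ∧
    ∀ w ∈ K, 0 < σ * cr (V (n + 1) - V n) (w - V n) :=
  exists_sign h.isOpen h.convex (h.ne_succ n) (h.mem_closure n) (h.mem_closure (n + 1))
    (midpoint_mem_openSegment _ _)
    (h.notMem_of_frontier (h.openEdge_subset n (midpoint_mem_openSegment _ _)))

theorem orient_nonneg {n : ℤ} {σ : ℝ}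
    (hσ : ∀ w ∈ K, 0 < σ * cr (V (n + 1) - V n) (w - V n)) {x : E2} (hx : x ∈ closure K) :
    0 ≤ σ * cr (V (n + 1) - V n) (x - V n) :=
  le_of_mem_closure (K := K) (f := fun w => σ * cr (V (n + 1) - V n) (w - V n))
    (continuous_const.mul (continuous_cr _ _)) (fun w h' => (hσ w h').le) hx

theorem orient_step (h : KPoly N K V) {n : ℤ} {σ : ℝ}
    (hσ : ∀ w ∈ K, 0 < σ * cr (V (n + 1) - V n) (w - V n)) :
    ∀ w ∈ K, 0 < σ * cr (V (n + 1 + 1) - V (n + 1)) (w - V (n + 1)) := by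
  intro w hw
  obtain ⟨σ', -, h'⟩ := h.orient_edge (n + 1)
  have hN := h.four_le
  set c := cr (V (n + 1) - V n) (V (n + 1 + 1) - V (n + 1)) with hc
  have e1 : cr (V (n + 1) - V n) (V (n + 1 + 1) - V n) = c := by
    rw [hc]; simp only [cr, PiLp.sub_apply]; ring
  by_cases hc0 : c = 0
  · have hn : Even n := by
      by_contra ho
      have := h.ncol (n + 1) (Int.not_even_iff_odd.1 ho).add_one
      rw [add_sub_cancel_right] at this
      apply this
      rw [← hc0, hc]; simp only [cr, PiLp.sub_apply]; ring
    rcases h.on_edge_line (b := n + 2) hn (by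
      rw [← hc0, ← e1, add_assoc, one_add_one_eq_two]) with h1 | h1 | ⟨-, h1⟩
    · exact absurd h1.symm (h.ne_of_lt (by omega) (by omega))
    · exact absurd h1.symm (h.ne_of_lt (by omega) (by omega))
    · rw [openSegment_eq_lineMap] at h1
      obtain ⟨s, hs, e⟩ := h1
      have p := hσ w hw
      rw [add_assoc, one_add_one_eq_two, ← e]
      rw [← e] at p
      have i1 : cr (AffineMap.lineMap (V n) (V (n + 2)) s - V n) (w - V n) =
          s * cr (V (n + 2) - V n) (w - V n) := by
        simp only [AffineMap.lineMap_apply_module, cr, PiLp.sub_apply, PiLp.add_apply,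
          PiLp.smul_apply, smul_eq_mul]; ring
      have i2 : cr (V (n + 2) - AffineMap.lineMap (V n) (V (n + 2)) s)
          (w - AffineMap.lineMap (V n) (V (n + 2)) s) =
          (1 - s) * cr (V (n + 2) - V n) (w - V n) := by
        simp only [AffineMap.lineMap_apply_module, cr, PiLp.sub_apply, PiLp.add_apply,
          PiLp.smul_apply, smul_eq_mul]; ring
      rw [i1] at p
      rw [i2]
      have hs1 := hs.1
      have hs2 := hs.2
      have : 0 < σ * cr (V (n + 2) - V n) (w - V n) := by
        by_contra hq
        nlinarith
      nlinarith
  · have q1 := orient_nonneg hσ (h.mem_closure (n + 1 + 1))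
    have q2 := orient_nonneg h' (h.mem_closure n)
    rw [e1] at q1
    have e2 : cr (V (n + 1 + 1) - V (n + 1)) (V n - V (n + 1)) = c := by
      rw [hc]; simp only [cr, PiLp.sub_apply]; ring
    rw [e2] at q2
    have p := h' w hw
    have hσ0 : σ ≠ 0 := left_ne_zero_of_mul (hσ w hw).ne'
    have q1' : 0 < σ * c := lt_of_le_of_ne q1 (mul_ne_zero hσ0 hc0).symm
    have q2' : 0 < σ' * c := lt_of_le_of_ne q2 (mul_ne_zero (left_ne_zero_of_mul p.ne') hc0).symm
    have : 0 < (σ' * c) * (σ * cr (V (n + 1 + 1) - V (n + 1)) (w - V (n + 1))) := by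
      have := mul_pos q1' p
      nlinarith
    exact (pos_iff_pos_of_mul_pos this).1 q2'

/-- The polygon lies on the same side of all its (oriented) edges. -/
def Oriented (K : Set E2) (V : ℤ → E2) (ε : ℝ) : Prop :=
  ∀ n, ∀ w ∈ K, 0 < ε * cr (V (n + 1) - V n) (w - V n)

theorem exists_orient (h : KPoly N K V) : ∃ ε : ℝ, Oriented K V ε := by
  obtain ⟨ε, -, h0⟩ := h.orient_edge 0
  refine ⟨ε, ?_⟩
  have hnat : ∀ n : ℕ, ∀ w ∈ K, 0 < ε * cr (V ((n : ℤ) + 1) - V n) (w - V n) := by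
    intro n
    induction n with
    | zero => simpa using h0
    | succ n ih => simpa using h.orient_step ih
  intro n w hw
  have hN := h.four_le
  have hnn : 0 ≤ n + |n| * N := by
    have := neg_abs_le n
    have := abs_nonneg n
    nlinarith
  obtain ⟨m, hm⟩ := Int.eq_ofNat_of_zero_le hnn
  have := hnat m w hw
  rw [← hm, h.per_mul, show n + |n| * N + 1 = n + 1 + |n| * N by ring, h.per_mul] at this
  exact this

/-! ### Chords -/

theorem chord_line (h : KPoly N K V) {a b : ℤ} (hne : V a ≠ V b)
    (hch : openSegment ℝ (V a) (V b) ⊆ K) {x : E2} (hx : x ∈ closure K)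
    (h0 : cr (V b - V a) (x - V a) = 0) : x ∈ segment ℝ (V a) (V b) := by
  obtain ⟨τ, rfl⟩ := exists_lineMap_of_cr hne h0
  have hz : (AffineMap.lineMap (V a) (V b) (1/2:ℝ) : E2) ∈ K := by
    apply hch; rw [openSegment_eq_lineMap]; exact ⟨1/2, by norm_num, rfl⟩
  rw [segment_eq_image_lineMap]
  refine ⟨τ, ⟨?_, ?_⟩, rfl⟩
  · by_contra! hτ
    have := mem_openSegment_lineMap (V a) (V b) hτ (by norm_num : (0:ℝ) < 1/2)
    rw [AffineMap.lineMap_apply_zero] at this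
    exact h.notMem a (openSegment_subset_of_mem' h.isOpen h.convex hx hz this)
  · by_contra! hτ
    have := mem_openSegment_lineMap (V a) (V b) (by norm_num : (1/2:ℝ) < 1) hτ
    rw [AffineMap.lineMap_apply_one] at this
    exact h.notMem b (openSegment_subset_of_mem h.isOpen h.convex hz hx this)

theorem chord_line_notMem (h : KPoly N K V) {a b : ℤ} (hne : V a ≠ V b)
    (hch : openSegment ℝ (V a) (V b) ⊆ K) {x : E2} (hx : x ∈ closure K) (hxK : x ∉ K)
    (h0 : cr (V b - V a) (x - V a) = 0) : x = V a ∨ x = V b := by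
  have h1 := h.chord_line hne hch hx h0
  rw [← insert_endpoints_openSegment] at h1
  rcases h1 with h1 | h1 | h1
  · exact Or.inl h1
  · exact Or.inr h1
  · exact absurd (hch h1) hxK

theorem chord_add_two_le (h : KPoly N K V) {a b : ℤ} (hab : a < b)
    (hch : openSegment ℝ (V a) (V b) ⊆ K) : a + 2 ≤ b := by
  by_contra hc
  obtain rfl : b = a + 1 := by omega
  exact h.notMem_of_frontier (h.openEdge_subset a (midpoint_mem_openSegment _ _))
    (hch (midpoint_mem_openSegment _ _))

theorem chord_neg (h : KPoly N K V) {ε : ℝ} (hε : Oriented K V ε) {a b : ℤ}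
    (hbN : b < a + N) (hch : openSegment ℝ (V a) (V b) ⊆ K) {n : ℤ}
    (hn1 : a < n) (hn2 : n < b) : ε * cr (V b - V a) (V n - V a) < 0 := by
  have hne : V a ≠ V b := h.ne_of_lt (by omega) hbN
  have hz : midpoint ℝ (V a) (V b) ∈ K := hch (midpoint_mem_openSegment _ _)
  have hε0 : ε ≠ 0 := left_ne_zero_of_mul (hε a _ hz).ne'
  have key : ∀ m : ℕ, a + 1 + m < b → ε * cr (V b - V a) (V (a + 1 + m) - V a) < 0 := by
    intro m
    induction m with
    | zero =>
      intro _
      have := hε a _ hz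
      rw [midpoint_eq_smul_add] at this
      have e : cr (V (a + 1) - V a) ((⅟2:ℝ) • (V a + V b) - V a) =
          -(1/2) * cr (V b - V a) (V (a + 1) - V a) := by
        simp only [cr, PiLp.sub_apply, PiLp.add_apply, PiLp.smul_apply, smul_eq_mul,
          invOf_eq_inv]; ring
      rw [e] at this
      simp only [Nat.cast_zero, add_zero]
      linarith
    | succ m ih =>
      intro hm
      push_cast at hm ⊢
      have ih' := ih (by omega)
      rw [← add_assoc]
      set j := a + 1 + (m : ℤ) with hj
      by_contra! hc
      rcases hc.eq_or_lt with hc | hc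
      · rcases h.chord_line_notMem hne hch (h.mem_closure (j + 1)) (h.notMem _)
          ((mul_eq_zero.1 hc.symm).resolve_left hε0) with e | e
        · exact h.ne_of_lt (by omega) (by omega) e.symm
        · exact h.ne_of_lt (by omega) (by omega) e
      · set p := ε * cr (V b - V a) (V j - V a) with hp
        set q := ε * cr (V b - V a) (V (j + 1) - V a) with hq
        have hpq : 0 < q - p := by linarith
        have hx : (AffineMap.lineMap (V j) (V (j + 1)) (-p / (q - p)) : E2) ∈
            openSegment ℝ (V j) (V (j + 1)) := by
          rw [openSegment_eq_lineMap]
          refine ⟨_, ⟨by apply div_pos <;> linarith, ?_⟩, rfl⟩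
          rw [div_lt_one hpq]; linarith
        have hx0 : ε * cr (V b - V a) (AffineMap.lineMap (V j) (V (j + 1)) (-p / (q - p)) - V a)
            = 0 := by
          rw [cr_lineMap]
          have : (1 - -p / (q - p)) * p + -p / (q - p) * q = 0 := by field_simp; ring
          rw [← this, hp, hq]; ring
        have hfr := h.openEdge_subset j hx
        rcases h.chord_line_notMem hne hch (frontier_subset_closure hfr)
          (h.notMem_of_frontier hfr) ((mul_eq_zero.1 hx0).resolve_left hε0) with e | e
        · exact h.vertex_notMem_openEdge a j (e ▸ hx)
        · exact h.vertex_notMem_openEdge b j (e ▸ hx)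
  obtain ⟨m, hm⟩ := Int.eq_ofNat_of_zero_le (show 0 ≤ n - (a + 1) by omega)
  have := key m (by omega)
  rwa [show a + 1 + (m : ℤ) = n by omega] at this

theorem chord_pos (h : KPoly N K V) {ε : ℝ} (hε : Oriented K V ε) {a b : ℤ} (hab : a < b)
    (hch : openSegment ℝ (V a) (V b) ⊆ K) {n : ℤ}
    (hn1 : b < n) (hn2 : n < a + N) : 0 < ε * cr (V b - V a) (V n - V a) := by
  have := h.chord_neg hε (a := b) (b := a + N) (by omega)
    (by rw [h.per, openSegment_symm]; exact hch) hn1 hn2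
  rw [h.per] at this
  have e : cr (V a - V b) (V n - V b) = - cr (V b - V a) (V n - V a) := by
    simp only [cr, PiLp.sub_apply]; ring
  rw [e] at this
  linarith

/-! ### The polygon cut off by a chord -/

/-- The part of `K` on the right of the chord from `V a` to `V b`. -/
def cut (K : Set E2) (V : ℤ → E2) (ε : ℝ) (a b : ℤ) : Set E2 :=
  {x ∈ K | ε * cr (V b - V a) (x - V a) < 0}

theorem continuous_side (V : ℤ → E2) (ε : ℝ) (a b : ℤ) :
    Continuous fun x : E2 => ε * cr (V b - V a) (x - V a) :=
  continuous_const.mul (continuous_cr _ _)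

theorem side_lineMap (V : ℤ → E2) (ε : ℝ) (a b : ℤ) (x y : E2) (τ : ℝ) :
    ε * cr (V b - V a) (AffineMap.lineMap x y τ - V a) =
      (1 - τ) * (ε * cr (V b - V a) (x - V a)) + τ * (ε * cr (V b - V a) (y - V a)) := by
  rw [cr_lineMap]; ring

theorem isOpen_cut (h : KPoly N K V) (ε : ℝ) (a b : ℤ) : IsOpen (cut K V ε a b) :=
  h.isOpen.inter (isOpen_lt (continuous_side V ε a b) continuous_const)

theorem convex_cut (h : KPoly N K V) (ε : ℝ) (a b : ℤ) : Convex ℝ (cut K V ε a b) := by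
  rw [convex_iff_segment_subset]
  intro x hx y hy w hw
  refine ⟨h.convex.segment_subset hx.1 hy.1 hw, ?_⟩
  rw [segment_eq_image_lineMap] at hw
  obtain ⟨τ, hτ, rfl⟩ := hw
  rw [side_lineMap]
  have := hx.2
  have := hy.2
  rcases hτ.1.eq_or_lt with rfl | h0
  · simpa
  · nlinarith [hτ.2]

theorem cut_aux (h : KPoly N K V) {ε : ℝ} (hε : Oriented K V ε) {a b : ℤ}
    (hab : a < b) (hbN : b < a + N) (hch : openSegment ℝ (V a) (V b) ⊆ K) {z : E2}
    (hz : z ∈ openSegment ℝ (V a) (V b)) : openSegment ℝ z (V (a + 1)) ⊆ cut K V ε a b := by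
  have h2 := h.chord_add_two_le hab hch
  have hneg := h.chord_neg hε hbN hch (n := a + 1) (by omega) (by omega)
  intro x hx
  refine ⟨openSegment_subset_of_mem h.isOpen h.convex (hch hz) (h.mem_closure _) hx, ?_⟩
  rw [openSegment_eq_lineMap] at hx hz
  obtain ⟨τ, hτ, rfl⟩ := hx
  obtain ⟨θ, hθ, rfl⟩ := hz
  rw [side_lineMap, cr_lineMap_self]
  nlinarith [hτ.1]

theorem cut_nonempty (h : KPoly N K V) {ε : ℝ} (hε : Oriented K V ε) {a b : ℤ}
    (hab : a < b) (hbN : b < a + N) (hch : openSegment ℝ (V a) (V b) ⊆ K) :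
    (cut K V ε a b).Nonempty :=
  ⟨_, h.cut_aux hε hab hbN hch (midpoint_mem_openSegment _ _) (midpoint_mem_openSegment _ _)⟩

theorem cut_ne {ε : ℝ} {a b : ℤ}
    (hch : openSegment ℝ (V a) (V b) ⊆ K) : cut K V ε a b ≠ K := by
  intro he
  have h1 : midpoint ℝ (V a) (V b) ∈ cut K V ε a b := by
    rw [he]; exact hch (midpoint_mem_openSegment _ _)
  have h2 := h1.2
  rw [← lineMap_one_half (R := ℝ), cr_lineMap_self] at h2
  linarith

theorem frontier_cut (h : KPoly N K V) {ε : ℝ} (hε : Oriented K V ε) {a b : ℤ}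
    (hab : a < b) (hbN : b < a + N) (hch : openSegment ℝ (V a) (V b) ⊆ K) :
    frontier (cut K V ε a b) ∩ Disk = (segment ℝ (V a) (V b) ∪
      ⋃ n ∈ Ico a b, segment ℝ (V n) (V (n + 1))) ∩ Disk := by
  have h2 := h.chord_add_two_le hab hch
  have hne : V a ≠ V b := h.ne_of_lt hab hbN
  have hz : midpoint ℝ (V a) (V b) ∈ K := hch (midpoint_mem_openSegment _ _)
  have hε0 : ε ≠ 0 := left_ne_zero_of_mul (hε a _ hz).ne'
  have hga : ε * cr (V b - V a) (V a - V a) = 0 := by rw [sub_self, cr_zero_right, mul_zero]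
  have hgb : ε * cr (V b - V a) (V b - V a) = 0 := by rw [cr_self, mul_zero]
  ext x
  simp only [mem_inter_iff, and_congr_left_iff]
  intro hxD
  rw [(h.isOpen_cut ε a b).frontier_eq]
  constructor
  · rintro ⟨hxc, hxn⟩
    have hxK : x ∈ closure K := closure_mono (fun w hw => hw.1) hxc
    have hx0 : ε * cr (V b - V a) (x - V a) ≤ 0 := by
      have := le_of_mem_closure (K := cut K V ε a b)
        (f := fun x => -(ε * cr (V b - V a) (x - V a))) (continuous_side V ε a b).neg
        (fun w hw => by linarith [hw.2]) hxc
      linarith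
    by_cases hxKK : x ∈ K
    · have : ε * cr (V b - V a) (x - V a) = 0 := by
        by_contra hcon
        exact hxn ⟨hxKK, lt_of_le_of_ne hx0 hcon⟩
      exact Or.inl (h.chord_line hne hch hxK ((mul_eq_zero.1 this).resolve_left hε0))
    · have hfr : x ∈ frontier K ∩ Disk := ⟨by rw [h.isOpen.frontier_eq]; exact ⟨hxK, hxKK⟩, hxD⟩
      rw [h.bdry] at hfr
      obtain ⟨n, hn⟩ := mem_iUnion.1 hfr.1
      set n' := a + (n - a) % N with hn'
      have hN := h.four_le
      have hd : N ∣ n' - n := by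
        rw [hn']
        have := Int.mul_ediv_add_emod (n - a) N
        exact ⟨-((n - a) / N), by linarith⟩
      have hx' : x ∈ segment ℝ (V n') (V (n' + 1)) := by
        rw [← h.eq_of_dvd hd, ← h.eq_of_dvd (m := n + 1) (n := n' + 1) (by
          rwa [add_sub_add_right_eq_sub])]
        exact hn
      have hr1 : a ≤ n' := by have := Int.emod_nonneg (n - a) (b := N) (by omega); omega
      have hr2 : n' < a + N := by have := Int.emod_lt_of_pos (n - a) (b := N) (by omega); omega
      clear_value n'
      by_cases hnb : n' < b
      · exact Or.inr (mem_iUnion₂.2 ⟨n', ⟨hr1, hnb⟩, hx'⟩)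
      · push Not at hnb
        have hg : ∀ m, b ≤ m → m ≤ a + N → 0 ≤ ε * cr (V b - V a) (V m - V a) := by
          intro m h1 h2
          rcases h1.eq_or_lt with rfl | h1
          · exact hgb.ge
          rcases h2.eq_or_lt with rfl | h2
          · rw [h.per]; exact hga.ge
          · exact (h.chord_pos hε hab hch h1 h2).le
        have g1 := hg n' hnb hr2.le
        have g2 := hg (n' + 1) (by omega) (by omega)
        rw [segment_eq_image_lineMap] at hx'
        obtain ⟨τ, hτ, rfl⟩ := hx'
        have g3 := side_lineMap V ε a b (V n') (V (n' + 1)) τ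
        have : ε * cr (V b - V a) (AffineMap.lineMap (V n') (V (n' + 1)) τ - V a) = 0 := by
          apply le_antisymm hx0
          rw [g3]
          have := hτ.1
          have := hτ.2
          have : 0 ≤ 1 - τ := by linarith
          positivity
        exact Or.inl (h.chord_line hne hch hxK ((mul_eq_zero.1 this).resolve_left hε0))
  · rw [← (h.isOpen_cut ε a b).frontier_eq]
    rintro (hx | hx)
    · refine closure_minimal (fun z hz => ?_) isClosed_frontier
        (segment_subset_closure_openSegment hx)
      rw [(h.isOpen_cut ε a b).frontier_eq]
      refine ⟨closure_mono (h.cut_aux hε hab hbN hch hz)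
        (segment_subset_closure_openSegment (left_mem_segment ℝ _ _)), fun hc => ?_⟩
      rw [openSegment_eq_lineMap] at hz
      obtain ⟨θ, hθ, rfl⟩ := hz
      have := hc.2
      rw [cr_lineMap_self] at this
      linarith
    · obtain ⟨n, hn, hx⟩ := mem_iUnion₂.1 hx
      refine closure_minimal (fun z hz => ?_) isClosed_frontier
        (segment_subset_closure_openSegment hx)
      have hzf := h.openEdge_subset n hz
      rw [(h.isOpen_cut ε a b).frontier_eq]
      refine ⟨?_, fun hc => h.notMem_of_frontier hzf hc.1⟩
      have hzneg : ε * cr (V b - V a) (z - V a) < 0 := by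
        rw [openSegment_eq_lineMap] at hz
        obtain ⟨τ, hτ, rfl⟩ := hz
        rw [side_lineMap]
        have := hτ.1
        have := hτ.2
        rcases hn.1.eq_or_lt with rfl | h1
        · have := h.chord_neg hε hbN hch (n := a + 1) (by omega) (by omega)
          rw [hga]; nlinarith
        · have p := h.chord_neg hε hbN hch h1 hn.2
          rcases (show n + 1 ≤ b from hn.2).eq_or_lt with h3 | h3
          · rw [h3, hgb]; nlinarith
          · have := h.chord_neg hε hbN hch (n := n + 1) (by omega) h3
            nlinarith
      have hop : IsOpen {x : E2 | ε * cr (V b - V a) (x - V a) < 0} :=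
        isOpen_lt (continuous_side V ε a b) continuous_const
      have hcl : z ∈ {x : E2 | ε * cr (V b - V a) (x - V a) < 0} ∩ closure K :=
        ⟨hzneg, frontier_subset_closure hzf⟩
      refine closure_mono (fun w hw => ?_) (hop.inter_closure hcl)
      exact ⟨hw.2, hw.1⟩

end KPoly

/-! ### Transfer between the two models -/

/-- The change of model as a homeomorphism of the open disk. -/
def kleinHomeo : OpenPartialHomeomorph E2 E2 where
  toFun := toKlein
  invFun := fromKlein
  source := Disk
  target := Disk
  map_source' _ hp := toKlein_mem_disk hp
  map_target' _ hp := fromKlein_mem_disk hp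
  left_inv' _ hp := fromKlein_toKlein (mem_disk.1 hp).le
  right_inv' _ hp := toKlein_fromKlein (mem_disk.1 hp).le
  open_source := isOpen_disk
  open_target := isOpen_disk
  continuousOn_toFun := continuous_toKlein.continuousOn
  continuousOn_invFun := continuous_fromKlein.continuousOn

/-- The set of the Poincaré disk with Klein model `P`. -/
def pull (P : Set E2) : Set E2 := Disk ∩ toKlein ⁻¹' P

/-- The Klein model of a set of the Poincaré disk. -/
def kl (S : Set E2) : Set E2 := Disk ∩ fromKlein ⁻¹' S

theorem mem_pull {P : Set E2} {p : E2} : p ∈ pull P ↔ p ∈ Disk ∧ toKlein p ∈ P := Iff.rfl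

theorem mem_kl {S : Set E2} {p : E2} : p ∈ kl S ↔ p ∈ Disk ∧ fromKlein p ∈ S := Iff.rfl

theorem pull_subset (P : Set E2) : pull P ⊆ Disk := inter_subset_left

theorem kl_subset (S : Set E2) : kl S ⊆ Disk := inter_subset_left

theorem toKlein_mem_kl {S : Set E2} {p : E2} (hp : p ∈ Disk) : toKlein p ∈ kl S ↔ p ∈ S := by
  rw [mem_kl, fromKlein_toKlein (mem_disk.1 hp).le]
  exact and_iff_right (toKlein_mem_disk hp)

theorem pull_kl {S : Set E2} (hS : S ⊆ Disk) : pull (kl S) = S := by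
  ext p
  constructor
  · rintro ⟨h1, h2⟩; exact (toKlein_mem_kl h1).1 h2
  · intro h; exact ⟨hS h, (toKlein_mem_kl (hS h)).2 h⟩

theorem kl_pull {P : Set E2} (hP : P ⊆ Disk) : kl (pull P) = P := by
  ext p
  constructor
  · rintro ⟨h1, h2, h3⟩
    rwa [mem_preimage, toKlein_fromKlein (mem_disk.1 h1).le] at h3
  · intro h
    refine ⟨hP h, fromKlein_mem_disk (hP h), ?_⟩
    rwa [mem_preimage, toKlein_fromKlein (mem_disk.1 (hP h)).le]

theorem isOpen_pull {P : Set E2} (hP : IsOpen P) : IsOpen (pull P) :=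
  isOpen_disk.inter (hP.preimage continuous_toKlein)

theorem isOpen_kl {P : Set E2} (hP : IsOpen P) : IsOpen (kl P) :=
  isOpen_disk.inter (hP.preimage continuous_fromKlein)

theorem pull_eq_image {P : Set E2} (hP : P ⊆ Disk) : pull P = fromKlein '' P := by
  ext p
  constructor
  · rintro ⟨h1, h2⟩; exact ⟨_, h2, fromKlein_toKlein (mem_disk.1 h1).le⟩
  · rintro ⟨x, hx, rfl⟩
    exact ⟨fromKlein_mem_disk (hP hx), by
      rwa [mem_preimage, toKlein_fromKlein (mem_disk.1 (hP hx)).le]⟩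

theorem kl_eq_image {S : Set E2} (hS : S ⊆ Disk) : kl S = toKlein '' S := by
  ext p
  constructor
  · rintro ⟨h1, h2⟩; exact ⟨_, h2, toKlein_fromKlein (mem_disk.1 h1).le⟩
  · rintro ⟨x, hx, rfl⟩
    exact (toKlein_mem_kl (hS hx)).2 hx

theorem frontier_pull (P : Set E2) : frontier (pull P) ∩ Disk = pull (frontier P) := by
  rw [pull, inter_comm Disk, frontier_inter_open_inter isOpen_disk, inter_comm, pull]
  exact (kleinHomeo.preimage_frontier P).symm

theorem frontier_kl (P : Set E2) : frontier (kl P) ∩ Disk = kl (frontier P) := by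
  rw [kl, inter_comm Disk, frontier_inter_open_inter isOpen_disk, inter_comm, kl]
  exact (kleinHomeo.symm.preimage_frontier P).symm

theorem geodArc_eq_pull (a b : E2) : geodArc a b = pull (segment ℝ (toKlein a) (toKlein b)) := by
  ext p; exact mem_geodArc

theorem kl_geodArc (a b : E2) : kl (geodArc a b) = segment ℝ (toKlein a) (toKlein b) ∩ Disk := by
  rw [geodArc_eq_pull]
  ext p
  constructor
  · rintro ⟨h1, -, h2⟩
    rw [mem_preimage, toKlein_fromKlein (mem_disk.1 h1).le] at h2
    exact ⟨h2, h1⟩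
  · rintro ⟨h1, h2⟩
    refine ⟨h2, fromKlein_mem_disk h2, ?_⟩
    rwa [mem_preimage, toKlein_fromKlein (mem_disk.1 h2).le]

theorem kl_iUnion {ι : Sort*} (S : ι → Set E2) : kl (⋃ i, S i) = ⋃ i, kl (S i) := by
  simp only [kl, preimage_iUnion, inter_iUnion]

theorem kl_union (S T : Set E2) : kl (S ∪ T) = kl S ∪ kl T := by
  simp only [kl, preimage_union, inter_union_distrib_left]

theorem kl_inter_disk (S : Set E2) : kl (S ∩ Disk) = kl S := by
  ext p
  exact ⟨fun h => ⟨h.1, h.2.1⟩, fun h => ⟨h.1, h.2, fromKlein_mem_disk h.1⟩⟩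

theorem convex_kl {S : Set E2} (hS : HypConvex S) : Convex ℝ (kl S) := by
  rw [convex_iff_segment_subset]
  intro x hx y hy z hz
  have hzD : z ∈ Disk := by
    have : Convex ℝ (Metric.ball (0 : E2) 1) := convex_ball _ _
    have hb : ∀ {w : E2}, w ∈ Disk ↔ w ∈ Metric.ball (0 : E2) 1 := by simp [mem_disk]
    exact hb.2 (this.segment_subset (hb.1 hx.1) (hb.1 hy.1) hz)
  refine ⟨hzD, hS _ hx.2 _ hy.2 (mem_geodArc.2 ⟨fromKlein_mem_disk hzD, ?_⟩)⟩
  rwa [toKlein_fromKlein (mem_disk.1 hzD).le, toKlein_fromKlein (mem_disk.1 hx.1).le,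
    toKlein_fromKlein (mem_disk.1 hy.1).le]

/-! ### The vertices of a semi-ideal domain -/

namespace SemiIdealDomain
variable {k : ℕ} (D : SemiIdealDomain k)

/-- The cyclic sequence of vertices. -/
def vx (n : ℤ) : E2 :=
  if Even n then D.pI ((n / 2 : ℤ) : ZMod k) else D.pB ((n / 2 : ℤ) : ZMod k)

theorem vx_even (l : ℤ) : D.vx (2 * l) = D.pI (l : ZMod k) := by
  rw [vx, if_pos (even_two_mul l), Int.mul_ediv_cancel_left _ two_ne_zero]

theorem vx_odd (l : ℤ) : D.vx (2 * l + 1) = D.pB (l : ZMod k) := by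
  rw [vx, if_neg (by rw [Int.not_even_iff_odd]; exact odd_two_mul_add_one l),
    show (2 * l + 1) / 2 = l by omega]

theorem vx_odd' (l : ℤ) : D.vx (2 * l - 1) = D.pB ((l : ZMod k) - 1) := by
  rw [show 2 * l - 1 = 2 * (l - 1) + 1 by ring, vx_odd]; push_cast; rfl

theorem norm_vx_le (n : ℤ) : ‖D.vx n‖ ≤ 1 := by
  rcases Int.even_or_odd' n with ⟨l, rfl | rfl⟩
  · rw [vx_even]; exact (D.ideal _).le
  · rw [vx_odd]; exact (mem_disk.1 (D.inter _)).le

theorem exists_vx_of_mem {x : E2} (hx : x ∈ range D.pI ∪ range D.pB) : ∃ n, D.vx n = x := by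
  rcases hx with ⟨i, rfl⟩ | ⟨i, rfl⟩
  · obtain ⟨l, rfl⟩ := ZMod.intCast_surjective i
    exact ⟨2 * l, D.vx_even l⟩
  · obtain ⟨l, rfl⟩ := ZMod.intCast_surjective i
    exact ⟨2 * l + 1, D.vx_odd l⟩

theorem vx_mem (n : ℤ) : D.vx n ∈ range D.pI ∪ range D.pB := by
  rcases Int.even_or_odd' n with ⟨l, rfl | rfl⟩
  · rw [vx_even]; exact Or.inl ⟨_, rfl⟩
  · rw [vx_odd]; exact Or.inr ⟨_, rfl⟩

theorem geodArc_vx_even (l : ℤ) : geodArc (D.vx (2 * l)) (D.vx (2 * l + 1)) = D.edgeA l := by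
  rw [vx_even, vx_odd, edgeA]

theorem geodArc_vx_odd (l : ℤ) : geodArc (D.vx (2 * l + 1)) (D.vx (2 * l + 1 + 1)) = D.edgeB l := by
  rw [vx_odd, show 2 * l + 1 + 1 = 2 * (l + 1) by ring, vx_even, edgeB]; push_cast; rfl

theorem iUnion_edges : (⋃ i, geodArc (D.pI i) (D.pB i)) ∪ (⋃ i, geodArc (D.pB i) (D.pI (i + 1))) =
    ⋃ n : ℤ, geodArc (D.vx n) (D.vx (n + 1)) := by
  ext p
  simp only [mem_union, mem_iUnion]
  constructor
  · rintro (⟨i, hi⟩ | ⟨i, hi⟩)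
    · obtain ⟨l, rfl⟩ := ZMod.intCast_surjective i
      exact ⟨2 * l, by rw [D.geodArc_vx_even]; exact hi⟩
    · obtain ⟨l, rfl⟩ := ZMod.intCast_surjective i
      exact ⟨2 * l + 1, by rw [D.geodArc_vx_odd]; exact hi⟩
  · rintro ⟨n, hn⟩
    rcases Int.even_or_odd' n with ⟨l, rfl | rfl⟩
    · rw [D.geodArc_vx_even] at hn; exact Or.inl ⟨_, hn⟩
    · rw [D.geodArc_vx_odd] at hn; exact Or.inr ⟨_, hn⟩

/-- The vertices in the Klein model. -/
def V (n : ℤ) : E2 := toKlein (D.vx n)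

theorem klein_boundary : frontier (kl D.Ω) ∩ Disk =
    (⋃ n, segment ℝ (D.V n) (D.V (n + 1))) ∩ Disk := by
  rw [frontier_kl, ← kl_inter_disk, D.boundary, D.iUnion_edges, kl_iUnion, iUnion_inter]
  exact iUnion_congr fun n => kl_geodArc _ _

theorem V_even (l : ℤ) : D.V (2 * l) = D.pI (l : ZMod k) := by
  rw [V, vx_even, toKlein_of_norm_eq_one (D.ideal _)]

theorem V_odd (l : ℤ) : D.V (2 * l + 1) = toKlein (D.pB (l : ZMod k)) := by rw [V, vx_odd]

theorem V_eq_iff (m n : ℤ) : D.V m = D.V n ↔ D.vx m = D.vx n :=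
  ⟨fun h => toKlein_injOn (D.norm_vx_le m) (D.norm_vx_le n) h, fun h => by rw [V, h, V]⟩

theorem vx_per (n : ℤ) : D.vx (n + 2 * k) = D.vx n := by
  rcases Int.even_or_odd' n with ⟨l, rfl | rfl⟩
  · rw [show 2 * l + 2 * (k : ℤ) = 2 * (l + k) by ring, vx_even, vx_even]; simp
  · rw [show 2 * l + 1 + 2 * (k : ℤ) = 2 * (l + k) + 1 by ring, vx_odd, vx_odd]; simp

theorem vx_inj (m n : ℤ) (h : D.vx m = D.vx n) : (2 * k : ℤ) ∣ n - m := by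
  have key : ∀ i j, D.pI i ≠ D.pB j := fun i j e => by
    have := D.inter j
    rw [← e, mem_disk, D.ideal] at this
    exact lt_irrefl _ this
  rcases Int.even_or_odd' m with ⟨l, rfl | rfl⟩ <;>
    rcases Int.even_or_odd' n with ⟨l', rfl | rfl⟩
  · rw [vx_even, vx_even] at h
    rw [← mul_sub]
    exact mul_dvd_mul_left 2 ((ZMod.intCast_eq_intCast_iff_dvd_sub _ _ _).1 (D.injI h))
  · rw [vx_even, vx_odd] at h; exact absurd h (key _ _)
  · rw [vx_even, vx_odd] at h; exact absurd h.symm (key _ _)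
  · rw [vx_odd, vx_odd] at h
    rw [add_sub_add_right_eq_sub, ← mul_sub]
    exact mul_dvd_mul_left 2 ((ZMod.intCast_eq_intCast_iff_dvd_sub _ _ _).1 (D.injB h))

theorem kl_nonempty : (kl D.Ω).Nonempty := by
  rw [kl_eq_image D.subset]; exact D.conn.nonempty.image _

theorem segment_inter_disk_subset {K : Set E2} {x y : E2} (hx : ‖x‖ ≤ 1) (hy : ‖y‖ ≤ 1)
    (hxy : x ≠ y) (h : segment ℝ x y ∩ Disk ⊆ frontier K) : segment ℝ x y ⊆ frontier K :=
  segment_subset_closure_openSegment.trans (closure_minimal (fun _ hz =>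
    h ⟨openSegment_subset_segment ℝ _ _ hz, openSegment_subset_disk hx hy hxy hz⟩) isClosed_frontier)

/-- There is no convex semi-ideal polygon with two vertices. -/
theorem two_le (hconv : HypConvex D.Ω) : 2 ≤ k := by
  by_contra hk
  obtain rfl : k = 1 := by have := D.k_pos; omega
  set K := kl D.Ω with hK
  set a := D.pI 0 with ha
  set b := toKlein (D.pB 0) with hb
  have hKo : IsOpen K := isOpen_kl D.isOpen
  have hKc : Convex ℝ K := convex_kl hconv
  have han : ‖a‖ = 1 := D.ideal 0
  have hbD : b ∈ Disk := toKlein_mem_disk (D.inter 0)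
  have hab : a ≠ b := fun e => by
    rw [← e, mem_disk, han] at hbD; exact lt_irrefl _ hbD
  have hfr : frontier K ∩ Disk = segment ℝ a b ∩ Disk := by
    rw [hK, frontier_kl, ← kl_inter_disk, D.boundary, kl_union, kl_iUnion, kl_iUnion]
    simp only [kl_geodArc]
    ext x
    simp only [mem_union, mem_iUnion]
    constructor
    · rintro (⟨i, hi⟩ | ⟨i, hi⟩)
      · obtain rfl := Subsingleton.elim i 0
        rwa [toKlein_of_norm_eq_one han] at hi
      · obtain rfl := Subsingleton.elim i 0
        rw [Subsingleton.elim (0 + 1 : ZMod 1) 0, toKlein_of_norm_eq_one han, segment_symm] at hi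
        exact hi
    · intro hx
      refine Or.inl ⟨0, ?_⟩
      rwa [toKlein_of_norm_eq_one han]
  have hsub : segment ℝ a b ⊆ frontier K :=
    segment_inter_disk_subset han.le (mem_disk.1 hbD).le hab (hfr ▸ inter_subset_left)
  have hcl : ∀ x ∈ segment ℝ a b, x ∈ closure K := fun x hx => frontier_subset_closure (hsub hx)
  have hnK : ∀ x ∈ segment ℝ a b, x ∉ K := fun x hx hxK => by
    have := hsub hx
    rw [hKo.frontier_eq] at this
    exact this.2 hxK
  obtain ⟨σ, -, hσ⟩ := exists_sign hKo hKc hab (hcl _ (left_mem_segment ℝ _ _))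
    (hcl _ (right_mem_segment ℝ _ _)) (midpoint_mem_openSegment _ _)
    (hnK _ (midpoint_mem_segment _ _))
  obtain ⟨w, hw⟩ := D.kl_nonempty
  obtain ⟨τ, hτ, hτD⟩ : ∃ τ : ℝ, 1 < τ ∧ (AffineMap.lineMap a b τ : E2) ∈ Disk := by
    have hc : Continuous fun τ : ℝ => (AffineMap.lineMap a b τ : E2) := AffineMap.lineMap_continuous
    have ho := (isOpen_disk.preimage hc).mem_nhds (show (1:ℝ) ∈ _ by simpa using hbD)
    obtain ⟨δ, hδ, hball⟩ := Metric.mem_nhds_iff.1 ho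
    refine ⟨1 + δ / 2, by linarith, hball ?_⟩
    rw [Metric.mem_ball, Real.dist_eq, add_sub_cancel_left, abs_of_pos (by linarith)]
    linarith
  set y : E2 := AffineMap.lineMap a b τ with hy
  have hyns : y ∉ segment ℝ a b := by
    rw [segment_eq_image_lineMap]
    rintro ⟨θ, hθ, e⟩
    have := lineMap_inj hab e
    linarith [hθ.2]
  by_cases hyK : y ∈ K
  · have := mem_openSegment_lineMap a b one_pos hτ
    rw [AffineMap.lineMap_apply_zero, AffineMap.lineMap_apply_one] at this
    exact hnK b (right_mem_segment ℝ _ _) (openSegment_subset_of_mem' hKo hKc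
      (hcl a (left_mem_segment ℝ _ _)) hyK this)
  · have hpre : IsPreconnected (segment ℝ w y) := (convex_segment w y).isPreconnected
    have hmeet : (segment ℝ w y ∩ frontier K).Nonempty := by
      by_contra hem
      rw [not_nonempty_iff_eq_empty] at hem
      have hcov : segment ℝ w y ⊆ K ∪ (closure K)ᶜ := by
        intro z hz
        by_contra hcon
        rw [mem_union, not_or, mem_compl_iff, not_not] at hcon
        have : z ∈ segment ℝ w y ∩ frontier K :=
          ⟨hz, by rw [hKo.frontier_eq]; exact ⟨hcon.2, hcon.1⟩⟩
        rw [hem] at this; exact this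
      have := hpre.subset_left_of_subset_union hKo isClosed_closure.isOpen_compl
        (disjoint_compl_right.mono_left subset_closure) hcov ⟨w, left_mem_segment ℝ _ _, hw⟩
      exact hyK (this (right_mem_segment ℝ _ _))
    obtain ⟨z, hz, hzf⟩ := hmeet
    have hzD : z ∈ Disk := by
      have : Convex ℝ (Metric.ball (0 : E2) 1) := convex_ball _ _
      have hb : ∀ {w : E2}, w ∈ Disk ↔ w ∈ Metric.ball (0 : E2) 1 := by simp [mem_disk]
      exact hb.2 (this.segment_subset (hb.1 (kl_subset _ hw)) (hb.1 hτD) hz)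
    have hzs : z ∈ segment ℝ a b := by
      have : z ∈ frontier K ∩ Disk := ⟨hzf, hzD⟩
      rw [hfr] at this; exact this.1
    have hz0 : σ * cr (b - a) (z - a) = 0 := by
      rw [segment_eq_image_lineMap] at hzs
      obtain ⟨θ, -, rfl⟩ := hzs
      rw [cr_lineMap_self, mul_zero]
    rw [segment_eq_image_lineMap] at hz
    obtain ⟨θ, hθ, rfl⟩ := hz
    rw [cr_lineMap, hy, cr_lineMap_self, mul_zero, add_zero, mul_left_comm] at hz0
    rcases mul_eq_zero.1 hz0 with h1 | h1
    · obtain rfl : θ = 1 := by linarith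
      rw [AffineMap.lineMap_apply_one] at hzs
      exact hyns hzs
    · exact (hσ w hw).ne' h1

/-- Points at the same height on the same geodesic to an ideal point coincide. -/
theorem eq_of_ht_eq_of_cr (H : Horocycle) {u v : E2} (hu : u ∈ Disk) (hv : v ∈ Disk)
    (he : H.ht u = H.ht v) (hc : cr (toKlein u - H.pt) (toKlein v - H.pt) = 0) : u = v := by
  obtain ⟨n, hn, hne, t₀, ht₀, -, hht⟩ := exists_ray H hu
  have e1 := toKlein_geo' hn H.hpt t₀
  rw [ht₀] at e1
  have hline : cr (H.pt - n) (toKlein v - n) = 0 := by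
    have hs : 0 < 1 - sig t₀ := by linarith [sig_lt_one t₀]
    have e2 : cr (toKlein u - H.pt) (toKlein v - H.pt) =
        -(1 - sig t₀) * cr (H.pt - n) (toKlein v - n) := by
      rw [e1]
      simp only [AffineMap.lineMap_apply_module, cr, PiLp.sub_apply, PiLp.add_apply,
        PiLp.smul_apply, smul_eq_mul]; ring
    rw [hc] at e2
    nlinarith [mul_eq_zero.1 e2.symm]
  obtain ⟨τ, e3⟩ := exists_lineMap_of_cr hne hline
  have hτ := lineMap_param_mem hn H.hpt (e3 ▸ toKlein_mem_disk hv)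
  obtain ⟨t, rfl⟩ := exists_sig_eq hτ.1 hτ.2
  have e4 := (toKlein_lineMap_iff hn H.hpt hne hv t).1 e3
  have e5 := hht t
  rw [e4, ← he] at e5
  have : t = t₀ := by linarith
  rw [← ht₀, ← e4, this]

theorem kPoly (hconv : HypConvex D.Ω) (Dh : ZMod k → Horocycle)
    (hDh : ∀ i, (Dh i).pt = D.pI i ∧ D.pB (i - 1) ∈ (Dh i).circle ∧ D.pB i ∈ (Dh i).circle) :
    KPoly (2 * k) (kl D.Ω) D.V where
  four_le := by have := D.two_le hconv; omega
  isOpen := isOpen_kl D.isOpen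
  convex := convex_kl hconv
  nonempty := D.kl_nonempty
  subset := kl_subset _
  per n := by rw [V, vx_per, V]
  inj m n h := D.vx_inj m n ((D.V_eq_iff m n).1 h)
  even n hn := by
    obtain ⟨l, rfl⟩ := hn.two_dvd
    rw [V_even]; exact D.ideal _
  odd n hn := by
    obtain ⟨l, rfl⟩ := hn
    rw [V_odd]; exact toKlein_mem_disk (D.inter _)
  bdry := D.klein_boundary
  ncol n hn := by
    obtain ⟨l, rfl⟩ := hn.two_dvd
    rw [V_odd, V_even, show (2 * l - 1 : ℤ) = 2 * (l - 1) + 1 by ring, V_odd]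
    intro hc
    push_cast at hc
    obtain ⟨h1, h2, h3⟩ := hDh l
    have hk := D.two_le hconv
    have e := eq_of_ht_eq_of_cr (Dh l) (D.inter l) (D.inter (l - 1))
      (((ht_eq _ (D.inter l)).2 h3).trans ((ht_eq _ (D.inter (l - 1))).2 h2).symm)
      (by rw [h1]; exact hc)
    have e' := D.injB e
    have : Fact (1 < k) := ⟨by omega⟩
    have h10 : (1 : ZMod k) = 0 := by linear_combination e'
    exact one_ne_zero h10
where
  ht_eq (H : Horocycle) {p : E2} (hp : p ∈ Disk) := H.ht_eq_zero_iff hp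

/-! ### Reversal of the cyclic order -/

theorem neg_sub_one_involutive : Function.Involutive fun i : ZMod k => -i - 1 :=
  fun i => by simp

/-- The same domain with the reversed cyclic order: the edges `A` and `B` are exchanged. -/
def rev : SemiIdealDomain k where
  Ω := D.Ω
  pI i := D.pI (-i)
  pB i := D.pB (-i - 1)
  k_pos := D.k_pos
  isOpen := D.isOpen
  conn := D.conn
  subset := D.subset
  ideal i := D.ideal _
  inter i := D.inter _
  injI i j h := neg_injective (D.injI h)
  injB i j h := neg_injective (sub_left_injective (D.injB h))
  boundary := by
    rw [D.boundary, union_comm]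
    congr 1
    · exact (neg_sub_one_involutive.surjective.iUnion_comp fun i =>
        geodArc (D.pB i) (D.pI (i + 1))).symm.trans
          (iUnion_congr fun i => by rw [geodArc_comm, sub_add_cancel])
    · exact (neg_sub_one_involutive.surjective.iUnion_comp fun i =>
        geodArc (D.pI i) (D.pB i)).symm.trans
          (iUnion_congr fun i => by rw [geodArc_comm, ← neg_add'])

theorem rev_edgeA (i : ZMod k) : D.rev.edgeA i = D.edgeB (-i - 1) := by
  simp only [edgeA, edgeB, rev, sub_add_cancel]
  rw [geodArc_comm]

end SemiIdealDomain

theorem gammaSet_neg {k : ℕ} (Q : PolygonalDomain) (H : ZMod k → Horocycle) :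
    GammaSet Q (fun i => H (-i)) = GammaSet Q H := by
  rw [GammaSet, GammaSet, (neg_involutive.surjective.iUnion_comp fun i => (H i).horodisk :
    ⋃ i, (H (-i)).horodisk = _)]

theorem alphaVal_rev {k : ℕ} (D : SemiIdealDomain k) (H : ZMod k → Horocycle)
    (Q : PolygonalDomain) : alphaVal D.rev (fun i => H (-i)) Q = betaVal D H Q := by
  have : NeZero k := ⟨D.k_pos.ne'⟩
  rw [alphaVal, betaVal, gammaSet_neg]
  simp only [D.rev_edgeA]
  exact Equiv.sum_comp (SemiIdealDomain.neg_sub_one_involutive (k := k)).toPerm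
    fun i => hLen (D.edgeB i ∩ GammaSet Q H)

theorem gammaLen_rev {k : ℕ} (H : ZMod k → Horocycle) (Q : PolygonalDomain) :
    gammaLen Q (fun i => H (-i)) = gammaLen Q H := by
  rw [gammaLen, gammaLen, gammaSet_neg]

theorem inscribedIn_rev {k : ℕ} (D : SemiIdealDomain k) (Q : PolygonalDomain) :
    InscribedIn Q D.rev ↔ InscribedIn Q D := by
  have h1 : range D.rev.pI = range D.pI := neg_involutive.surjective.range_comp D.pI
  have h2 : range D.rev.pB = range D.pB :=
    SemiIdealDomain.neg_sub_one_involutive.surjective.range_comp D.pB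
  rw [InscribedIn, InscribedIn, h1, h2]
  rfl

/-! ### Flux through the chords of an admissible domain -/

/-- The inequalities (ii) in the definition of admissibility. -/
def FluxIneq {k : ℕ} (D : SemiIdealDomain k) (H : ZMod k → Horocycle) : Prop :=
  ∀ Q : PolygonalDomain, InscribedIn Q D → Q.P ≠ D.Ω →
    2 * alphaVal D H Q < gammaLen Q H ∧ 2 * betaVal D H Q < gammaLen Q H

theorem measurableSet_gammaSet {k : ℕ} (Q : PolygonalDomain) (H : ZMod k → Horocycle) :
    MeasurableSet (GammaSet Q H) :=
  (isClosed_frontier.measurableSet.inter isOpen_disk.measurableSet).diff (measurableSet_horodisks H)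

theorem gammaSet_subset_disk {k : ℕ} (Q : PolygonalDomain) (H : ZMod k → Horocycle) :
    GammaSet Q H ⊆ Disk := fun _ hx => hx.1.2

theorem gammaLen_eq {k : ℕ} (Q : PolygonalDomain) (H : ZMod k → Horocycle) :
    gammaLen Q H = (hypMeas (GammaSet Q H)).toReal :=
  hLen_eq (measurableSet_gammaSet Q H) (gammaSet_subset_disk Q H)

theorem hLen_geodArc_inter {k : ℕ} (Q : PolygonalDomain) (H : ZMod k → Horocycle) (u v : E2) :
    hLen (geodArc u v ∩ GammaSet Q H) = (hypMeas (geodArc u v ∩ GammaSet Q H)).toReal :=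
  hLen_eq ((measurableSet_geodArc u v).inter (measurableSet_gammaSet Q H))
    (inter_subset_left.trans (geodArc_subset_disk u v))

theorem hLen_geodArc_of_subset {k : ℕ} {Q : PolygonalDomain} (H : ZMod k → Horocycle) {u v : E2}
    (h : geodArc u v ⊆ frontier Q.P ∩ Disk) :
    hLen (geodArc u v ∩ GammaSet Q H) = (trunc H u v).toReal := by
  rw [hLen_geodArc_inter, GammaSet, ← inter_sdiff_assoc, inter_eq_left.2 h, trunc]

namespace SemiIdealDomain
variable {k : ℕ} (D : SemiIdealDomain k) (H : ZMod k → Horocycle)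

theorem trunc_vx_lt_top (hpt : ∀ i, (H i).pt = D.pI i) {a b : ℤ} (hab : D.vx a ≠ D.vx b) :
    trunc H (D.vx a) (D.vx b) < ⊤ := by
  have : NeZero k := ⟨D.k_pos.ne'⟩
  rcases Int.even_or_odd' a with ⟨l, rfl | rfl⟩ <;>
    rcases Int.even_or_odd' b with ⟨m, rfl | rfl⟩
  · rw [vx_even, vx_even] at hab ⊢
    rw [← hpt, ← hpt] at hab ⊢
    exact (trunc_ideal_ideal_le H hab).trans_lt ENNReal.ofReal_lt_top
  · rw [vx_even, vx_odd, ← hpt]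
    exact (trunc_ideal_inter_le H _ l (D.inter m)).trans_lt ENNReal.ofReal_lt_top
  · rw [vx_even, vx_odd, trunc_comm, ← hpt]
    exact (trunc_ideal_inter_le H _ l (D.inter l)).trans_lt ENNReal.ofReal_lt_top
  · rw [vx_odd, vx_odd]
    exact trunc_inter_inter_lt_top H (D.inter l) (D.inter m)

/-- The truncated length of the `n`-th edge. -/
def len (n : ℤ) : ℝ := (trunc H (D.vx n) (D.vx (n + 1))).toReal

theorem len_nonneg (n : ℤ) : 0 ≤ D.len H n := ENNReal.toReal_nonneg

/-- A primitive of the signed truncated lengths of the edges. -/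
def Flow (f : ℤ → ℝ) : Prop :=
  ∀ n, f (n + 1) = f n + if Even n then D.len H n else -D.len H n

theorem exists_primitive (s : ℤ → ℝ) : ∃ f : ℤ → ℝ, ∀ n, f (n + 1) = f n + s n := by
  refine ⟨fun n => ∑ i ∈ Finset.range n.toNat, s i - ∑ i ∈ Finset.range (-n).toNat, s (-i - 1),
    fun n => ?_⟩
  rcases n with n | n
  · have e1 : ((n : ℤ) + 1).toNat = n + 1 := by omega
    have e2 : (-((n : ℤ) + 1)).toNat = 0 := by omega
    have e3 : (n : ℤ).toNat = n := by omega
    have e4 : (-(n : ℤ)).toNat = 0 := by omega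
    simp only [Int.ofNat_eq_natCast, e1, e2, e3, e4, Finset.sum_range_succ]
    simp
  · have e1 : (Int.negSucc n + 1).toNat = 0 := by omega
    have e2 : (-(Int.negSucc n + 1)).toNat = n := by omega
    have e3 : (Int.negSucc n).toNat = 0 := by omega
    have e4 : (-(Int.negSucc n)).toNat = n + 1 := by omega
    have e5 : Int.negSucc n = -(n : ℤ) - 1 := by omega
    simp only [e1, e2, e3, e4, Finset.sum_range_succ]
    rw [e5]; simp

theorem exists_flow : ∃ f, D.Flow H f :=
  exists_primitive fun n => if Even n then D.len H n else -D.len H n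

section cut
variable {D H} (hP : KPoly (2 * k) (kl D.Ω) D.V) {ε : ℝ} (hε : KPoly.Oriented (kl D.Ω) D.V ε)
  {a : ℤ} {M : ℕ} (h0 : 0 < M) (hM : M < 2 * k)
  (hch : openSegment ℝ (D.V a) (D.V (a + M)) ⊆ kl D.Ω)
include hP hε h0 hM hch

theorem frontier_pull_cut : frontier (pull (KPoly.cut (kl D.Ω) D.V ε a (a + M))) ∩ Disk =
    geodArc (D.vx a) (D.vx (a + M)) ∪
      ⋃ m ∈ Finset.range M, geodArc (D.vx (a + m)) (D.vx (a + m + 1)) := by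
  have hsub : ∀ P, pull P = pull (P ∩ Disk) := fun P => by
    ext p; exact ⟨fun h => ⟨h.1, h.2, toKlein_mem_disk h.1⟩, fun h => ⟨h.1, h.2.1⟩⟩
  rw [frontier_pull, hsub, hP.frontier_cut hε (by omega) (by omega) hch, ← hsub]
  simp only [geodArc_eq_pull]
  ext p
  simp only [mem_pull, mem_union, mem_iUnion, exists_prop, mem_Ico, Finset.mem_range, V]
  constructor
  · rintro ⟨h1, h2 | ⟨n, hn, h2⟩⟩
    · exact Or.inl ⟨h1, h2⟩
    · refine Or.inr ⟨(n - a).toNat, by omega, h1, ?_⟩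
      rwa [show a + ((n - a).toNat : ℤ) = n by omega]
  · rintro (⟨h1, h2⟩ | ⟨m, hm, h1, h2⟩)
    · exact ⟨h1, Or.inl h2⟩
    · exact ⟨h1, Or.inr ⟨a + m, by omega, h2⟩⟩

/-- The polygonal domain cut off by a chord. -/
def cutDomain : PolygonalDomain where
  P := pull (KPoly.cut (kl D.Ω) D.V ε a (a + M))
  m := M + 1
  q j := D.vx (a + j.val)
  m_pos := M.succ_pos
  isOpen := isOpen_pull (hP.isOpen_cut ε a _)
  conn := by
    rw [pull_eq_image (fun x hx => hP.subset hx.1)]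
    exact ((hP.convex_cut ε a _).isConnected
      (hP.cut_nonempty hε (by omega) (by omega) hch)).image _ continuous_fromKlein.continuousOn
  subset := pull_subset _
  vtx j := D.norm_vx_le _
  boundary := by
    rw [frontier_pull_cut hP hε h0 hM hch]
    ext p
    simp only [mem_union, mem_iUnion, exists_prop, Finset.mem_range]
    constructor
    · rintro (h | ⟨m, hm, h⟩)
      · refine ⟨(M : ZMod (M + 1)), ?_⟩
        rw [show (M : ZMod (M + 1)) + 1 = 0 by exact_mod_cast ZMod.natCast_self (M + 1),
          ZMod.val_natCast_of_lt (by omega), ZMod.val_zero, geodArc_comm]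
        simpa using h
      · refine ⟨(m : ZMod (M + 1)), ?_⟩
        rw [show (m : ZMod (M + 1)) + 1 = ((m + 1 : ℕ) : ZMod (M + 1)) by push_cast; rfl,
          ZMod.val_natCast_of_lt (by omega), ZMod.val_natCast_of_lt (by omega)]
        push_cast
        rwa [← add_assoc]
    · rintro ⟨j, hj⟩
      have hj1 := ZMod.val_lt j
      have hj2 : j = (j.val : ZMod (M + 1)) := (ZMod.natCast_zmod_val j).symm
      set m := j.val with hm
      clear_value m
      subst hj2
      rcases (Nat.lt_succ_iff.1 hj1).eq_or_lt with rfl | h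
      · left
        rw [show (m : ZMod (m + 1)) + 1 = 0 by exact_mod_cast ZMod.natCast_self (m + 1),
          ZMod.val_zero, geodArc_comm] at hj
        simpa using hj
      · right
        refine ⟨m, h, ?_⟩
        rw [show (m : ZMod (M + 1)) + 1 = ((m + 1 : ℕ) : ZMod (M + 1)) by push_cast; rfl,
          ZMod.val_natCast_of_lt (by omega)] at hj
        push_cast at hj
        rwa [← add_assoc] at hj

theorem inscribedIn_cutDomain : InscribedIn (cutDomain hP hε h0 hM hch) D := by
  refine ⟨fun p hp => ?_, fun j => D.vx_mem _⟩
  rw [← pull_kl D.subset]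
  exact ⟨hp.1, hp.2.1⟩

theorem cutDomain_ne : (cutDomain hP hε h0 hM hch).P ≠ D.Ω := fun he => by
  apply KPoly.cut_ne (ε := ε) hch
  rw [← kl_pull (P := KPoly.cut (kl D.Ω) D.V ε a (a + M)) (fun x hx => hP.subset hx.1)]
  exact congrArg kl he

omit hε h0 hch in
theorem sum_edges_le (g : ZMod k → ℝ) (hg : ∀ i, 0 ≤ g i) (S : Finset ℕ) (hS : S ⊆ Finset.range M)
    (hpar : ∀ m ∈ S, ∀ n ∈ S, (Even (a + m : ℤ) ↔ Even (a + n : ℤ))) :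
    ∑ m ∈ S, g (((a + m) / 2 : ℤ) : ZMod k) ≤
      letI : NeZero k := ⟨D.k_pos.ne'⟩; ∑ i, g i := by
  have : NeZero k := ⟨D.k_pos.ne'⟩
  have hinj : Set.InjOn (fun m : ℕ => (((a + m) / 2 : ℤ) : ZMod k)) S := by
    intro m hm n hn hmn
    have hv : D.V (a + m) = D.V (a + n) := by
      rw [V_eq_iff, vx, vx]
      have hp := hpar m hm n hn
      have hmn' : (((a + m) / 2 : ℤ) : ZMod k) = (((a + n) / 2 : ℤ) : ZMod k) := hmn
      rw [hmn']
      simp only [hp]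
    have hd := hP.inj _ _ hv
    have h1 := Finset.mem_range.1 (hS hm)
    have h2 := Finset.mem_range.1 (hS hn)
    have := Int.eq_zero_of_abs_lt_dvd hd (by rw [abs_lt]; constructor <;> omega)
    omega
  rw [← Finset.sum_image (f := g) hinj]
  exact Finset.sum_le_sum_of_subset_of_nonneg (Finset.subset_univ _) fun i _ _ => hg i

theorem abs_flow_lt_trunc (hpt : ∀ i, (H i).pt = D.pI i) (hΦ : FluxIneq D H) {f : ℤ → ℝ}
    (hf : D.Flow H f) :
    |f (a + M) - f a| < (trunc H (D.vx a) (D.vx (a + M))).toReal := by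
  have hkp := D.k_pos
  have : NeZero k := ⟨hkp.ne'⟩
  set Q := cutDomain hP hε h0 hM hch with hQ
  have hfr : frontier Q.P ∩ Disk = _ := frontier_pull_cut hP hε h0 hM hch
  have hlt := hΦ Q (inscribedIn_cutDomain hP hε h0 hM hch) (cutDomain_ne hP hε h0 hM hch)
  have hne : D.vx a ≠ D.vx (a + M) := fun e =>
    hP.ne_of_lt (m := a) (n := a + M) (by omega) (by omega) ((D.V_eq_iff _ _).2 e)
  have hlen : gammaLen Q H ≤ (trunc H (D.vx a) (D.vx (a + M))).toReal +
      ∑ m ∈ Finset.range M, D.len H (a + m) := by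
    have hne' : ∀ n, D.vx n ≠ D.vx (n + 1) := fun n e => hP.ne_succ n ((D.V_eq_iff _ _).2 e)
    have hle : hypMeas (GammaSet Q H) ≤ trunc H (D.vx a) (D.vx (a + M)) +
        ∑ m ∈ Finset.range M, trunc H (D.vx (a + m)) (D.vx (a + m + 1)) := by
      rw [GammaSet, hfr, union_sdiff_distrib]
      refine (measure_union_le _ _).trans (add_le_add le_rfl ?_)
      simp only [iUnion_sdiff]
      exact measure_biUnion_finset_le _ _
    have hfin : ∀ m ∈ Finset.range M, trunc H (D.vx (a + m)) (D.vx (a + m + 1)) ≠ ⊤ :=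
      fun m _ => (D.trunc_vx_lt_top H hpt (hne' _)).ne
    rw [gammaLen_eq]
    have htop := (D.trunc_vx_lt_top H hpt hne).ne
    refine (ENNReal.toReal_mono (ENNReal.add_ne_top.2
      ⟨htop, ENNReal.sum_ne_top.2 hfin⟩) hle).trans ?_
    rw [ENNReal.toReal_add htop (ENNReal.sum_ne_top.2 hfin), ENNReal.toReal_sum hfin]
    rfl
  have hedge : ∀ m ∈ Finset.range M,
      geodArc (D.vx (a + m)) (D.vx (a + m + 1)) ⊆ frontier Q.P ∩ Disk := fun m hm => by
    rw [hfr]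
    exact subset_union_of_subset_right (subset_biUnion_of_mem
      (u := fun m : ℕ => geodArc (D.vx (a + m)) (D.vx (a + m + 1))) hm) _
  have hα : ∑ m ∈ (Finset.range M).filter (fun m : ℕ => Even (a + m : ℤ)), D.len H (a + m) ≤
      alphaVal D H Q := by
    refine le_trans (Finset.sum_le_sum fun m hm => ?_) (sum_edges_le hP hM
      (fun i => hLen (D.edgeA i ∩ GammaSet Q H)) (fun i => by
        rw [edgeA, hLen_geodArc_inter]; exact ENNReal.toReal_nonneg) _ (Finset.filter_subset _ _)
      (fun m hm n hn => iff_of_true (Finset.mem_filter.1 hm).2 (Finset.mem_filter.1 hn).2))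
    obtain ⟨hm1, hm2⟩ := Finset.mem_filter.1 hm
    have he := hedge m hm1
    obtain ⟨l, hl⟩ := hm2.two_dvd
    rw [len]
    rw [hl] at he ⊢
    rw [Int.mul_ediv_cancel_left _ two_ne_zero, ← D.geodArc_vx_even, hLen_geodArc_of_subset H he]
  have hβ : ∑ m ∈ (Finset.range M).filter (fun m : ℕ => ¬ Even (a + m : ℤ)), D.len H (a + m) ≤
      betaVal D H Q := by
    refine le_trans (Finset.sum_le_sum fun m hm => ?_) (sum_edges_le hP hM
      (fun i => hLen (D.edgeB i ∩ GammaSet Q H)) (fun i => by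
        rw [edgeB, hLen_geodArc_inter]; exact ENNReal.toReal_nonneg) _ (Finset.filter_subset _ _)
      (fun m hm n hn => iff_of_false (Finset.mem_filter.1 hm).2 (Finset.mem_filter.1 hn).2))
    obtain ⟨hm1, hm2⟩ := Finset.mem_filter.1 hm
    have he := hedge m hm1
    obtain ⟨l, hl⟩ := Int.not_even_iff_odd.1 hm2
    rw [len]
    rw [hl] at he ⊢
    rw [show (2 * l + 1) / 2 = l by omega, ← D.geodArc_vx_odd, hLen_geodArc_of_subset H he]
  have hsplit := Finset.sum_filter_add_sum_filter_not (Finset.range M)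
    (fun m : ℕ => Even (a + m : ℤ)) (fun m => D.len H (a + m))
  have hdiff : ∀ M : ℕ, f (a + M) - f a =
      ∑ m ∈ (Finset.range M).filter (fun m : ℕ => Even (a + m : ℤ)), D.len H (a + m) -
      ∑ m ∈ (Finset.range M).filter (fun m : ℕ => ¬ Even (a + m : ℤ)), D.len H (a + m) := by
    intro M
    induction M with
    | zero => simp
    | succ M ih =>
      push_cast
      rw [← add_assoc, hf, Finset.range_add_one, Finset.filter_insert, Finset.filter_insert]
      by_cases hp : Even (a + M : ℤ)
      · rw [if_pos hp, if_pos hp, if_neg (not_not.2 hp), Finset.sum_insert (by simp)]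
        linarith
      · rw [if_neg hp, if_neg hp, if_pos hp, Finset.sum_insert (by simp)]
        linarith
  have hd := hdiff M
  rw [abs_lt]
  constructor <;> linarith [hlt.1, hlt.2]

end cut

end SemiIdealDomain

/-! ### The heights determine the truncated lengths of the edges -/

/-- A continuity argument: if the maximum of `-(u - t)⁺` and of the functions `c m - (g m u)⁺` only
takes finitely many values off the set of good parameters, then its total variation is bounded by
the measure of that set. -/
theorem chain_bound {ι : Type*} [Fintype ι] (c : ι → ℝ) (g : ι → ℝ → ℝ)
    (hg : ∀ m u v, |g m u - g m v| ≤ |u - v|) {t L A : ℝ} (ht : 0 ≤ t) (hL : 0 ≤ L) (hA : 0 ≤ A)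
    (h1 : ∀ m, ∀ u ∈ Icc 0 L, g m u ≤ 0 → -max (u - t) 0 ≤ c m)
    (h2 : ∀ m n, ∀ u ∈ Icc 0 L, g m u ≤ 0 → c n - max (g n u) 0 ≤ c m)
    (h3 : ∀ m, ∀ u ∈ Icc 0 L, u < t → c m - max (g m u) 0 ≤ 0)
    (hvol : volume {u ∈ Icc 0 L | t ≤ u ∧ ∀ m, 0 ≤ g m u} ≤ ENNReal.ofReal A) :
    L - t ≤ A ∨ ∃ m, -A ≤ c m - max (g m L) 0 := by
  classical
  set ψ : Option ι → ℝ → ℝ := fun o u => o.elim (-max (u - t) 0) fun m => c m - max (g m u) 0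
  set φ : ℝ → ℝ := fun u => Finset.univ.sup' ⟨none, Finset.mem_univ _⟩ fun o => ψ o u
  have hle : ∀ o u, ψ o u ≤ φ u := fun o u => Finset.le_sup' (fun o => ψ o u) (Finset.mem_univ o)
  have hmax : ∀ x y : ℝ, max x 0 ≤ max y 0 + |x - y| := fun x y =>
    max_le (by linarith [le_max_left y 0, le_abs_self (x - y)])
      (add_nonneg (le_max_right _ _) (abs_nonneg _))
  have hψ : ∀ o u v, ψ o u ≤ ψ o v + |u - v| := by
    rintro (_ | m) u v
    · have := hmax (v - t) (u - t)
      rw [sub_sub_sub_cancel_right, abs_sub_comm] at this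
      show -max (u - t) 0 ≤ -max (v - t) 0 + |u - v|
      linarith
    · have := hmax (g m v) (g m u)
      have h := hg m v u
      rw [abs_sub_comm v u] at h
      show c m - max (g m u) 0 ≤ c m - max (g m v) 0 + |u - v|
      linarith
  have hφ : ∀ u v, φ u ≤ φ v + |u - v| := fun u v =>
    Finset.sup'_le _ _ fun o _ => (hψ o u v).trans (by linarith [hle o v])
  have hlip : LipschitzWith 1 φ := LipschitzWith.of_dist_le_mul fun u v => by
    rw [Real.dist_eq, Real.dist_eq, NNReal.coe_one, one_mul, abs_le]
    have := hφ v u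
    rw [abs_sub_comm] at this
    exact ⟨by linarith, by linarith [hφ u v]⟩
  have h0 : 0 ≤ φ 0 := (show (0:ℝ) ≤ ψ none 0 by
    show 0 ≤ -max (0 - t) 0
    rw [max_eq_right (by linarith)]; simp).trans (hle _ _)
  by_contra! hcon
  obtain ⟨hc1, hc2⟩ := hcon
  have hφL : φ L < -A := by
    refine (Finset.sup'_lt_iff _).2 ?_
    rintro (_ | m) -
    · show -max (L - t) 0 < -A
      linarith [le_max_left (L - t) 0]
    · exact hc2 m
  set G := {u ∈ Icc 0 L | t ≤ u ∧ ∀ m, 0 ≤ g m u}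
  have hcov : Icc (φ L) 0 ⊆ φ '' G ∪ insert 0 (range c) := by
    intro y hy
    obtain ⟨u, hu, rfl⟩ := intermediate_value_Icc' hL hlip.continuous.continuousOn
      ⟨hy.1, hy.2.trans h0⟩
    by_cases hG : u ∈ G
    · exact Or.inl (mem_image_of_mem _ hG)
    right
    by_cases hut : u < t
    · refine Or.inl (le_antisymm (Finset.sup'_le _ _ ?_) ((show (0:ℝ) ≤ ψ none u by
        show 0 ≤ -max (u - t) 0
        rw [max_eq_right (by linarith)]; simp).trans (hle _ _)))
      rintro (_ | m) -
      · show -max (u - t) 0 ≤ 0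
        linarith [le_max_right (u - t) 0]
      · exact h3 m u hu hut
    · have : ∃ m, g m u < 0 := by
        by_contra! h
        exact hG ⟨hu, not_lt.1 hut, h⟩
      obtain ⟨m, hm⟩ := this
      refine Or.inr ⟨m, le_antisymm ?_ (Finset.sup'_le _ _ ?_)⟩
      · refine le_trans (le_of_eq ?_) (hle (some m) u)
        show c m = c m - max (g m u) 0
        rw [max_eq_right hm.le, sub_zero]
      · rintro (_ | n) -
        · exact h1 m u hu hm.le
        · exact h2 m n u hu hm.le
  have hv1 : volume (φ '' G) ≤ volume G := by
    have := hlip.hausdorffMeasure_image_le (d := 1) zero_le_one G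
    simpa [hausdorffMeasure_real] using this
  have hv2 : volume (insert 0 (range c)) = 0 := ((finite_range c).insert 0).measure_zero _
  have hv : ENNReal.ofReal (0 - φ L) ≤ ENNReal.ofReal A := by
    rw [← Real.volume_Icc]
    calc volume (Icc (φ L) 0) ≤ volume (φ '' G) + volume (insert 0 (range c)) :=
          (measure_mono hcov).trans (measure_union_le _ _)
      _ ≤ ENNReal.ofReal A := by rw [hv2, add_zero]; exact hv1.trans hvol
  have := (ENNReal.ofReal_le_ofReal_iff hA).1 hv
  linarith

theorem toReal_trunc_le {k : ℕ} [NeZero k] (H : ZMod k → Horocycle) (m n : ZMod k) {u : E2}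
    (hu : u ∈ Disk) :
    (trunc H (H m).pt u).toReal ≤ max ((H m).ht u - max (-(H n).ht u) 0) 0 := by
  refine (ENNReal.toReal_mono ENNReal.ofReal_ne_top (trunc_ideal_inter_le H m n hu)).trans ?_
  rw [ENNReal.toReal_ofReal']

theorem gap_eq_of_cr (H H' : Horocycle) (hne : H.pt ≠ H'.pt) {x : E2} (hx : x ∈ Disk)
    (h0 : cr (H'.pt - H.pt) (toKlein x - H.pt) = 0) : H.gap H' = H.ht x + H'.ht x := by
  obtain ⟨τ, hτ⟩ := exists_lineMap_of_cr hne h0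
  obtain ⟨h1, h2⟩ := lineMap_param_mem H.hpt H'.hpt (hτ ▸ toKlein_mem_disk hx)
  obtain ⟨t, rfl⟩ := exists_sig_eq h1 h2
  rw [toKlein_lineMap_iff H.hpt H'.hpt hne hx] at hτ
  subst hτ
  rw [ht_geo_left H H'.hpt hne, ht_geo_right H' H.hpt hne, Horocycle.gap]
  have hpos : 0 < ‖H.pt - H'.pt‖ := norm_pos_iff.2 (sub_ne_zero.2 hne)
  have : ‖H.pt - H'.pt‖ ^ 2 / 4 = (‖H.pt - H'.pt‖ / 2) ^ 2 := by ring
  rw [this, Real.log_pow]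
  push_cast
  ring

namespace KPoly
variable {N : ℤ} {K : Set E2} {V : ℤ → E2}

theorem on_edge_line_rev (h : KPoly N K V) {n b : ℤ} (hn : Even n)
    (hb : cr (V (n - 1) - V n) (V b - V n) = 0) :
    V b = V n ∨ V b = V (n - 1) ∨
      (V b = V (n - 2) ∧ V (n - 1) ∈ openSegment ℝ (V n) (V (n - 2))) := by
  have := h.rev.on_edge_line (n := -n) (b := -b) hn.neg
  simp only [neg_neg, neg_add, ← sub_eq_add_neg] at this
  exact this hb

end KPoly

namespace SemiIdealDomain
variable {k : ℕ}

/-- A flow `f` on a semi-ideal domain whose increments are controlled by the chords, for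
horocycles with heights `s` at the neighbours of their ideal points. -/
structure IsFlux (D : SemiIdealDomain k) (H : ZMod k → Horocycle) (s f : ℤ → ℝ) : Prop where
  poly : KPoly (2 * k) (kl D.Ω) D.V
  pt : ∀ i, (H i).pt = D.pI i
  gap_pos : ∀ i j, i ≠ j → 0 < (H i).gap (H j)
  ht_right : ∀ l : ℤ, (H l).ht (D.pB l) = s l
  ht_left : ∀ l : ℤ, (H l).ht (D.pB (l - 1)) = s l
  flow : D.Flow H f
  lt : ∀ (a : ℤ) (M : ℕ), 0 < M → M < 2 * k → openSegment ℝ (D.V a) (D.V (a + M)) ⊆ kl D.Ω →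
    |f (a + M) - f a| < (trunc H (D.vx a) (D.vx (a + M))).toReal

theorem rev_vx (D : SemiIdealDomain k) (n : ℤ) : D.rev.vx n = D.vx (-n) := by
  rcases Int.even_or_odd' n with ⟨l, rfl | rfl⟩
  · rw [vx_even, ← mul_neg, vx_even, Int.cast_neg]; rfl
  · rw [vx_odd, show -(2 * l + 1) = 2 * (-l - 1) + 1 by ring, vx_odd]
    push_cast; rfl

theorem trunc_neg (H : ZMod k → Horocycle) (u v : E2) :
    trunc (fun i => H (-i)) u v = trunc H u v := by
  rw [trunc, trunc, (neg_involutive.surjective.iUnion_comp fun i => (H i).horodisk :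
    ⋃ i, (H (-i)).horodisk = _)]

theorem rev_V (D : SemiIdealDomain k) (n : ℤ) : D.rev.V n = D.V (-n) := congrArg toKlein (D.rev_vx n)

namespace IsFlux
variable {D : SemiIdealDomain k} {H : ZMod k → Horocycle} {s f : ℤ → ℝ} (S : IsFlux D H s f)
include S

theorem rev : IsFlux D.rev (fun i => H (-i)) (fun l => s (-l)) (fun n => f (-n)) where
  poly := by
    have := S.poly.rev
    rwa [← show D.rev.V = fun n => D.V (-n) from funext D.rev_V] at this
  pt i := S.pt (-i)
  gap_pos i j h := S.gap_pos _ _ (neg_injective.ne h)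
  ht_right l := by
    have := S.ht_left (-l)
    push_cast at this
    exact this
  ht_left l := by
    have := S.ht_right (-l)
    push_cast at this
    rw [← this]
    show (H (-l)).ht (D.pB (-((l:ZMod k) - 1) - 1)) = _
    congr 2; ring
  flow n := by
    have h := S.flow (-(n + 1))
    have hl : D.rev.len (fun i => H (-i)) n = D.len H (-(n + 1)) := by
      rw [len, len, trunc_neg, rev_vx, rev_vx, trunc_comm]
      congr 3; ring
    rw [show -(n + 1) + 1 = -n by ring] at h
    show f (-(n + 1)) = f (-n) + _
    rw [hl, h]
    by_cases he : Even n
    · rw [if_pos he, if_neg (by rw [even_neg, Int.even_add_one]; exact not_not.2 he)]; ring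
    · rw [if_neg he, if_pos (by rw [even_neg, Int.even_add_one]; exact he)]; ring
  lt a M h0 hM hch := by
    have := S.lt (-(a + M)) M h0 hM (by
      rw [rev_V, rev_V, openSegment_symm] at hch
      rwa [show -(a + M : ℤ) + M = -a by ring])
    rw [show -(a + M : ℤ) + M = -a by ring, abs_sub_comm] at this
    rwa [trunc_neg, rev_vx, rev_vx, trunc_comm]

theorem pt_ne {i j : ZMod k} (h : i ≠ j) : (H i).pt ≠ (H j).pt := by
  rw [S.pt, S.pt]; exact D.injI.ne h

omit S in
theorem cast_ne {m n : ℤ} (h1 : m < n) (h2 : n < m + k) : (m : ZMod k) ≠ n := fun h => by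
  have := (ZMod.intCast_eq_intCast_iff_dvd_sub m n k).1 h
  have := Int.eq_zero_of_abs_lt_dvd this (by rw [abs_lt]; constructor <;> omega)
  omega

omit S in
theorem cast_add_card (l : ℤ) : ((l + k : ℤ) : ZMod k) = l := by push_cast; simp

theorem two_le : 2 ≤ k := by have := S.poly.four_le; omega

theorem adjacent_pos (l : ℤ) : 0 < s l + s (l + 1) := by
  have h := S.two_le
  have hne : (l : ZMod k) ≠ (l + 1 : ℤ) := cast_ne (by omega) (by omega)
  have h1 := S.ht_left (l + 1)
  rw [Int.cast_add, Int.cast_one, add_sub_cancel_right] at h1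
  rw [← S.ht_right l, ← h1]
  push_cast at hne ⊢
  exact (S.gap_pos _ _ hne).trans_le (gap_le_ht_add_ht _ _ (S.pt_ne hne) (D.inter _))

theorem ht_left' (l : ℤ) : (H ((l + 1 : ℤ) : ZMod k)).ht (D.pB l) = s (l + 1) := by
  have h1 := S.ht_left (l + 1)
  rwa [Int.cast_add, Int.cast_one, add_sub_cancel_right, ← Int.cast_one, ← Int.cast_add] at h1

theorem len_even_le (l : ℤ) : D.len H (2 * l) ≤ max (s l) 0 - max (-s (l + 1)) 0 := by
  have : NeZero k := ⟨D.k_pos.ne'⟩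
  have h := toReal_trunc_le H l ((l + 1 : ℤ) : ZMod k) (D.inter l)
  rw [S.ht_right, S.ht_left', S.pt] at h
  rw [len, vx_even, vx_odd]
  refine h.trans ?_
  have := S.adjacent_pos l
  rcases le_total (s (l + 1)) 0 with h1 | h1
  · rw [max_eq_left (by linarith : 0 ≤ -s (l + 1)), max_eq_left (by linarith : 0 ≤ s l),
      max_eq_left (by linarith)]
  · rw [max_eq_right (by linarith : -s (l + 1) ≤ 0), sub_zero, sub_zero]

theorem len_odd_le (l : ℤ) : D.len H (2 * l + 1) ≤ max (s (l + 1)) 0 - max (-s l) 0 := by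
  have h := S.rev.len_even_le (-l - 1)
  have hl : D.rev.len (fun i => H (-i)) (2 * (-l - 1)) = D.len H (2 * l + 1) := by
    rw [len, len, trunc_neg, rev_vx, rev_vx, trunc_comm]
    congr 3 <;> ring
  rw [hl] at h
  simpa [neg_add, add_comm] using h

theorem f_odd (l : ℤ) : f (2 * l + 1) = f (2 * l) + D.len H (2 * l) := by
  have := S.flow (2 * l); rwa [if_pos (even_two_mul l)] at this

theorem f_even (l : ℤ) : f (2 * (l + 1)) = f (2 * l + 1) - D.len H (2 * l + 1) := by
  have := S.flow (2 * l + 1)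
  rw [if_neg (Int.not_even_two_mul_add_one l)] at this
  rw [mul_add, mul_one, show (2:ℤ) * l + 2 = 2 * l + 1 + 1 by ring, this]; ring

/-- The domain has a straight angle at the interior vertex with index `l`. -/
def _root_.SemiIdealDomain.Straight (D : SemiIdealDomain k) (l : ℤ) : Prop :=
  D.V (2 * l + 1) ∈ openSegment ℝ (D.V (2 * l)) (D.V (2 * (l + 1)))

theorem gap_of_straight {l : ℤ} (h : D.Straight l) :
    (H l).gap (H ((l + 1 : ℤ) : ZMod k)) = s l + s (l + 1) := by
  have hk := S.two_le
  have hne : (l : ZMod k) ≠ (l + 1 : ℤ) := cast_ne (by omega) (by omega)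
  rw [← S.ht_right, ← S.ht_left']
  refine gap_eq_of_cr _ _ (S.pt_ne hne) (D.inter _) ?_
  rw [S.pt, S.pt, ← V_even, ← V_even, ← V_odd]
  rw [Straight, openSegment_eq_lineMap] at h
  obtain ⟨τ, -, h⟩ := h
  rw [← h, cr_lineMap_self]

theorem f_ideal_ideal {m n : ℤ} (h1 : m < n) (h2 : n < m + k)
    (h3 : ¬ (n = m + k - 1 ∧ D.Straight n)) :
    |f (2 * m) - f (2 * n)| ≤ (H m).gap (H n) := by
  have : NeZero k := ⟨D.k_pos.ne'⟩
  have hne := cast_ne h1 h2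
  by_cases hst : n = m + 1 ∧ D.Straight m
  · obtain ⟨rfl, hst⟩ := hst
    rw [S.gap_of_straight hst, S.f_even, S.f_odd]
    have e1 := S.len_even_le m
    have e2 := S.len_odd_le m
    have e3 := D.len_nonneg H (2 * m)
    have e4 := D.len_nonneg H (2 * m + 1)
    have e5 := max_zero_sub_max_neg_zero_eq_self (s m)
    have e6 := max_zero_sub_max_neg_zero_eq_self (s (m + 1))
    rw [abs_le]
    constructor <;> linarith
  · have hM : (2 * m : ℤ) + (2 * (n - m).toNat : ℕ) = 2 * n := by omega
    have hch : openSegment ℝ (D.V (2 * m)) (D.V (2 * n)) ⊆ kl D.Ω := by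
      refine S.poly.openSegment_subset (even_two_mul m) (fun h0 => ?_) fun h0 => ?_
      · rcases S.poly.on_edge_line (even_two_mul m) h0 with h | h | ⟨h, h'⟩
        · exact S.poly.ne_of_lt (by omega) (by omega) h.symm
        · exact S.poly.ne_of_lt (by omega) (by omega) h.symm
        · refine hst ⟨?_, by rwa [Straight, mul_add, mul_one]⟩
          by_contra hn
          exact S.poly.ne_of_lt (by omega) (by omega) h.symm
      · rcases S.poly.on_edge_line_rev (even_two_mul m) h0 with h | h | ⟨h, h'⟩
        · exact S.poly.ne_of_lt (by omega) (by omega) h.symm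
        · rw [← S.poly.per (2 * m - 1)] at h
          exact S.poly.ne_of_lt (m := 2 * n) (by omega) (by omega) h
        · have hn : n = m + k - 1 := by
            by_contra hn
            have := S.poly.per (2 * m - 2)
            rw [← this] at h
            exact S.poly.ne_of_lt (m := 2 * n) (by omega) (by omega) h
          refine h3 ⟨hn, ?_⟩
          rw [Straight, openSegment_symm]
          have p1 := S.poly.per (2 * m)
          have p2 := S.poly.per (2 * m - 1)
          have p3 := S.poly.per (2 * m - 2)
          rw [← p1, ← p2, ← p3] at h'
          rwa [show 2 * m - 1 + 2 * (k : ℤ) = 2 * n + 1 by omega,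
            show 2 * m + 2 * (k : ℤ) = 2 * (n + 1) by omega,
            show 2 * m - 2 + 2 * (k : ℤ) = 2 * n by omega] at h'
    have h := S.lt (2 * m) (2 * (n - m).toNat) (by omega) (by omega) (by rwa [hM])
    rw [hM, vx_even, vx_even, abs_sub_comm, ← S.pt, ← S.pt] at h
    refine h.le.trans ?_
    have := ENNReal.toReal_mono ENNReal.ofReal_ne_top (trunc_ideal_ideal_le H (S.pt_ne hne))
    rwa [ENNReal.toReal_ofReal (S.gap_pos _ _ hne).le] at this

theorem chord_ideal_inter {i j : ℤ} (h1 : i < j) (h2 : j < i + k - 1) :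
    openSegment ℝ (D.V (2 * i)) (D.V (2 * j + 1)) ⊆ kl D.Ω := by
  refine S.poly.openSegment_subset (even_two_mul i) (fun h0 => ?_) fun h0 => ?_
  · rcases S.poly.on_edge_line (even_two_mul i) h0 with h | h | ⟨h, h'⟩ <;>
      exact S.poly.ne_of_lt (by omega) (by omega) h.symm
  · rcases S.poly.on_edge_line_rev (even_two_mul i) h0 with h | h | ⟨h, h'⟩ <;>
      rw [← S.poly.per] at h
    · exact S.poly.ne_of_lt (m := 2 * i) (n := 2 * j + 1) (by omega) (by omega)
        (by rw [← h, S.poly.per])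
    · rw [← S.poly.per (2 * i - 1)] at h
      exact S.poly.ne_of_lt (m := 2 * j + 1) (n := 2 * i - 1 + 2 * k) (by omega) (by omega)
        (by rw [← h, S.poly.per])
    · rw [← S.poly.per (2 * i - 2)] at h
      exact S.poly.ne_of_lt (m := 2 * j + 1) (n := 2 * i - 2 + 2 * k) (by omega) (by omega)
        (by rw [← h, S.poly.per])

theorem f_inter_ideal {l m : ℤ} (h1 : l < m) (h2 : m < l + k) :
    |f (2 * m) - f (2 * l + 1)| ≤ max ((H m).ht (D.pB l)) 0 := by
  have : NeZero k := ⟨D.k_pos.ne'⟩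
  rcases (Int.add_one_le_iff.2 h1).eq_or_lt with rfl | h3
  · rw [S.f_even, S.ht_left', sub_sub_cancel_left, abs_neg, abs_of_nonneg (D.len_nonneg H _)]
    exact (S.len_odd_le l).trans (by linarith [le_max_right (-s l) 0])
  · have hM : (2 * l + 1 : ℤ) + (2 * (m - l).toNat - 1 : ℕ) = 2 * m := by omega
    have hch := S.chord_ideal_inter (i := m) (j := l + k) (by omega) (by omega)
    rw [show 2 * (l + k : ℤ) + 1 = 2 * l + 1 + 2 * k by ring, S.poly.per, openSegment_symm] at hch
    have h := S.lt (2 * l + 1) (2 * (m - l).toNat - 1) (by omega) (by omega) (by rwa [hM])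
    rw [hM, vx_odd, vx_even, trunc_comm, ← S.pt] at h
    exact h.le.trans ((toReal_trunc_le H m m (D.inter l)).trans
      (max_le_max (by linarith [le_max_right (-(H m).ht (D.pB l)) 0]) le_rfl))

end IsFlux
end SemiIdealDomain

namespace SemiIdealDomain
variable {k : ℕ}

theorem exists_intCast_eq (D : SemiIdealDomain k) (l : ℤ) (i : ZMod k) :
    ∃ m : ℤ, l ≤ m ∧ m < l + k ∧ (m : ZMod k) = i := by
  have : NeZero k := ⟨D.k_pos.ne'⟩
  refine ⟨l + (i - l).val, by omega, by have := ZMod.val_lt (i - (l : ZMod k)); omega, ?_⟩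
  push_cast
  rw [ZMod.natCast_zmod_val]; ring

namespace IsFlux
variable {D : SemiIdealDomain k} {H : ZMod k → Horocycle} {s f : ℤ → ℝ} (S : IsFlux D H s f)
include S

theorem f_ideal_ideal_of_near {m n : ℤ} (hmn : m ≠ n) (h1 : m < n + k - 1) (h2 : n < m + k - 1) :
    |f (2 * m) - f (2 * n)| ≤ (H m).gap (H n) := by
  rcases hmn.lt_or_gt with h | h
  · exact S.f_ideal_ideal h (by omega) (by omega)
  · rw [abs_sub_comm, Horocycle.gap_comm]
    exact S.f_ideal_ideal h (by omega) (by omega)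

theorem cr_ray {l m : ℤ} {q : E2} (hq : ‖q‖ = 1) {t₀ : ℝ}
    (e : geo q (H l).pt t₀ = D.pB l) (t : ℝ) :
    cr ((H m).pt - (H l).pt) (toKlein (geo q (H l).pt t) - (H l).pt) = 0 ↔
      cr (D.V (2 * l + 1) - D.V (2 * l)) (D.V (2 * m) - D.V (2 * l)) = 0 := by
  have key : ∀ t, toKlein (geo q (H l).pt t) - (H l).pt = (1 - sig t) • (q - (H l).pt) := fun t => by
    rw [toKlein_geo' hq (H l).hpt, AffineMap.lineMap_apply, vsub_eq_sub, vadd_eq_add]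
    module
  have hs : ∀ t, 1 - sig t ≠ 0 := fun t => by linarith [sig_lt_one t]
  rw [V_odd, V_even, V_even, ← S.pt, ← S.pt, ← e, key, key, cr_smul_right, cr_smul_left,
    cr_swap ((H m).pt - _)]
  simp [hs]

theorem le_len_even (l : ℤ) (hT : f (2 * (l + k)) ≤ f (2 * l)) :
    max (s l) 0 - max (-s (l + 1)) 0 ≤ D.len H (2 * l) := by
  classical
  have : NeZero k := ⟨D.k_pos.ne'⟩
  have hk := S.two_le
  by_contra! hlt
  have hA := D.len_nonneg H (2 * l)
  have hs : 0 < s l := by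
    by_contra! h
    rw [max_eq_right h] at hlt
    linarith [le_max_right (-s (l + 1)) 0]
  rw [max_eq_left hs.le] at hlt
  obtain ⟨q, hq, hne, t₀, e, harc, hht⟩ := exists_ray (H l) (D.inter l)
  rw [S.ht_right] at hht
  set γ : ℝ → E2 := fun u => geo q (H l).pt (t₀ + u)
  have hγ : ∀ u, γ u ∈ Disk := fun u => geo_mem_disk hq (H l).hpt hne _
  have hγ0 : γ 0 = D.pB l := by show geo _ _ _ = _; rw [add_zero, e]
  have hl : ∀ u, (H l).ht (γ u) = s l - u := fun u => by
    show (H l).ht (geo _ _ _) = _; rw [hht]; ring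
  have hlip : ∀ (m : ZMod k) u v, |(H m).ht (γ u) - (H m).ht (γ v)| ≤ |u - v| := fun m u v => by
    have := ht_geo_lipschitz (H m) hq (H l).hpt hne (t₀ + u) (t₀ + v)
    rwa [add_sub_add_left_eq_sub] at this
  have hstr : D.Straight l → ∀ u, (H ((l + 1 : ℤ) : ZMod k)).ht (γ u) = s (l + 1) + u := by
    intro h u
    have hne' : (l : ZMod k) ≠ (l + 1 : ℤ) := cast_ne (by omega) (by omega)
    have h0 : cr (D.V (2 * l + 1) - D.V (2 * l)) (D.V (2 * (l + 1)) - D.V (2 * l)) = 0 := by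
      rw [Straight, openSegment_eq_lineMap] at h
      obtain ⟨τ, -, h⟩ := h
      rw [cr_swap, ← h, cr_lineMap_self, neg_zero]
    have := gap_eq_of_cr _ _ (S.pt_ne hne') (hγ u) ((S.cr_ray hq e (t₀ + u)).2 h0)
    rw [S.gap_of_straight h, hl] at this
    linarith
  set t : ℝ := if D.Straight l then max (-s (l + 1)) 0 else 0 with htdef
  have ht0 : 0 ≤ t := by
    rw [htdef]; split_ifs
    exacts [le_max_right _ _, le_rfl]
  have htle : t ≤ max (-s (l + 1)) 0 := by
    rw [htdef]; split_ifs
    exacts [le_rfl, le_max_right _ _]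
  have htpos : 0 < t → D.Straight l ∧ t = -s (l + 1) ∧ f (2 * (l + 1)) = f (2 * l + 1) := by
    intro hpos
    by_cases hst : D.Straight l
    · rw [htdef, if_pos hst] at hpos ⊢
      have h1 : s (l + 1) < 0 := by
        by_contra! h
        rw [max_eq_right (by linarith)] at hpos
        exact lt_irrefl _ hpos
      refine ⟨hst, max_eq_left (by linarith), ?_⟩
      have h2 := S.len_odd_le l
      rw [max_eq_right h1.le, max_eq_right (by linarith)] at h2
      rw [S.f_even]
      linarith [D.len_nonneg H (2 * l + 1)]
    · rw [htdef, if_neg hst] at hpos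
      exact absurd hpos (lt_irrefl _)
  set M : Finset ℤ := (Finset.Ioo l (l + k)).filter fun m => ¬ (m = l + 1 ∧ D.Straight l)
  have hM : ∀ m : M, l < m ∧ (m : ℤ) < l + k ∧ ¬ ((m : ℤ) = l + 1 ∧ D.Straight l) := fun m => by
    have := Finset.mem_filter.1 m.2
    rw [Finset.mem_Ioo] at this
    exact ⟨this.1.1, this.1.2, this.2⟩
  have hbound : ∀ m : M, 0 < t → ∀ u, |f (2 * m) - f (2 * l + 1)| ≤ (H (m : ℤ)).ht (γ u) + (u - t) := by
    intro m hpos u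
    obtain ⟨hst, h1, h2⟩ := htpos hpos
    obtain ⟨m1, m2, m3⟩ := hM m
    have hm : (m : ℤ) ≠ l + 1 := fun h => m3 ⟨h, hst⟩
    have h3 := S.f_ideal_ideal_of_near hm (by omega) (by omega)
    rw [h2] at h3
    have h4 := gap_le_ht_add_ht _ _ (S.pt_ne
      (cast_ne (k := k) (m := l + 1) (n := m) (by omega) (by omega)).symm) (hγ u)
    rw [hstr hst] at h4
    linarith
  refine (chain_bound (fun m : M => f (2 * m) - f (2 * l + 1))
    (fun m u => (H (m : ℤ)).ht (γ u)) (fun m => hlip m) ht0 hs.le hA ?_ ?_ ?_ ?_).elim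
    (fun h => by linarith) ?_
  rotate_left 4
  · rintro ⟨m, hm⟩
    obtain ⟨m1, m2, m3⟩ := hM m
    have hne' : ((m : ℤ) : ZMod k) ≠ l := (cast_ne m1 m2).symm
    have hy := gap_le_ht_add_ht _ _ (S.pt_ne hne') (hγ (s l))
    have hgap := S.gap_pos _ _ hne'
    rw [hl, sub_self, add_zero] at hy
    have hD := S.f_ideal_ideal (m := m) (n := l + k) (by omega) (by omega) (by
      rintro ⟨h1, h2⟩
      refine m3 ⟨by omega, ?_⟩
      rw [Straight] at h2 ⊢
      have p1 := S.poly.per (2 * l)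
      have p2 := S.poly.per (2 * l + 1)
      have p3 := S.poly.per (2 * (l + 1))
      rw [← p1, ← p2, ← p3]
      rwa [show 2 * l + 1 + 2 * (k : ℤ) = 2 * (l + k) + 1 by ring,
            show 2 * l + 2 * (k : ℤ) = 2 * (l + k) by ring,
            show 2 * (l + 1) + 2 * (k : ℤ) = 2 * (l + k + 1) by ring])
    rw [cast_add_card] at hD
    have hD' := (abs_le.1 hD).2
    rw [max_eq_left (by linarith)] at hm
    have hfl := S.f_odd l
    have heq : (H (m : ℤ)).gap (H l) = (H (m : ℤ)).ht (γ (s l)) + (H l).ht (γ (s l)) := by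
      rw [hl, sub_self, add_zero]
      linarith
    rw [Horocycle.gap_comm, add_comm] at heq
    have h0 := (S.cr_ray hq e _).1 (cr_eq_zero_of_gap_eq _ _ (S.pt_ne hne'.symm) (hγ _) heq)
    rcases S.poly.on_edge_line (even_two_mul l) h0 with h | h | ⟨h, h'⟩
    · exact S.poly.ne_of_lt (by omega) (by omega) h.symm
    · exact S.poly.ne_of_lt (by omega) (by omega) h.symm
    · have : (m : ℤ) ≠ l + 1 := fun hm => m3 ⟨hm, by rwa [Straight, mul_add, mul_one]⟩
      exact S.poly.ne_of_lt (by omega) (by omega) h.symm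
  · intro m u hu hg
    rcases ht0.eq_or_lt with h0 | h0
    · obtain ⟨m1, m2, -⟩ := hM m
      have h1 := S.f_inter_ideal m1 m2
      rw [← hγ0] at h1
      have h2 := hlip (m : ℤ) u 0
      rw [sub_zero, abs_of_nonneg hu.1] at h2
      have h3 : max ((H (m : ℤ)).ht (γ 0)) 0 ≤ u :=
        max_le (by linarith [(abs_le.1 h2).1]) hu.1
      rw [← h0, sub_zero, max_eq_left hu.1]
      linarith [(abs_le.1 h1).1]
    · have := hbound m h0 u
      linarith [(abs_le.1 this).1, le_max_left (u - t) 0]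
  · intro m n u hu hg
    by_cases hmn : (m : ℤ) = n
    · rw [hmn]; linarith [le_max_right ((H (n : ℤ)).ht (γ u)) 0]
    · obtain ⟨m1, m2, -⟩ := hM m
      obtain ⟨n1, n2, -⟩ := hM n
      have h1 := S.f_ideal_ideal_of_near hmn (by omega) (by omega)
      have hne' : ((m : ℤ) : ZMod k) ≠ (n : ℤ) := by
        rcases lt_or_gt_of_ne hmn with h | h
        · exact cast_ne h (by omega)
        · exact (cast_ne h (by omega)).symm
      have h2 := gap_le_ht_add_ht _ _ (S.pt_ne hne') (hγ u)
      linarith [(abs_le.1 h1).1, le_max_left ((H (n : ℤ)).ht (γ u)) 0]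
  · intro m u hu hut
    have := hbound m (hu.1.trans_lt hut) u
    linarith [(abs_le.1 this).2, le_max_left ((H (m : ℤ)).ht (γ u)) 0]
  · have hfin := (D.trunc_vx_lt_top H S.pt (a := 2 * l) (b := 2 * l + 1) fun h =>
      S.poly.ne_succ _ ((D.V_eq_iff _ _).2 h)).ne
    rw [len, ENNReal.ofReal_toReal hfin, vx_even, vx_odd, ← S.pt, trunc, harc,
      hypMeas_image_geo_diff H hq (H l).hpt hne measurableSet_Ici]
    refine le_trans (measure_mono ?_) (measure_preimage_add volume t₀ _).le
    rintro u ⟨hu, htu, hg⟩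
    refine ⟨by simpa using hu.1, fun i => ?_⟩
    obtain ⟨m, m1, m2, rfl⟩ := D.exists_intCast_eq l i
    show 0 ≤ (H m).ht (γ u)
    rcases m1.eq_or_lt with rfl | m1
    · rw [hl]; linarith [hu.2]
    · by_cases hst : m = l + 1 ∧ D.Straight l
      · obtain ⟨rfl, hst⟩ := hst
        rw [hstr hst]
        rw [htdef, if_pos hst] at htu
        linarith [le_max_left (-s (l + 1)) 0]
      · exact hg ⟨m, Finset.mem_filter.2 ⟨Finset.mem_Ioo.2 ⟨m1, m2⟩, hst⟩⟩

theorem f_add_period (n : ℤ) : f (n + 2 * k) - f n = f (2 * k) - f 0 := by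
  have hlen : ∀ n, D.len H (n + 2 * k) = D.len H n := fun n => by
    rw [len, len, vx_per, add_right_comm, vx_per]
  have hstep : ∀ n, f (n + 1 + 2 * k) - f (n + 1) = f (n + 2 * k) - f n := fun n => by
    have he : Even (n + 2 * k : ℤ) ↔ Even n := by
      rw [Int.even_add]; simp
    rw [add_right_comm, S.flow, S.flow n, hlen]
    simp only [he]
    ring
  induction n with
  | zero => simp
  | succ n ih => rw [hstep, ih]
  | pred n ih =>
    have := hstep (-n - 1)
    rw [sub_add_cancel] at this
    rw [← this, ih]

theorem s_period (l : ℤ) : s (l + k) = s l := by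
  rw [← S.ht_right, ← S.ht_right l, cast_add_card]

theorem f_period_of_le (hT : f (2 * k) ≤ f 0) : f 0 ≤ f (2 * k) := by
  have hmono : Monotone fun l : ℤ => f (2 * l) + |s l| := by
    refine monotone_int_of_le_succ fun l => ?_
    have h1 := S.le_len_even l (by
      have := S.f_add_period (2 * l)
      rw [mul_add]; linarith)
    have h2 := S.len_odd_le l
    have h3 := S.f_even l
    have h4 := S.f_odd l
    have e1 := max_zero_add_max_neg_zero_eq_abs_self (s l)
    have e2 := max_zero_add_max_neg_zero_eq_abs_self (s (l + 1))
    show f (2 * l) + |s l| ≤ f (2 * (l + 1)) + |s (l + 1)|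
    linarith
  have h := hmono (show (0:ℤ) ≤ 0 + k by omega)
  dsimp only at h
  rw [S.s_period, zero_add, mul_zero] at h
  linarith

theorem f_period (n : ℤ) : f (n + 2 * k) = f n := by
  have h1 := S.f_add_period n
  have h2 := S.f_add_period (-(2 * k))
  rw [neg_add_cancel] at h2
  have h3 := S.rev.f_period_of_le
  rw [neg_zero] at h3
  rcases le_total (f (2 * k)) (f 0) with h | h
  · linarith [S.f_period_of_le h]
  · linarith [h3 (by linarith)]

theorem len_even (l : ℤ) : D.len H (2 * l) = max (s l) 0 - max (-s (l + 1)) 0 :=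
  le_antisymm (S.len_even_le l) (S.le_len_even l (by rw [mul_add, S.f_period]))

theorem len_odd (l : ℤ) : D.len H (2 * l + 1) = max (s (l + 1)) 0 - max (-s l) 0 := by
  have h := S.rev.len_even (-l - 1)
  have hl : D.rev.len (fun i => H (-i)) (2 * (-l - 1)) = D.len H (2 * l + 1) := by
    rw [len, len, trunc_neg, rev_vx, rev_vx, trunc_comm]
    congr 3 <;> ring
  rw [hl] at h
  simpa [neg_add, add_comm] using h

theorem f_add_abs_eq (m : ℤ) : f (2 * m) + |s m| = f 0 + |s 0| := by
  have hstep : ∀ l : ℤ, f (2 * (l + 1)) + |s (l + 1)| = f (2 * l) + |s l| := fun l => by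
    have h1 := S.len_even l
    have h2 := S.len_odd l
    have h3 := S.f_even l
    have h4 := S.f_odd l
    have e1 := max_zero_add_max_neg_zero_eq_abs_self (s l)
    have e2 := max_zero_add_max_neg_zero_eq_abs_self (s (l + 1))
    linarith
  induction m with
  | zero => simp
  | succ n ih => rw [hstep, ih]
  | pred n ih =>
    have := hstep (-n - 1)
    rw [sub_add_cancel] at this
    rw [← this, ih]

theorem lt_ht {i j : ℤ} (h1 : i < j) (h2 : j < i + k - 1) : s i < (H i).ht (D.pB j) := by
  have : NeZero k := ⟨D.k_pos.ne'⟩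
  by_contra! hle
  have hM : (2 * i : ℤ) + (2 * (j - i).toNat + 1 : ℕ) = 2 * j + 1 := by omega
  have h := S.lt (2 * i) (2 * (j - i).toNat + 1) (by omega) (by omega)
    (by rw [hM]; exact S.chord_ideal_inter h1 h2)
  rw [hM, vx_even, vx_odd, ← S.pt] at h
  have hf : f (2 * j + 1) - f (2 * i) = |s i| - max (-s j) 0 - max (-s (j + 1)) 0 := by
    have e1 := S.f_odd j
    have e2 := S.len_even j
    have e3 := S.f_add_abs_eq i
    have e4 := S.f_add_abs_eq j
    have e5 := max_zero_add_max_neg_zero_eq_abs_self (s j)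
    linarith
  rw [hf] at h
  have hx : (trunc H (H i).pt (D.pB j)).toReal ≤
      max ((H i).ht (D.pB j) - (max (-s j) 0 + max (-s (j + 1)) 0)) 0 := by
    have hadj := S.adjacent_pos j
    rcases le_total 0 (s (j + 1)) with h0 | h0
    · have := toReal_trunc_le H i j (D.inter j)
      rw [S.ht_right] at this
      rwa [max_eq_right (neg_nonpos.2 h0), add_zero]
    · have := toReal_trunc_le H i ((j + 1 : ℤ) : ZMod k) (D.inter j)
      rw [S.ht_left'] at this
      rwa [max_eq_right (a := -s j) (by linarith), zero_add]
  have h' := h.trans_le (hx.trans (max_le_max (sub_le_sub_right hle _) le_rfl))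
  rcases lt_max_iff.1 h' with h'' | h''
  · linarith [le_abs_self (|s i| - max (-s j) 0 - max (-s (j + 1)) 0), le_abs_self (s i)]
  · exact absurd h'' (not_lt.2 (abs_nonneg _))

end IsFlux

theorem vertices_outside_of_fluxIneq (D : SemiIdealDomain k) (hconv : HypConvex D.Ω)
    {H : ZMod k → Horocycle} (hpt : ∀ i, (H i).pt = D.pI i)
    (hdisj : ∀ i j, i ≠ j → Disjoint (H i).circle (H j).circle) (hΦ : FluxIneq D H)
    {Dh : ZMod k → Horocycle}
    (hDh : ∀ i, (Dh i).pt = D.pI i ∧ D.pB (i - 1) ∈ (Dh i).circle ∧ D.pB i ∈ (Dh i).circle)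
    {i j : ZMod k} (hij : j ≠ i) (hij' : j ≠ i - 1) : 0 < (Dh i).ht (D.pB j) := by
  have hP := D.kPoly hconv Dh hDh
  obtain ⟨ε, hε⟩ := hP.exists_orient
  obtain ⟨f, hf⟩ := D.exists_flow H
  have hht : ∀ i p, (H i).ht p = (Dh i).ht p + ((Dh i).lev - (H i).lev) := fun i p => by
    rw [Horocycle.ht, Horocycle.ht, hpt, (hDh i).1]; ring
  have h0 : ∀ i, (Dh i).ht (D.pB i) = 0 := fun i =>
    ((Dh i).ht_eq_zero_iff (D.inter _)).2 (hDh i).2.2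
  have h1 : ∀ i, (Dh i).ht (D.pB (i - 1)) = 0 := fun i =>
    ((Dh i).ht_eq_zero_iff (D.inter _)).2 (hDh i).2.1
  have S : IsFlux D H (fun l => (Dh l).lev - (H l).lev) f :=
    { poly := hP
      pt := hpt
      gap_pos := fun i j h => gap_pos _ _ (by rw [hpt, hpt]; exact D.injI.ne h) (hdisj i j h)
      ht_right := fun l => by rw [hht, h0, zero_add]
      ht_left := fun l => by rw [hht, h1, zero_add]
      flow := hf
      lt := fun a M h0 hM hch => abs_flow_lt_trunc hP hε h0 hM hch hpt hΦ hf }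
  obtain ⟨a, -, -, rfl⟩ := D.exists_intCast_eq 0 i
  obtain ⟨b, b1, b2, rfl⟩ := D.exists_intCast_eq a j
  have hb1 : a ≠ b := fun h => hij (by rw [h])
  have hb2 : b ≠ a + k - 1 := fun h => hij' (by rw [h]; push_cast; simp)
  have := S.lt_ht (lt_of_le_of_ne b1 hb1) (by omega)
  rw [hht] at this
  linarith

end SemiIdealDomain

/-! ### Boundary of an inscribed domain in the Klein model -/

namespace KPoly
variable {N : ℤ} {K : Set E2} {V : ℤ → E2}

/-- A segment between vertices meeting an open edge contains that edge. -/
theorem edge_subset_segment (h : KPoly N K V) {n a b : ℤ} {z : E2}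
    (hz : z ∈ openSegment ℝ (V n) (V (n + 1))) (hz' : z ∈ segment ℝ (V a) (V b)) :
    segment ℝ (V n) (V (n + 1)) ⊆ segment ℝ (V a) (V b) := by
  have hne := h.ne_succ n
  have hmid : midpoint ℝ (V n) (V (n + 1)) ∈ openSegment ℝ (V n) (V (n + 1)) :=
    midpoint_mem_openSegment _ _
  have hnot : ∀ m, V m ∉ openSegment ℝ (V n) (V (n + 1)) := fun m => h.vertex_notMem_openEdge m n
  have hzo : z ∈ openSegment ℝ (V a) (V b) :=
    mem_openSegment_of_ne_left_right (fun e => hnot a (e ▸ hz)) (fun e => hnot b (e ▸ hz)) hz'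
  obtain ⟨σ, hσ1, hσ⟩ := h.orient_edge n
  have hσ0 : σ ≠ 0 := by rcases hσ1 with rfl | rfl <;> norm_num
  have ha := orient_nonneg hσ (h.mem_closure a)
  have hb := orient_nonneg hσ (h.mem_closure b)
  rw [openSegment_eq_lineMap] at hz hzo
  obtain ⟨τ, hτ, rfl⟩ := hz
  obtain ⟨θ, hθ, hzθ⟩ := hzo
  have h0 : (1 - θ) * (σ * cr (V (n + 1) - V n) (V a - V n)) +
      θ * (σ * cr (V (n + 1) - V n) (V b - V n)) = 0 := by
    have := cr_lineMap (V (n + 1) - V n) (V n) (V a) (V b) θ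
    rw [hzθ, cr_lineMap_self] at this
    linear_combination -σ * this
  have ha0 : cr (V (n + 1) - V n) (V a - V n) = 0 := by
    have : σ * cr (V (n + 1) - V n) (V a - V n) = 0 := by
      nlinarith [hθ.1, hθ.2, mul_nonneg hθ.1.le hb]
    exact (mul_eq_zero.1 this).resolve_left hσ0
  have hb0 : cr (V (n + 1) - V n) (V b - V n) = 0 := by
    have : σ * cr (V (n + 1) - V n) (V b - V n) = 0 := by
      nlinarith [hθ.1, hθ.2, mul_nonneg (sub_nonneg.2 hθ.2.le) ha]
    exact (mul_eq_zero.1 this).resolve_left hσ0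
  obtain ⟨α, hα⟩ := exists_lineMap_of_cr hne ha0
  obtain ⟨β, hβ⟩ := exists_lineMap_of_cr hne hb0
  have hα' : α ∉ Ioo (0:ℝ) 1 := fun hm => hnot a (by
    rw [openSegment_eq_lineMap]; exact ⟨α, hm, hα.symm⟩)
  have hβ' : β ∉ Ioo (0:ℝ) 1 := fun hm => hnot b (by
    rw [openSegment_eq_lineMap]; exact ⟨β, hm, hβ.symm⟩)
  have hτe : τ = (1 - θ) * α + θ * β := by
    apply lineMap_inj hne
    rw [← hzθ, hα, hβ]
    simp only [AffineMap.lineMap_apply_module]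
    module
  rw [mem_Ioo, not_and_or, not_lt, not_lt] at hα' hβ'
  have key : ∀ {c d : ℝ}, c ≤ 0 → 1 ≤ d → segment ℝ (V n) (V (n + 1)) ⊆
      segment ℝ (AffineMap.lineMap (V n) (V (n + 1)) c : E2)
        (AffineMap.lineMap (V n) (V (n + 1)) d) := by
    intro c d hc hd
    rw [segment_lineMap _ _ (by linarith : c ≤ d), segment_eq_image_lineMap]
    exact image_mono (Icc_subset_Icc hc hd)
  rw [hα, hβ]
  rcases hα' with h1 | h1 <;> rcases hβ' with h2 | h2
  · nlinarith [hτ.1, hτ.2, hθ.1, hθ.2]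
  · exact key h1 h2
  · rw [segment_symm ℝ (AffineMap.lineMap _ _ α : E2)]
    exact key h2 h1
  · nlinarith [hτ.1, hτ.2, hθ.1, hθ.2]

theorem disjoint_openEdge (h : KPoly N K V) {m n : ℤ} (hmn : ¬ N ∣ n - m) :
    Disjoint (openSegment ℝ (V m) (V (m + 1))) (openSegment ℝ (V n) (V (n + 1))) := by
  rw [Set.disjoint_left]
  intro z hm hn
  have h1 := h.edge_subset_segment hm (openSegment_subset_segment ℝ _ _ hn)
  have hend : ∀ l, V l ∈ segment ℝ (V n) (V (n + 1)) → V l = V n ∨ V l = V (n + 1) := by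
    intro l hl
    rw [← insert_endpoints_openSegment] at hl
    rcases hl with hl | hl | hl
    · exact Or.inl hl
    · exact Or.inr hl
    · exact absurd hl (h.vertex_notMem_openEdge l n)
  have hN := h.four_le
  have hne := h.ne_succ m
  rcases hend m (h1 (left_mem_segment ℝ _ _)) with e | e
  · exact hmn (h.inj _ _ e)
  · rcases hend (m + 1) (h1 (right_mem_segment ℝ _ _)) with e' | e'
    · have d1 := h.inj _ _ e
      have d2 := h.inj _ _ e'
      have : N ∣ 2 := by have := dvd_sub d1 d2; ring_nf at this; exact this
      have := Int.le_of_dvd (by norm_num) this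
      omega
    · exact hne (e.trans e'.symm)

end KPoly

theorem subset_of_inter_frontier {P T : Set E2} (hP : IsOpen P) (hT : IsPreconnected T)
    (hF : T ∩ frontier P = ∅) (hne : (T ∩ P).Nonempty) : T ⊆ P := by
  refine hT.subset_left_of_subset_union hP isClosed_closure.isOpen_compl
    (disjoint_compl_right.mono_left subset_closure) (fun w hw => ?_) hne
  by_cases hwc : w ∈ closure P
  · left
    by_contra hwP
    have : w ∈ T ∩ frontier P := ⟨hw, by rw [hP.frontier_eq]; exact ⟨hwc, hwP⟩⟩
    rwa [hF] at this
  · exact Or.inr hwc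

/-- A domain `P` inscribed in the convex polygon `K` with vertices `V`. -/
structure KInscribed {ι : Type*} (K : Set E2) (V : ℤ → E2) (P : Set E2) (x y : ι → ℤ) : Prop where
  isOpen : IsOpen P
  conn : IsConnected P
  subset : P ⊆ K
  bdry : frontier P ∩ Disk = (⋃ j, segment ℝ (V (x j)) (V (y j))) ∩ Disk

namespace KInscribed
variable {ι : Type*} {N : ℤ} {K : Set E2} {V : ℤ → E2} {P : Set E2} {x y : ι → ℤ}

theorem openSegment_subset_frontier (Q : KInscribed K V P x y) (h : KPoly N K V) {a b : ℤ}
    (hab : V a ≠ V b) (j : ι) (hj : openSegment ℝ (V a) (V b) ⊆ segment ℝ (V (x j)) (V (y j))) :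
    openSegment ℝ (V a) (V b) ⊆ frontier P := fun z hz => by
  have : z ∈ frontier P ∩ Disk := by
    rw [Q.bdry]
    exact ⟨mem_iUnion.2 ⟨j, hj hz⟩, openSegment_subset_disk (h.norm_le _) (h.norm_le _) hab hz⟩
  exact this.1

theorem edge_subset_frontier (Q : KInscribed K V P x y) (h : KPoly N K V) {n : ℤ} {z : E2}
    (hz : z ∈ openSegment ℝ (V n) (V (n + 1))) (hzF : z ∈ frontier P) :
    openSegment ℝ (V n) (V (n + 1)) ⊆ frontier P := by
  have : z ∈ frontier P ∩ Disk := ⟨hzF, h.openEdge_subset_disk n hz⟩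
  rw [Q.bdry] at this
  obtain ⟨j, hj⟩ := mem_iUnion.1 this.1
  exact Q.openSegment_subset_frontier h (h.ne_succ n) j
    ((openSegment_subset_segment ℝ _ _).trans (h.edge_subset_segment hz hj))

/-- If all boundary segments at the ideal vertex `V n` lie along the edge from `V n` to `V (n + 1)`,
then the other edge at `V n` is also part of the boundary. -/
theorem prev_edge_subset [Finite ι] (Q : KInscribed K V P x y) (h : KPoly N K V) {n : ℤ}
    (hn : Even n) (hF : openSegment ℝ (V n) (V (n + 1)) ⊆ frontier P)
    (hcol : ∀ j, V n ∈ segment ℝ (V (x j)) (V (y j)) → ∀ w ∈ segment ℝ (V (x j)) (V (y j)),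
      cr (V (n + 1) - V n) (w - V n) = 0) :
    openSegment ℝ (V (n - 1)) (V n) ⊆ frontier P := by
  set e := V (n + 1) - V n with he
  set g := V (n - 1) - V n with hg
  have hc0 : cr e g ≠ 0 := h.ncol n hn
  set T : ℝ → Set E2 := fun s =>
    (fun q : ℝ × ℝ => V n + q.1 • e + q.2 • g) '' {q | 0 < q.1 ∧ 0 < q.2 ∧ q.1 + q.2 < s} with hT
  have hTK : ∀ s ≤ 1, T s ⊆ K := by
    rintro s hs _ ⟨q, ⟨h1, h2, h3⟩, rfl⟩
    exact triangle_mem h.isOpen h.convex (h.mem_closure n)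
      (by simpa [e] using h.mem_closure (n + 1)) (by simpa [g] using h.mem_closure (n - 1))
      h1 h2 (by linarith) hc0
  have hseg : ∀ j, ∀ᶠ s in 𝓝[>] (0:ℝ), Disjoint (T s) (segment ℝ (V (x j)) (V (y j))) := by
    intro j
    by_cases hj : V n ∈ segment ℝ (V (x j)) (V (y j))
    · refine Eventually.of_forall fun s => ?_
      rw [Set.disjoint_left]
      rintro _ ⟨q, ⟨h1, h2, h3⟩, rfl⟩ hw
      have := hcol j hj _ hw
      rw [show V n + q.1 • e + q.2 • g - V n = q.1 • e + q.2 • g by abel, cr_add_right,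
        cr_smul_right, cr_smul_right, cr_self, mul_zero, zero_add] at this
      exact (mul_ne_zero h2.ne' hc0) this
    · obtain ⟨ρ, hρ, hball⟩ := Metric.isOpen_iff.1 (isClosed_segment _ _).isOpen_compl _ hj
      have hev : ∀ᶠ s in 𝓝[>] (0:ℝ), s * (‖e‖ + ‖g‖) < ρ := by
        have : Tendsto (fun s : ℝ => s * (‖e‖ + ‖g‖)) (𝓝[>] 0) (𝓝 (0 * (‖e‖ + ‖g‖))) :=
          ((continuous_id.mul continuous_const).tendsto 0).mono_left nhdsWithin_le_nhds
        rw [zero_mul] at this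
        exact this.eventually_lt_const hρ
      filter_upwards [hev] with s hs
      rw [Set.disjoint_left]
      rintro _ ⟨q, ⟨h1, h2, h3⟩, rfl⟩ hw
      refine hball ?_ hw
      rw [Metric.mem_ball, dist_eq_norm,
        show V n + q.1 • e + q.2 • g - V n = q.1 • e + q.2 • g by abel]
      refine lt_of_le_of_lt (norm_add_le _ _) (lt_of_le_of_lt ?_ hs)
      rw [norm_smul, norm_smul, Real.norm_of_nonneg h1.le, Real.norm_of_nonneg h2.le]
      nlinarith [norm_nonneg e, norm_nonneg g]
  have hIoo : ∀ᶠ s in 𝓝[>] (0:ℝ), s ∈ Ioo (0:ℝ) 1 := Ioo_mem_nhdsGT one_pos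
  obtain ⟨s, hs, hs0, hs1⟩ := ((eventually_all.2 hseg).and hIoo).exists
  have hTF : T s ∩ frontier P = ∅ := by
    rw [← Set.disjoint_iff_inter_eq_empty, Set.disjoint_left]
    intro w hw hwF
    have : w ∈ frontier P ∩ Disk := ⟨hwF, h.subset (hTK s hs1.le hw)⟩
    rw [Q.bdry] at this
    obtain ⟨j, hj⟩ := mem_iUnion.1 this.1
    exact Set.disjoint_left.1 (hs j) hw hj
  have hTpre : IsPreconnected (T s) := by
    refine IsPreconnected.image (Convex.isPreconnected ?_) _ (by fun_prop)
    intro q hq r hr a b ha hb hab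
    obtain ⟨q1, q2, q3⟩ := hq
    obtain ⟨r1, r2, r3⟩ := hr
    simp only [mem_ofPred_eq, Prod.fst_add, Prod.snd_add, Prod.smul_fst, Prod.smul_snd, smul_eq_mul]
    rcases ha.eq_or_lt with rfl | ha
    · obtain rfl : b = 1 := by linarith
      simpa using ⟨r1, r2, r3⟩
    · refine ⟨by positivity, by positivity, ?_⟩
      have e1 : a * (q.1 + q.2) < a * s := by gcongr
      have e2 : b * (r.1 + r.2) ≤ b * s := by gcongr
      have e3 : a * s + b * s = s := by rw [← add_mul, hab, one_mul]
      linarith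
  have hne : (T s ∩ P).Nonempty := by
    set A : E2 → ℝ := fun w => (cr e g)⁻¹ * -cr g (w - V n)
    set B : E2 → ℝ := fun w => (cr e g)⁻¹ * cr e (w - V n)
    have hA : Continuous A := continuous_const.mul (continuous_cr g (V n)).neg
    have hB : Continuous B := continuous_const.mul (continuous_cr e (V n))
    have hdec : ∀ w, w = V n + A w • e + B w • g := by
      intro w
      have h1 := cr_decomp e g (w - V n)
      rw [cr_swap (w - V n) g] at h1
      have h2 : w - V n = (cr e g)⁻¹ • (cr e g • (w - V n)) := by
        rw [smul_smul, inv_mul_cancel₀ hc0, one_smul]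
      rw [h1, smul_add, smul_smul, smul_smul] at h2
      rw [add_assoc, ← h2]; abel
    have hz : V n + (s / 2) • e ∈ frontier P := by
      apply hF
      rw [openSegment_eq_image']
      exact ⟨s / 2, ⟨by linarith, by linarith⟩, rfl⟩
    have hAz : A (V n + (s / 2) • e) = s / 2 := by
      simp only [A]
      rw [add_sub_cancel_left, cr_smul_right, cr_swap g e]
      field_simp
    have hBz : B (V n + (s / 2) • e) = 0 := by
      simp only [B]
      rw [add_sub_cancel_left, cr_smul_right, cr_self]; simp
    have hU : IsOpen {w | 0 < A w ∧ A w + B w < s} :=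
      (isOpen_lt continuous_const hA).inter (isOpen_lt (hA.add hB) continuous_const)
    obtain ⟨w, ⟨hw1, hw2⟩, hwP⟩ := mem_closure_iff.1 (frontier_subset_closure hz) _ hU
      (by simp only [mem_ofPred_eq, hAz, hBz]; exact ⟨by linarith, by linarith⟩)
    refine ⟨w, ⟨(A w, B w), ⟨hw1, ?_, hw2⟩, (hdec w).symm⟩, hwP⟩
    obtain ⟨σ, -, hσ⟩ := h.orient_edge n
    have h1 : 0 < σ * cr e (w - V n) := hσ w (Q.subset hwP)
    have h2 : 0 ≤ σ * cr e g := KPoly.orient_nonneg hσ (h.mem_closure (n - 1))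
    have h3 : 0 < σ * cr e g := by
      refine h2.lt_of_ne fun h0 => ?_
      exact (mul_ne_zero (left_ne_zero_of_mul h1.ne') hc0) h0.symm
    have h4 : σ * cr e (w - V n) = (σ * cr e g) * B w := by
      simp only [B]; field_simp
    rw [h4] at h1
    exact pos_of_mul_pos_right h1 h3.le
  have hTP : T s ⊆ P := subset_of_inter_frontier Q.isOpen hTpre hTF hne
  have hz : V n + (s / 2) • g ∈ openSegment ℝ (V (n - 1)) (V (n - 1 + 1)) := by
    rw [sub_add_cancel, openSegment_symm, openSegment_eq_image']
    exact ⟨s / 2, ⟨by linarith, by linarith⟩, rfl⟩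
  have hzcl : V n + (s / 2) • g ∈ closure P := by
    have ht : Tendsto (fun ε : ℝ => V n + ε • e + (s / 2) • g) (𝓝[>] 0)
        (𝓝 (V n + (0:ℝ) • e + (s / 2) • g)) := by
      have : Continuous fun ε : ℝ => V n + ε • e + (s / 2) • g := by fun_prop
      exact (this.tendsto 0).mono_left nhdsWithin_le_nhds
    rw [zero_smul, add_zero] at ht
    refine mem_closure_of_tendsto ht ?_
    filter_upwards [self_mem_nhdsWithin,
      mem_nhdsWithin_of_mem_nhds (Iio_mem_nhds (half_pos hs0))] with ε h1 h2
    rw [mem_Ioi] at h1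
    rw [mem_Iio] at h2
    exact hTP ⟨(ε, s / 2), ⟨h1, by simp only; linarith, by simp only; linarith⟩, rfl⟩
  have hzF : V n + (s / 2) • g ∈ frontier P := by
    rw [Q.isOpen.frontier_eq]
    exact ⟨hzcl, fun hzP => h.notMem_of_frontier (h.openEdge_subset (n - 1) hz) (Q.subset hzP)⟩
  have := Q.edge_subset_frontier h hz hzF
  rwa [sub_add_cancel] at this

/-- The boundary of an inscribed domain leaves an ideal vertex twice. -/
theorem exists_second_segment [Finite ι] (Q : KInscribed K V P x y) (h : KPoly N K V) {n : ℤ}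
    (hn : Even n) (hF : openSegment ℝ (V n) (V (n + 1)) ⊆ frontier P) :
    ∃ b, openSegment ℝ (V n) (V b) ⊆ frontier P ∧
      (b = n - 1 ∨ (V n ≠ V b ∧ openSegment ℝ (V n) (V b) ⊆ K)) := by
  have hprev : V n ≠ V (n - 1) := by
    have := h.ne_succ (n - 1)
    rw [sub_add_cancel] at this
    exact this.symm
  by_cases hcol : ∀ j, V n ∈ segment ℝ (V (x j)) (V (y j)) →
      ∀ w ∈ segment ℝ (V (x j)) (V (y j)), cr (V (n + 1) - V n) (w - V n) = 0
  · refine ⟨n - 1, ?_, Or.inl rfl⟩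
    rw [openSegment_symm]
    exact Q.prev_edge_subset h hn hF hcol
  push Not at hcol
  obtain ⟨j, hj, w, hw, hw0⟩ := hcol
  obtain ⟨c, hc, hc0⟩ : ∃ c, segment ℝ (V (x j)) (V (y j)) = segment ℝ (V n) (V c) ∧
      cr (V (n + 1) - V n) (V c - V n) ≠ 0 := by
    have hcr : ∀ c, w ∈ segment ℝ (V n) (V c) → cr (V (n + 1) - V n) (V c - V n) ≠ 0 := by
      intro c hwc h0
      rw [segment_eq_image_lineMap] at hwc
      obtain ⟨τ, -, rfl⟩ := hwc
      rw [cr_lineMap, sub_self, cr_zero_right, h0] at hw0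
      exact hw0 (by ring)
    have hends : V n = V (x j) ∨ V n = V (y j) := by
      by_contra! hcon
      have hmem := mem_openSegment_of_ne_left_right hcon.1.symm hcon.2.symm hj
      have hxy : V (x j) ≠ V (y j) := by
        intro e
        rw [e, segment_same] at hj
        exact hcon.2 hj
      have := mem_disk.1 (openSegment_subset_disk (h.norm_le _) (h.norm_le _) hxy hmem)
      rw [h.even n hn] at this
      exact lt_irrefl _ this
    rcases hends with e | e
    · exact ⟨y j, by rw [e], hcr _ (by rwa [e])⟩
    · have e' : segment ℝ (V (x j)) (V (y j)) = segment ℝ (V n) (V (x j)) := by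
        rw [segment_symm, e]
      exact ⟨x j, e', hcr _ (by rwa [← e'])⟩
  by_cases hg : cr (V (n - 1) - V n) (V c - V n) = 0
  · refine ⟨n - 1, Q.openSegment_subset_frontier h hprev j ?_, Or.inl rfl⟩
    rw [hc]
    rcases h.on_edge_line_rev hn hg with e | e | ⟨e, e'⟩
    · rw [e, sub_self, cr_zero_right] at hc0; exact absurd rfl hc0
    · rw [e]; exact openSegment_subset_segment ℝ _ _
    · rw [e]
      exact (openSegment_subset_segment ℝ _ _).trans ((convex_segment _ _).segment_subset
        (left_mem_segment ℝ _ _) (openSegment_subset_segment ℝ _ _ e'))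
  · have hne : V n ≠ V c := fun e => by
      rw [e, sub_self, cr_zero_right] at hc0; exact hc0 rfl
    exact ⟨c, Q.openSegment_subset_frontier h hne j
      (hc ▸ openSegment_subset_segment ℝ _ _), Or.inr ⟨hne, h.openSegment_subset hn hc0 hg⟩⟩

/-- An inscribed domain lies on one side of every proper chord in its boundary. -/
theorem exists_side (Q : KInscribed K V P x y) (h : KPoly N K V) {a b : ℤ} (hab : V a ≠ V b)
    (hK : openSegment ℝ (V a) (V b) ⊆ K) (hF : openSegment ℝ (V a) (V b) ⊆ frontier P) :
    ∃ σ : ℝ, (σ = 1 ∨ σ = -1) ∧ ∀ w ∈ closure P, 0 ≤ σ * cr (V b - V a) (w - V a) := by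
  have hcont := continuous_cr (V b - V a) (V a)
  have h0 : ∀ w ∈ P, cr (V b - V a) (w - V a) ≠ 0 := by
    intro w hw h0
    have hwK := Q.subset hw
    have h1 := h.chord_line hab hK (subset_closure hwK) h0
    rw [← insert_endpoints_openSegment] at h1
    rcases h1 with h1 | h1 | h1
    · exact h.notMem a (h1 ▸ hwK)
    · exact h.notMem b (h1 ▸ hwK)
    · have := hF h1
      rw [Q.isOpen.frontier_eq] at this
      exact this.2 hw
  obtain ⟨w₀, hw₀⟩ := Q.conn.nonempty
  have hsame : ∀ u ∈ P, ∀ v ∈ P, cr (V b - V a) (u - V a) < 0 →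
      0 < cr (V b - V a) (v - V a) → False := by
    intro u hu v hv h1 h2
    obtain ⟨w, hw, hw0⟩ := Q.conn.isPreconnected.intermediate_value hu hv hcont.continuousOn
      (⟨h1.le, h2.le⟩ : (0:ℝ) ∈ Icc _ _)
    exact h0 w hw hw0
  rcases lt_or_gt_of_ne (h0 w₀ hw₀) with h1 | h1
  · refine ⟨-1, Or.inr rfl, fun w hw => le_of_mem_closure (K := P)
      (f := fun w => -1 * cr (V b - V a) (w - V a)) (continuous_const.mul hcont) (fun v hv => ?_) hw⟩
    by_contra hc
    exact hsame _ hw₀ v hv h1 (by linarith)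
  · refine ⟨1, Or.inl rfl, fun w hw => le_of_mem_closure (K := P)
      (f := fun w => 1 * cr (V b - V a) (w - V a)) (continuous_const.mul hcont) (fun v hv => ?_) hw⟩
    by_contra hc
    exact hsame v hv _ hw₀ (by linarith) h1

theorem left_mem_closure {a b : ℤ} (hF : openSegment ℝ (V a) (V b) ⊆ frontier P) :
    V a ∈ closure P :=
  closure_minimal (hF.trans frontier_subset_closure) isClosed_closure
    (segment_subset_closure_openSegment (left_mem_segment ℝ _ _))

theorem right_mem_closure {a b : ℤ} (hF : openSegment ℝ (V a) (V b) ⊆ frontier P) :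
    V b ∈ closure P :=
  closure_minimal (hF.trans frontier_subset_closure) isClosed_closure
    (segment_subset_closure_openSegment (right_mem_segment ℝ _ _))

/-- The neighbours following two vertices joined by a chord cannot both lie in the closure. -/
theorem not_both_next (Q : KInscribed K V P x y) (h : KPoly N K V) {n m : ℤ} (hnm : V n ≠ V m)
    (hK : openSegment ℝ (V n) (V m) ⊆ K) (hF : openSegment ℝ (V n) (V m) ⊆ frontier P)
    (hn : V (n + 1) ∈ closure P) (hm : V (m + 1) ∈ closure P) : False := by
  have hN := h.four_le
  obtain ⟨ε, hε⟩ := h.exists_orient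
  set m' := n + (m - n) % N with hm'
  have hdvd : N ∣ m - m' := by
    refine ⟨(m - n) / N, ?_⟩
    have := Int.mul_ediv_add_emod (m - n) N
    omega
  have e0 : V m' = V m := h.eq_of_dvd hdvd
  have e1 : V (m' + 1) = V (m + 1) := h.eq_of_dvd (by simpa using hdvd)
  have hge := Int.emod_nonneg (m - n) (by omega : N ≠ 0)
  have hlt := Int.emod_lt_of_pos (m - n) (by omega : 0 < N)
  have hne : m' ≠ n := fun e => hnm (by rw [← e0, e])
  rw [← e0] at hK hF hnm
  rw [← e1] at hm
  have h1 := h.chord_add_two_le (by omega : n < m') hK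
  have h2 := h.chord_add_two_le (a := m') (b := n + N) (by omega)
    (by rw [h.per, openSegment_symm]; exact hK)
  have c1 := h.chord_neg hε (by omega) hK (n := n + 1) (by omega) (by omega)
  have c2 := h.chord_pos hε (by omega : n < m') hK (n := m' + 1) (by omega) (by omega)
  obtain ⟨σ, hσ1, hσ⟩ := Q.exists_side h hnm hK hF
  have s1 := hσ _ hn
  have s2 := hσ _ hm
  rcases hσ1 with rfl | rfl <;>
    rcases lt_trichotomy ε 0 with hε | hε | hε <;> nlinarith

theorem disjoint_chords (Q : KInscribed K V P x y) (h : KPoly N K V) {n m b c : ℤ}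
    (hnm : V n ≠ V m) (hnb : V n ≠ V b)
    (hnK : openSegment ℝ (V n) (V b) ⊆ K) (hnF : openSegment ℝ (V n) (V b) ⊆ frontier P)
    (hmF : openSegment ℝ (V m) (V c) ⊆ frontier P)
    (hn : V (n + 1) ∈ closure P) (hm : V (m + 1) ∈ closure P) :
    Disjoint (openSegment ℝ (V n) (V b)) (openSegment ℝ (V m) (V c)) := by
  rw [Set.disjoint_left]
  intro z hz hz'
  obtain ⟨σ, hσ1, hσ⟩ := Q.exists_side h hnb hnK hnF
  have hσ0 : σ ≠ 0 := by rcases hσ1 with rfl | rfl <;> norm_num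
  have s1 := hσ _ (left_mem_closure hmF)
  have s2 := hσ _ (right_mem_closure hmF)
  rw [openSegment_eq_lineMap] at hz hz'
  obtain ⟨τ, hτ, rfl⟩ := hz
  obtain ⟨θ, hθ, hzθ⟩ := hz'
  have h0 : (1 - θ) * (σ * cr (V b - V n) (V m - V n)) +
      θ * (σ * cr (V b - V n) (V c - V n)) = 0 := by
    have := cr_lineMap (V b - V n) (V n) (V m) (V c) θ
    rw [hzθ, cr_lineMap_self] at this
    linear_combination -σ * this
  have hm0 : cr (V b - V n) (V m - V n) = 0 := by
    have : σ * cr (V b - V n) (V m - V n) = 0 := by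
      nlinarith [hθ.1, hθ.2, mul_nonneg hθ.1.le s2]
    exact (mul_eq_zero.1 this).resolve_left hσ0
  rcases h.chord_line_notMem hnb hnK (h.mem_closure m) (h.notMem m) hm0 with e | e
  · exact hnm e.symm
  rw [← e] at hnK hnF
  exact Q.not_both_next h hnm hnK hnF hn hm

theorem exists_chord (Q : KInscribed K V P x y) (h : KPoly N K V) (hne : P ≠ K) :
    ∃ j, V (x j) ≠ V (y j) ∧ openSegment ℝ (V (x j)) (V (y j)) ⊆ K ∧
      openSegment ℝ (V (x j)) (V (y j)) ⊆ frontier P := by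
  obtain ⟨z, hzK, hzF⟩ : (K ∩ frontier P).Nonempty := by
    by_contra hc
    obtain ⟨w, hw⟩ := Q.conn.nonempty
    exact hne (Q.subset.antisymm (subset_of_inter_frontier Q.isOpen h.convex.isPreconnected
      (Set.not_nonempty_iff_eq_empty.1 hc) ⟨w, Q.subset hw, hw⟩))
  have : z ∈ frontier P ∩ Disk := ⟨hzF, h.subset hzK⟩
  rw [Q.bdry] at this
  obtain ⟨j, hj⟩ := mem_iUnion.1 this.1
  have hxy : V (x j) ≠ V (y j) := fun e => by
    rw [e, segment_same] at hj
    exact h.notMem (y j) (mem_singleton_iff.1 hj ▸ hzK)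
  have hzo := mem_openSegment_of_ne_left_right (fun e => h.notMem (x j) (by rw [e]; exact hzK))
    (fun e => h.notMem (y j) (by rw [e]; exact hzK)) hj
  exact ⟨j, hxy, openSegment_subset_of_inter h.isOpen h.convex (h.mem_closure _)
    (h.mem_closure _) hzo hzK,
    Q.openSegment_subset_frontier h hxy j (openSegment_subset_segment ℝ _ _)⟩

end KInscribed

/-! ### Thin horocycles -/

namespace Horocycle

/-- The horocycle at an ideal point with a prescribed level. -/
def ofLevel (q : E2) (hq : ‖q‖ = 1) (L : ℝ) : Horocycle where
  pt := q
  r := 1 / (1 + Real.exp L)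
  hpt := hq
  hr0 := by positivity
  hr1 := by
    have := Real.exp_pos L
    rw [div_lt_one (by positivity)]
    linarith

theorem lev_ofLevel (q : E2) (hq : ‖q‖ = 1) (L : ℝ) : (ofLevel q hq L).lev = -L := by
  have h := Real.exp_pos L
  have e : (1 / (1 + Real.exp L)) / (1 - 1 / (1 + Real.exp L)) = Real.exp (-L) := by
    rw [Real.exp_neg]
    field_simp
    ring
  rw [lev, ofLevel, e, Real.log_exp]

theorem ht_ofLevel (q : E2) (hq : ‖q‖ = 1) (L : ℝ) (p : E2) :
    (ofLevel q hq L).ht p = Real.log (busW q p) + L := by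
  rw [ht, lev_ofLevel, sub_neg_eq_add]; rfl

theorem gap_ofLevel (q q' : E2) (hq : ‖q‖ = 1) (hq' : ‖q'‖ = 1) (L : ℝ) :
    (ofLevel q hq L).gap (ofLevel q' hq' L) = Real.log (‖q - q'‖ ^ 2 / 4) + 2 * L := by
  rw [gap, lev_ofLevel, lev_ofLevel]
  change Real.log (‖q - q'‖ ^ 2 / 4) - -L - -L = _
  ring

/-- Horocycles with a positive gap are disjoint. -/
theorem disjoint_circle_of_gap_pos (H H' : Horocycle) (hne : H.pt ≠ H'.pt) (h : 0 < H.gap H') :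
    Disjoint H.circle H'.circle := by
  rw [Set.disjoint_left]
  intro x hx hx'
  by_cases hD : x ∈ Disk
  · have h1 := gap_le_ht_add_ht H H' hne hD
    rw [(H.ht_eq_zero_iff hD).2 hx, (H'.ht_eq_zero_iff hD).2 hx'] at h1
    linarith
  · have key : ∀ H : Horocycle, x ∈ H.circle → x = H.pt := by
      intro H hx
      have h1 := H.sub_sq_formula x
      have hx : ‖x - (1 - H.r) • H.pt‖ = H.r := hx
      rw [hx, sub_self] at h1
      have h2 : 1 ≤ ‖x‖ := not_lt.1 fun hc => hD (mem_disk.2 hc)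
      have h3 : 0 < (1 - H.r) := by linarith [H.hr1]
      have h4 : 0 ≤ H.r * (‖x‖ ^ 2 - 1) := mul_nonneg H.hr0.le (by nlinarith)
      have h5 : (1 - H.r) * ‖x - H.pt‖ ^ 2 ≤ 0 := by linarith
      have h6 : ‖x - H.pt‖ ^ 2 ≤ 0 := nonpos_of_mul_nonpos_right h5 h3
      have h7 : ‖x - H.pt‖ = 0 := by nlinarith [norm_nonneg (x - H.pt)]
      exact sub_eq_zero.1 (norm_eq_zero.1 h7)
    exact hne ((key H hx).symm.trans (key H' hx'))

theorem pt_mem_circle (H : Horocycle) : H.pt ∈ H.circle := by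
  change ‖H.pt - (1 - H.r) • H.pt‖ = H.r
  rw [show H.pt - (1 - H.r) • H.pt = H.r • H.pt by module, norm_smul, H.hpt, mul_one,
    Real.norm_of_nonneg H.hr0.le]

theorem norm_le_one_of_mem_circle (H : Horocycle) {x : E2} (hx : x ∈ H.circle) : ‖x‖ ≤ 1 := by
  have hx : ‖x - (1 - H.r) • H.pt‖ = H.r := hx
  have h := norm_add_le (x - (1 - H.r) • H.pt) ((1 - H.r) • H.pt)
  rw [sub_add_cancel, hx, norm_smul, H.hpt, Real.norm_of_nonneg (by linarith [H.hr1])] at h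
  linarith

end Horocycle

theorem arcosh_nonneg_of_one_le {x : ℝ} (hx : 1 ≤ x) : 0 ≤ arcosh x :=
  Real.log_nonneg (by linarith [Real.sqrt_nonneg (x ^ 2 - 1)])

theorem hDistSet_circle {a : E2} (ha : a ∈ Disk) (H : Horocycle) : hDistSet a H.circle = 0 := by
  refine IsLeast.csInf_eq ⟨⟨H.pt, H.pt_mem_circle, ?_⟩, ?_⟩
  · simp [hDist, H.hpt, arcosh]
  · rintro _ ⟨x, hx, rfl⟩
    have h1 : 0 ≤ 1 - ‖a‖ ^ 2 := by nlinarith [mem_disk.1 ha, norm_nonneg a]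
    have h2 : 0 ≤ 1 - ‖x‖ ^ 2 := by
      nlinarith [H.norm_le_one_of_mem_circle hx, norm_nonneg x]
    exact arcosh_nonneg_of_one_le (le_add_of_nonneg_right (by positivity))

section trunc
variable {k : ℕ} [NeZero k] (H : ZMod k → Horocycle)

theorem trunc_ideal_inter_eq (hne : ∀ m n, m ≠ n → (H m).pt ≠ (H n).pt) {m : ZMod k} {u : E2}
    (hu : u ∈ Disk) (h0 : 0 ≤ (H m).ht u) (hg : ∀ n, m ≠ n → (H m).ht u ≤ (H m).gap (H n)) :
    trunc H (H m).pt u = ENNReal.ofReal ((H m).ht u) := by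
  refine le_antisymm ?_ ?_
  · refine (trunc_ideal_inter_le H m m hu).trans_eq ?_
    rw [max_eq_right (by linarith), sub_zero]
  obtain ⟨q, hq, hqne, t₀, e, harc, hht⟩ := exists_ray (H m) hu
  rw [trunc, harc, hypMeas_image_geo_diff H hq (H m).hpt hqne measurableSet_Ici]
  rw [show (H m).ht u = (t₀ + (H m).ht u) - t₀ by ring, ← Real.volume_Icc]
  refine measure_mono fun t ht => ⟨ht.1, fun i => ?_⟩
  have h1 := hht t
  by_cases hi : m = i
  · subst hi
    linarith [ht.2]
  · have h2 := gap_le_ht_add_ht (H m) (H i) (hne _ _ hi) (geo_mem_disk hq (H m).hpt hqne t)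
    linarith [hg i hi, ht.1]

theorem gap_le_trunc (hne : ∀ m n, m ≠ n → (H m).pt ≠ (H n).pt) {m n : ZMod k} (hmn : m ≠ n)
    (hm : ∀ p, p ≠ m → p ≠ n → (H m).gap (H n) / 2 ≤ (H p).gap (H m))
    (hn : ∀ p, p ≠ m → p ≠ n → (H m).gap (H n) / 2 ≤ (H p).gap (H n)) :
    ENNReal.ofReal ((H m).gap (H n)) ≤ trunc H (H m).pt (H n).pt := by
  have hmn' := hne m n hmn
  have hc : 0 < ‖(H m).pt - (H n).pt‖ := norm_pos_iff.2 (sub_ne_zero.2 hmn')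
  rw [trunc, geodArc_ideal_ideal (H m).hpt (H n).hpt hmn', ← image_univ,
    hypMeas_image_geo_diff H (H m).hpt (H n).hpt hmn' MeasurableSet.univ]
  set l := Real.log (‖(H m).pt - (H n).pt‖ / 2) with hl
  have hg : (H m).gap (H n) = (l - (H n).lev) - ((H m).lev - l) := by
    have : Real.log (‖(H m).pt - (H n).pt‖ ^ 2 / 4) = 2 * l := by
      rw [hl, ← Real.log_rpow (by positivity)]
      congr 1; rw [Real.rpow_two]; ring
    rw [Horocycle.gap, this]; ring
  rw [hg, ← Real.volume_Icc]
  refine measure_mono fun t ht => ⟨mem_univ _, fun i => ?_⟩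
  have e1 := ht_geo_left (H m) (H n).hpt hmn' t
  have e2 := ht_geo_right (H n) (H m).hpt hmn' t
  rw [← hl] at e1 e2
  by_cases him : i = m
  · subst him; linarith [ht.1]
  by_cases hin : i = n
  · subst hin; linarith [ht.2]
  have hx := geo_mem_disk (H m).hpt (H n).hpt hmn' t
  have h1 := gap_le_ht_add_ht (H i) (H m) (hne _ _ him) hx
  have h2 := gap_le_ht_add_ht (H i) (H n) (hne _ _ hin) hx
  linarith [hm i him hin, hn i him hin]

theorem exists_trunc_pos {u v : E2} (hu : u ∈ Disk) (hv : v ∈ Disk) (huv : u ≠ v) :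
    ∃ δ : ℝ, ∀ H : ZMod k → Horocycle, (∀ i, δ ≤ (H i).ht u) → 0 < trunc H u v := by
  obtain ⟨n₁, n₂, h₁, h₂, hne, a, b, hab, ea, -, harc⟩ := geodArc_seg hu hv huv
  refine ⟨b - a, fun H hH => ?_⟩
  rw [trunc, harc, hypMeas_image_geo_diff H h₁ h₂ hne measurableSet_Icc]
  refine lt_of_lt_of_le ?_ (measure_mono (s := Icc a b) fun t ht => ⟨ht, fun i => ?_⟩)
  · rw [Real.volume_Icc]
    exact ENNReal.ofReal_pos.2 (by linarith)
  · have h := ht_geo_lipschitz (H i) h₁ h₂ hne a t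
    rw [ea, abs_sub_comm a t, abs_of_nonneg (sub_nonneg.2 ht.1)] at h
    linarith [(abs_le.1 h).2, hH i, ht.2]

end trunc

/-- Horocycles so small that every edge, diagonal or chord is long. -/
structure IsThin {k : ℕ} (D : SemiIdealDomain k) (H : ZMod k → Horocycle) : Prop where
  pt : ∀ i, (H i).pt = D.pI i
  ht_pos : ∀ i j, 0 < (H i).ht (D.pB j)
  ht_lt_gap : ∀ i m j, i ≠ m → (H i).ht (D.pB j) < (H i).gap (H m)
  gap_le : ∀ m n p q, p ≠ q → (H m).gap (H n) / 2 ≤ (H p).gap (H q)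
  trunc_pos : ∀ i j, i ≠ j → 0 < trunc H (D.pB i) (D.pB j)
  ht_eq : ∀ i, (H i).ht (D.pB (i - 1)) = (H i).ht (D.pB i)
  ht_lt : ∀ i j, j ≠ i → j ≠ i - 1 → (H i).ht (D.pB i) < (H i).ht (D.pB j)

namespace IsThin
variable {k : ℕ} {D : SemiIdealDomain k} {H : ZMod k → Horocycle}

theorem pt_ne (T : IsThin D H) (m n : ZMod k) (h : m ≠ n) : (H m).pt ≠ (H n).pt := by
  rw [T.pt, T.pt]; exact D.injI.ne h

theorem gap_pos (T : IsThin D H) {m n : ZMod k} (h : m ≠ n) : 0 < (H m).gap (H n) :=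
  (T.ht_pos m 0).trans (T.ht_lt_gap m n 0 h)

theorem trunc_eq (T : IsThin D H) (i j : ZMod k) :
    trunc H (D.pI i) (D.pB j) = ENNReal.ofReal ((H i).ht (D.pB j)) := by
  have : NeZero k := ⟨D.k_pos.ne'⟩
  rw [← T.pt]
  exact trunc_ideal_inter_eq H T.pt_ne (D.inter j) (T.ht_pos i j).le
    fun n hn => (T.ht_lt_gap i n j hn).le

theorem lt_trunc (T : IsThin D H) {m n : ZMod k} (h : m ≠ n) (j : ZMod k) :
    ENNReal.ofReal ((H m).ht (D.pB j)) < trunc H (D.pI m) (D.pI n) := by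
  have : NeZero k := ⟨D.k_pos.ne'⟩
  rw [← T.pt, ← T.pt]
  refine lt_of_lt_of_le ?_ (gap_le_trunc H T.pt_ne h (fun p h1 _ => T.gap_le m n p m h1)
    (fun p _ h2 => T.gap_le m n p n h2))
  exact (ENNReal.ofReal_lt_ofReal_iff (T.gap_pos h)).2 (T.ht_lt_gap m n j h)

theorem rev (T : IsThin D H) : IsThin D.rev (fun i => H (-i)) where
  pt i := T.pt _
  ht_pos i j := T.ht_pos _ _
  ht_lt_gap i m j h := T.ht_lt_gap _ _ _ (neg_injective.ne h)
  gap_le m n p q h := T.gap_le _ _ _ _ (neg_injective.ne h)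
  trunc_pos i j h := by
    rw [SemiIdealDomain.trunc_neg]
    exact T.trunc_pos _ _ fun e => h (neg_injective (sub_left_injective e))
  ht_eq i := by
    change (H (-i)).ht (D.pB (-(i - 1) - 1)) = (H (-i)).ht (D.pB (-i - 1))
    rw [T.ht_eq (-i)]; congr 2; ring
  ht_lt i j h1 h2 := by
    change (H (-i)).ht (D.pB (-i - 1)) < (H (-i)).ht (D.pB (-j - 1))
    rw [T.ht_eq (-i)]
    exact T.ht_lt _ _ (fun e => h2 (by linear_combination -e)) fun e => h1 (by linear_combination -e)

end IsThin

theorem SemiIdealDomain.exists_isThin {k : ℕ} (D : SemiIdealDomain k) {Dh : ZMod k → Horocycle}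
    (hDh : ∀ i, (Dh i).pt = D.pI i ∧ D.pB (i - 1) ∈ (Dh i).circle ∧ D.pB i ∈ (Dh i).circle)
    (hout : ∀ i j, j ≠ i → j ≠ i - 1 → 0 < (Dh i).ht (D.pB j)) : ∃ H, IsThin D H := by
  have : NeZero k := ⟨D.k_pos.ne'⟩
  have hlarge : ∀ c a b : ℝ, 0 < a → ∀ᶠ L : ℝ in atTop, b < c + a * L := by
    intro c a b ha
    have : Tendsto (fun L : ℝ => c + a * L) atTop atTop :=
      tendsto_atTop_add_const_left _ _ (tendsto_id.const_mul_atTop ha)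
    exact this.eventually_gt_atTop b
  have htp : ∀ j j' : ZMod k, ∃ δ : ℝ, j ≠ j' → ∀ H : ZMod k → Horocycle,
      (∀ i, δ ≤ (H i).ht (D.pB j)) → 0 < trunc H (D.pB j) (D.pB j') := by
    intro j j'
    by_cases h : j = j'
    · exact ⟨0, fun h' => absurd h h'⟩
    · obtain ⟨δ, hδ⟩ := exists_trunc_pos (k := k) (D.inter j) (D.inter j') (D.injB.ne h)
      exact ⟨δ, fun _ => hδ⟩
  choose δ hδ using htp
  set w : ZMod k → ZMod k → ℝ := fun i j => Real.log (busW (D.pI i) (D.pB j)) with hw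
  set γ : ZMod k → ZMod k → ℝ := fun i j => Real.log (‖D.pI i - D.pI j‖ ^ 2 / 4) with hγ
  have e1 : ∀ᶠ L : ℝ in atTop, ∀ i j, 0 < w i j + 1 * L :=
    eventually_all.2 fun i => eventually_all.2 fun j => hlarge _ _ _ one_pos
  have e2 : ∀ᶠ L : ℝ in atTop, ∀ i m j, w i j - γ i m < 0 + 1 * L :=
    eventually_all.2 fun i => eventually_all.2 fun m => eventually_all.2 fun j =>
      hlarge _ _ _ one_pos
  have e3 : ∀ᶠ L : ℝ in atTop, ∀ m n p q, γ m n / 2 - γ p q < 0 + 1 * L :=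
    eventually_all.2 fun m => eventually_all.2 fun n => eventually_all.2 fun p =>
      eventually_all.2 fun q => hlarge _ _ _ one_pos
  have e4 : ∀ᶠ L : ℝ in atTop, ∀ i j j', δ j j' < w i j + 1 * L :=
    eventually_all.2 fun i => eventually_all.2 fun j => eventually_all.2 fun j' =>
      hlarge _ _ _ one_pos
  obtain ⟨L, h1, h2, h3, h4⟩ := (e1.and (e2.and (e3.and e4))).exists
  set H : ZMod k → Horocycle := fun i => .ofLevel (D.pI i) (D.ideal i) L with hH
  have hht : ∀ i j, (H i).ht (D.pB j) = w i j + L := fun i j => Horocycle.ht_ofLevel _ _ _ _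
  have hgap : ∀ i j, (H i).gap (H j) = γ i j + 2 * L := fun i j => Horocycle.gap_ofLevel _ _ _ _ _
  have hDht : ∀ i j, (H i).ht (D.pB j) = (Dh i).ht (D.pB j) + (Dh i).lev + L := by
    intro i j
    rw [hht, Horocycle.ht, (hDh i).1]; ring
  have z1 : ∀ i, (Dh i).ht (D.pB i) = 0 := fun i =>
    ((Dh i).ht_eq_zero_iff (D.inter _)).2 (hDh i).2.2
  have z2 : ∀ i, (Dh i).ht (D.pB (i - 1)) = 0 := fun i =>
    ((Dh i).ht_eq_zero_iff (D.inter _)).2 (hDh i).2.1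
  refine ⟨H, fun i => rfl, fun i j => ?_, fun i m j _ => ?_, fun m n p q _ => ?_,
    fun i j h => hδ i j h H fun l => ?_, fun i => ?_, fun i j h h' => ?_⟩
  · rw [hht]; linarith [h1 i j]
  · rw [hht, hgap]; linarith [h2 i m j]
  · rw [hgap, hgap]; linarith [h3 m n p q]
  · rw [hht]; linarith [h4 l i j]
  · rw [hDht, hDht, z1, z2]
  · rw [hDht, hDht, z1]; linarith [hout i j h h']

/-! ### The boundary measure of an inscribed domain -/

theorem toKlein_mem_frontier_kl (P : Set E2) {p : E2} (hp : p ∈ Disk) :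
    toKlein p ∈ frontier (kl P) ↔ p ∈ frontier P := by
  rw [← toKlein_mem_kl hp, ← frontier_kl, mem_inter_iff, and_iff_left (toKlein_mem_disk hp)]

theorem measurableSet_openSegment (u v : E2) : MeasurableSet (openSegment ℝ u v) := by
  by_cases huv : u = v
  · rw [huv, openSegment_same]; exact measurableSet_singleton v
  · have h : openSegment ℝ u v = segment ℝ u v \ {u, v} := by
      ext z
      refine ⟨fun hz => ⟨openSegment_subset_segment ℝ _ _ hz, ?_⟩, fun hz => ?_⟩
      · rintro (rfl | rfl)
        · exact huv (left_mem_openSegment_iff.1 hz)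
        · exact huv (right_mem_openSegment_iff.1 hz)
      · exact mem_openSegment_of_ne_left_right (fun e => hz.2 (Or.inl e.symm))
          (fun e => hz.2 (Or.inr e.symm)) hz.1
    rw [h]
    exact (isClosed_segment u v).measurableSet.diff (toFinite _).measurableSet

/-- The length measure of the truncated boundary, in the Klein model. -/
def flux {k : ℕ} (Q : PolygonalDomain) (H : ZMod k → Horocycle) : Measure E2 :=
  (hypMeas.restrict (GammaSet Q H)).map toKlein

section flux
variable {k : ℕ} {D : SemiIdealDomain k} (Q : PolygonalDomain) (H : ZMod k → Horocycle)

theorem flux_apply {S : Set E2} (hS : MeasurableSet S) :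
    flux Q H S = hypMeas (toKlein ⁻¹' S ∩ GammaSet Q H) := by
  have hm := continuous_toKlein.measurable hS
  rw [flux, Measure.map_apply continuous_toKlein.measurable hS, Measure.restrict_apply hm]

theorem flux_univ : flux Q H univ = hypMeas (GammaSet Q H) := by
  rw [flux_apply Q H MeasurableSet.univ, preimage_univ, univ_inter]

theorem flux_real_univ : (flux Q H).real univ = gammaLen Q H := by
  rw [gammaLen_eq, Measure.real, flux_univ]

theorem isFiniteMeasure_flux {Q : PolygonalDomain} (hpt : ∀ i, (H i).pt = D.pI i)
    (hQ : InscribedIn Q D) : IsFiniteMeasure (flux Q H) := by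
  have : NeZero Q.m := ⟨Q.m_pos.ne'⟩
  refine ⟨?_⟩
  rw [flux_univ]
  have hsub : GammaSet Q H ⊆ ⋃ j, (geodArc (Q.q j) (Q.q (j + 1)) \ ⋃ i, (H i).horodisk) := by
    rw [GammaSet, Q.boundary, iUnion_sdiff]
  refine (measure_mono hsub).trans_lt ((measure_iUnion_fintype_le _ _).trans_lt ?_)
  refine ENNReal.sum_lt_top.2 fun j _ => ?_
  obtain ⟨a, ha⟩ := D.exists_vx_of_mem (hQ.2 j)
  obtain ⟨b, hb⟩ := D.exists_vx_of_mem (hQ.2 (j + 1))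
  by_cases hab : D.vx a = D.vx b
  · rw [← ha, ← hb, hab]
    refine (hypMeas_subsingleton ?_).trans_lt ENNReal.zero_lt_top
    intro p hp q hq
    have h1 := mem_geodArc.1 hp.1
    have h2 := mem_geodArc.1 hq.1
    rw [segment_same] at h1 h2
    exact toKlein_injOn (mem_disk.1 h1.1).le (mem_disk.1 h2.1).le
      ((mem_singleton_iff.1 h1.2).trans (mem_singleton_iff.1 h2.2).symm)
  · rw [← ha, ← hb]
    exact D.trunc_vx_lt_top H hpt hab

theorem SemiIdealDomain.geodArc_vx_subset (D : SemiIdealDomain k) (a b : ℤ) (S : Set E2) :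
    geodArc (D.vx a) (D.vx b) ∩ S ⊆
      (toKlein ⁻¹' openSegment ℝ (D.V a) (D.V b) ∩ S) ∪ ({D.vx a} ∪ {D.vx b}) := by
  rintro p ⟨hp, hpS⟩
  obtain ⟨hd, hs⟩ := mem_geodArc.1 hp
  by_cases h1 : D.V a = toKlein p
  · exact Or.inr (Or.inl (toKlein_injOn (mem_disk.1 hd).le (D.norm_vx_le a) h1.symm))
  by_cases h2 : D.V b = toKlein p
  · exact Or.inr (Or.inr (toKlein_injOn (mem_disk.1 hd).le (D.norm_vx_le b) h2.symm))
  exact Or.inl ⟨mem_openSegment_of_ne_left_right h1 h2 hs, hpS⟩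

theorem flux_openSegment {Q : PolygonalDomain} {a b : ℤ}
    (hF : openSegment ℝ (D.V a) (D.V b) ⊆ frontier (kl Q.P)) :
    flux Q H (openSegment ℝ (D.V a) (D.V b)) = trunc H (D.vx a) (D.vx b) := by
  rw [flux_apply Q H (measurableSet_openSegment _ _), trunc]
  refine le_antisymm (measure_mono fun p hp => ?_) ?_
  · exact ⟨mem_geodArc.2 ⟨hp.2.1.2, openSegment_subset_segment ℝ _ _ hp.1⟩, hp.2.2⟩
  have hsub : geodArc (D.vx a) (D.vx b) \ ⋃ i, (H i).horodisk ⊆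
      (toKlein ⁻¹' openSegment ℝ (D.V a) (D.V b) ∩ GammaSet Q H) ∪ ({D.vx a} ∪ {D.vx b}) := by
    rintro p ⟨hp, hpH⟩
    refine (D.geodArc_vx_subset a b univ ⟨hp, trivial⟩).imp_left fun h => ?_
    have hd := (mem_geodArc.1 hp).1
    exact ⟨h.1, ⟨(toKlein_mem_frontier_kl _ hd).1 (hF h.1), hd⟩, hpH⟩
  refine (measure_mono hsub).trans ((measure_union_le _ _).trans_eq ?_)
  rw [measure_union_null (hypMeas_singleton _) (hypMeas_singleton _), add_zero]

theorem hLen_geodArc_vx (D : SemiIdealDomain k) (a b : ℤ) :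
    hLen (geodArc (D.vx a) (D.vx b) ∩ GammaSet Q H) =
      (flux Q H).real (openSegment ℝ (D.V a) (D.V b)) := by
  rw [hLen_geodArc_inter, Measure.real, flux_apply Q H (measurableSet_openSegment _ _)]
  congr 1
  refine le_antisymm ?_ (measure_mono fun p hp =>
    ⟨mem_geodArc.2 ⟨hp.2.1.2, openSegment_subset_segment ℝ _ _ hp.1⟩, hp.2⟩)
  refine (measure_mono (D.geodArc_vx_subset a b _)).trans ((measure_union_le _ _).trans_eq ?_)
  rw [measure_union_null (hypMeas_singleton _) (hypMeas_singleton _), add_zero]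

end flux

/-- An inscribed domain, in the Klein model. -/
theorem InscribedIn.kInscribed {k : ℕ} {D : SemiIdealDomain k} {Q : PolygonalDomain}
    (hQ : InscribedIn Q D) : ∃ x y : ZMod Q.m → ℤ, KInscribed (kl D.Ω) D.V (kl Q.P) x y := by
  choose x hx using fun j => D.exists_vx_of_mem (hQ.2 j)
  refine ⟨x, fun j => x (j + 1), isOpen_kl Q.isOpen, ?_, ?_, ?_⟩
  · rw [kl_eq_image Q.subset]
    exact Q.conn.image _ continuous_toKlein.continuousOn
  · exact fun p hp => ⟨hp.1, hQ.1 hp.2⟩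
  · rw [frontier_kl, ← kl_inter_disk, Q.boundary, kl_iUnion, iUnion_inter]
    refine iUnion_congr fun j => ?_
    rw [kl_geodArc, SemiIdealDomain.V, SemiIdealDomain.V, hx, hx]

/-! ### Sufficiency -/

/-- If each boundary edge starting at an ideal vertex is no heavier than the other boundary
segments at this vertex, such edges carry less than half of the boundary measure. -/
theorem KInscribed.two_mul_sum_lt {ι α : Type*} [Finite ι] {N : ℤ} {K : Set E2} {V : ℤ → E2}
    {P : Set E2} {x y : ι → ℤ} (Q : KInscribed K V P x y) (h : KPoly N K V) (hN : Even N)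
    (hne : P ≠ K) (ν : Measure E2) [IsFiniteMeasure ν] (I : Finset α) (n : α → ℤ)
    (hn : ∀ i, Even (n i)) (hinj : ∀ i j, i ≠ j → ¬ N ∣ n j - n i)
    (hF : ∀ i ∈ I, openSegment ℝ (V (n i)) (V (n i + 1)) ⊆ frontier P)
    (hpos : ∀ a b, V a ≠ V b → openSegment ℝ (V a) (V b) ⊆ frontier P →
      0 < ν.real (openSegment ℝ (V a) (V b)))
    (heq : ∀ i ∈ I, openSegment ℝ (V (n i)) (V (n i - 1)) ⊆ frontier P →
      ν.real (openSegment ℝ (V (n i)) (V (n i + 1))) =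
        ν.real (openSegment ℝ (V (n i)) (V (n i - 1))))
    (hlt : ∀ i ∈ I, ∀ b, V (n i) ≠ V b → openSegment ℝ (V (n i)) (V b) ⊆ K →
      openSegment ℝ (V (n i)) (V b) ⊆ frontier P →
      ν.real (openSegment ℝ (V (n i)) (V (n i + 1))) < ν.real (openSegment ℝ (V (n i)) (V b))) :
    2 * ∑ i ∈ I, ν.real (openSegment ℝ (V (n i)) (V (n i + 1))) < ν.real univ := by
  have hex : ∀ i, ∃ b, i ∈ I → openSegment ℝ (V (n i)) (V b) ⊆ frontier P ∧
      (b = n i - 1 ∨ (V (n i) ≠ V b ∧ openSegment ℝ (V (n i)) (V b) ⊆ K)) := fun i => by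
    by_cases hi : i ∈ I
    · obtain ⟨b, hb⟩ := Q.exists_second_segment h (hn i) (hF i hi)
      exact ⟨b, fun _ => hb⟩
    · exact ⟨0, fun hi' => absurd hi' hi⟩
  choose b hb using hex
  set A : α → Set E2 := fun i => openSegment ℝ (V (n i)) (V (n i + 1)) with hA
  set E : α → Set E2 := fun i => openSegment ℝ (V (n i)) (V (b i)) with hE
  have hAm : ∀ i, MeasurableSet (A i) := fun i => measurableSet_openSegment _ _
  have hEm : ∀ i, MeasurableSet (E i) := fun i => measurableSet_openSegment _ _
  have hAK : ∀ i, A i ⊆ frontier K := fun i => h.openEdge_subset (n i)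
  have hprev : ∀ i, openSegment ℝ (V (n i)) (V (n i - 1)) =
      openSegment ℝ (V (n i - 1)) (V (n i - 1 + 1)) := fun i => by
    rw [sub_add_cancel, openSegment_symm]
  have hKf : Disjoint K (frontier K) :=
    Set.disjoint_left.2 fun z hz hz' => h.notMem_of_frontier hz' hz
  have hAA : ∀ i j, i ≠ j → Disjoint (A i) (A j) := fun i j hij =>
    h.disjoint_openEdge (hinj i j hij)
  have hEE : ∀ i ∈ I, ∀ j ∈ I, i ≠ j → Disjoint (E i) (E j) := by
    intro i hi j hj hij
    have hV : V (n i) ≠ V (n j) := fun e => hinj i j hij (h.inj _ _ e)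
    have ci := right_mem_closure (hF i hi)
    have cj := right_mem_closure (hF j hj)
    rcases (hb i hi).2 with h1 | ⟨h1, h2⟩
    · rcases (hb j hj).2 with h3 | ⟨h3, h4⟩
      · simp only [hE, h1, h3, hprev]
        exact h.disjoint_openEdge (by
          rw [sub_sub_sub_cancel_right]; exact hinj i j hij)
      · exact (Q.disjoint_chords h hV.symm h3 h4 (hb j hj).1 (hb i hi).1 cj ci).symm
    · exact Q.disjoint_chords h hV h1 h2 (hb i hi).1 (hb j hj).1 ci cj
  have hAE : ∀ i, ∀ j ∈ I, Disjoint (A i) (E j) := by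
    intro i j hj
    rcases (hb j hj).2 with h3 | ⟨h3, h4⟩
    · simp only [hA, hE, h3, hprev]
      refine h.disjoint_openEdge fun hd => ?_
      have h1 := even_iff_two_dvd.1 (hn i)
      have h2 := even_iff_two_dvd.1 (hn j)
      have h3 := (even_iff_two_dvd.1 hN).trans hd
      omega
    · exact (hKf.mono h4 (hAK i)).symm
  set U := ⋃ i ∈ I, A i with hU
  set W := ⋃ i ∈ I, E i with hW
  have hWm : MeasurableSet W := I.measurableSet_biUnion fun i _ => hEm i
  have eU : ν.real U = ∑ i ∈ I, ν.real (A i) :=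
    measureReal_biUnion_finset (fun i _ j _ hij => hAA i j hij) fun i _ => hAm i
  have eW : ν.real W = ∑ i ∈ I, ν.real (E i) :=
    measureReal_biUnion_finset (fun i hi j hj hij => hEE i hi j hj hij) fun i _ => hEm i
  have eUW : ν.real (U ∪ W) = ∑ i ∈ I, ν.real (A i) + ∑ i ∈ I, ν.real (E i) := by
    rw [measureReal_union _ hWm (measure_ne_top _ _) (measure_ne_top _ _), eU, eW]
    simp only [hU, hW, Set.disjoint_iUnion_left, Set.disjoint_iUnion_right]
    exact fun i hi j hj => hAE j i hi
  by_cases hall : ∀ i ∈ I, b i = n i - 1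
  · obtain ⟨j, h1, h2, h3⟩ := Q.exists_chord h hne
    have hdis : Disjoint (U ∪ W) (openSegment ℝ (V (x j)) (V (y j))) := by
      refine (hKf.symm.mono_left ?_).mono_right h2
      refine union_subset (iUnion₂_subset fun i _ => hAK i) (iUnion₂_subset fun i hi => ?_)
      simp only [hE, hall i hi, hprev]
      exact h.openEdge_subset _
    have h4 : ν.real (U ∪ W ∪ openSegment ℝ (V (x j)) (V (y j))) ≤ ν.real univ :=
      measureReal_mono (subset_univ _)
    rw [measureReal_union hdis (measurableSet_openSegment _ _) (measure_ne_top _ _)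
      (measure_ne_top _ _), eUW] at h4
    have h5 := hpos _ _ h1 h3
    have h6 : ∑ i ∈ I, ν.real (A i) = ∑ i ∈ I, ν.real (E i) :=
      Finset.sum_congr rfl fun i hi => by
        have := (hb i hi).1
        simp only [hA, hE, hall i hi] at this ⊢
        exact heq i hi this
    linarith
  · push Not at hall
    obtain ⟨i, hi, hbi⟩ := hall
    have h4 : ν.real (U ∪ W) ≤ ν.real univ := measureReal_mono (subset_univ _)
    have h6 : ∑ i ∈ I, ν.real (A i) < ∑ i ∈ I, ν.real (E i) := by
      refine Finset.sum_lt_sum (fun i hi => ?_) ⟨i, hi, ?_⟩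
      · have h1 := (hb i hi).1
        rcases (hb i hi).2 with h2 | ⟨h2, h3⟩
        · simp only [hA, hE, h2] at h1 ⊢
          exact (heq i hi h1).le
        · exact (hlt i hi _ h2 h3 h1).le
      · obtain ⟨h2, h3⟩ := (hb i hi).2.resolve_left hbi
        exact hlt i hi _ h2 h3 (hb i hi).1
    linarith

namespace IsThin
variable {k : ℕ} {D : SemiIdealDomain k} {H : ZMod k → Horocycle} {Q : PolygonalDomain}

theorem two_mul_alphaVal_lt (T : IsThin D H) (hP : KPoly (2 * k) (kl D.Ω) D.V)
    (hQ : InscribedIn Q D) (hne : Q.P ≠ D.Ω) : 2 * alphaVal D H Q < gammaLen Q H := by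
  classical
  have : NeZero k := ⟨D.k_pos.ne'⟩
  have : NeZero Q.m := ⟨Q.m_pos.ne'⟩
  obtain ⟨x, y, KQ⟩ := hQ.kInscribed
  have := isFiniteMeasure_flux H T.pt hQ
  have hne' : kl Q.P ≠ kl D.Ω := fun e => hne (by rw [← pull_kl Q.subset, e, pull_kl D.subset])
  set n : ZMod k → ℤ := fun i => 2 * (i.val : ℤ) with hn
  have hcast : ∀ i : ZMod k, (((i.val : ℕ) : ℤ) : ZMod k) = i := fun i => by simp
  have vI : ∀ i, D.vx (n i) = D.pI i := fun i => by rw [hn, D.vx_even, hcast]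
  have vB : ∀ i, D.vx (n i + 1) = D.pB i := fun i => by rw [hn, D.vx_odd, hcast]
  have vB' : ∀ i, D.vx (n i - 1) = D.pB (i - 1) := fun i => by rw [hn, D.vx_odd', hcast]
  have hreal : ∀ a b, openSegment ℝ (D.V a) (D.V b) ⊆ frontier (kl Q.P) →
      (flux Q H).real (openSegment ℝ (D.V a) (D.V b)) = (trunc H (D.vx a) (D.vx b)).toReal :=
    fun a b hF => by rw [Measure.real, flux_openSegment H hF]
  have hlen : ∀ i, hLen (D.edgeA i ∩ GammaSet Q H) =
      (flux Q H).real (openSegment ℝ (D.V (n i)) (D.V (n i + 1))) := fun i => by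
    rw [← hLen_geodArc_vx, vI, vB]; rfl
  set I := Finset.univ.filter fun i =>
    openSegment ℝ (D.V (n i)) (D.V (n i + 1)) ⊆ frontier (kl Q.P) with hI
  have hα : alphaVal D H Q =
      ∑ i ∈ I, (flux Q H).real (openSegment ℝ (D.V (n i)) (D.V (n i + 1))) := by
    have : alphaVal D H Q = ∑ i, (flux Q H).real (openSegment ℝ (D.V (n i)) (D.V (n i + 1))) :=
      Finset.sum_congr rfl fun i _ => hlen i
    rw [this]
    refine (Finset.sum_subset (Finset.subset_univ I) fun i _ hi => ?_).symm
    have hempty : toKlein ⁻¹' openSegment ℝ (D.V (n i)) (D.V (n i + 1)) ∩ GammaSet Q H = ∅ := by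
      rw [Set.eq_empty_iff_forall_notMem]
      exact fun p hp => hi (Finset.mem_filter.2 ⟨Finset.mem_univ i, KQ.edge_subset_frontier hP hp.1
        ((toKlein_mem_frontier_kl _ hp.2.1.2).2 hp.2.1.1)⟩)
    rw [Measure.real, flux_apply Q H (measurableSet_openSegment _ _), hempty, measure_empty,
      ENNReal.toReal_zero]
  have hA : ∀ i ∈ I, (flux Q H).real (openSegment ℝ (D.V (n i)) (D.V (n i + 1))) =
      (ENNReal.ofReal ((H i).ht (D.pB i))).toReal := fun i hi => by
    rw [hreal _ _ (Finset.mem_filter.1 hi).2, vI, vB, T.trunc_eq]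
  have hvx : ∀ {a b}, D.V a ≠ D.V b → D.vx a ≠ D.vx b := fun h e => h ((D.V_eq_iff _ _).2 e)
  rw [hα, ← flux_real_univ]
  refine KQ.two_mul_sum_lt hP (even_two_mul _) hne' _ I n (fun i => even_two_mul _)
    (fun i j hij hd => hij ?_) (fun i hi => (Finset.mem_filter.1 hi).2) (fun a b hab hF => ?_)
    (fun i hi hF => ?_) (fun i hi b hab hK hF => ?_)
  · have h1 : (k : ℤ) ∣ (j.val : ℤ) - i.val :=
      Int.dvd_of_mul_dvd_mul_left two_ne_zero (by rw [mul_sub]; exact hd)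
    have h2 := (ZMod.intCast_eq_intCast_iff_dvd_sub (i.val : ℤ) j.val k).2 h1
    rwa [hcast, hcast] at h2
  · rw [hreal a b hF]
    have htop := D.trunc_vx_lt_top H T.pt (hvx hab)
    refine ENNReal.toReal_pos (pos_iff_ne_zero.1 ?_) htop.ne
    have hab := hvx hab
    rcases Int.even_or_odd' a with ⟨l, rfl | rfl⟩ <;>
      rcases Int.even_or_odd' b with ⟨m, rfl | rfl⟩ <;>
      simp only [D.vx_even, D.vx_odd] at hab ⊢
    · exact zero_le.trans_lt (T.lt_trunc (fun e => hab (by rw [e])) 0)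
    · rw [T.trunc_eq]; exact ENNReal.ofReal_pos.2 (T.ht_pos _ _)
    · rw [trunc_comm, T.trunc_eq]; exact ENNReal.ofReal_pos.2 (T.ht_pos _ _)
    · exact T.trunc_pos _ _ fun e => hab (by rw [e])
  · rw [hA i hi, hreal _ _ hF, vI, vB', T.trunc_eq, T.ht_eq]
  · rw [hA i hi, hreal _ _ hF]
    have htop := D.trunc_vx_lt_top H T.pt (hvx hab)
    refine (ENNReal.toReal_lt_toReal ENNReal.ofReal_ne_top htop.ne).2 ?_
    have hVb : ∀ c, D.vx b = D.vx c →
        openSegment ℝ (D.V (n i)) (D.V c) ⊆ frontier (kl D.Ω) → False := by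
      intro c hc hsub
      rw [← (D.V_eq_iff b c).2 hc] at hsub
      have hz : midpoint ℝ (D.V (n i)) (D.V b) ∈ openSegment ℝ (D.V (n i)) (D.V b) :=
        midpoint_mem_openSegment _ _
      exact hP.notMem_of_frontier (hsub hz) (hK hz)
    have hab := hvx hab
    rw [vI] at hab ⊢
    rcases Int.even_or_odd' b with ⟨m, rfl | rfl⟩
    · rw [D.vx_even] at hab ⊢
      exact T.lt_trunc (fun e => hab (by rw [e])) i
    · rw [D.vx_odd, T.trunc_eq]
      refine (ENNReal.ofReal_lt_ofReal_iff (T.ht_pos _ _)).2 (T.ht_lt _ _ (fun e => ?_) fun e => ?_)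
      · refine hVb (n i + 1) ?_ (hP.openEdge_subset _)
        rw [vB, D.vx_odd, e]
      · refine hVb (n i - 1) ?_ ?_
        · rw [vB', D.vx_odd, e]
        · have := hP.openEdge_subset (n i - 1)
          rwa [sub_add_cancel, openSegment_symm] at this

theorem fluxIneq (T : IsThin D H) (hP : KPoly (2 * k) (kl D.Ω) D.V) : FluxIneq D H := by
  refine fun Q hQ hne => ⟨T.two_mul_alphaVal_lt hP hQ hne, ?_⟩
  have hPr : KPoly (2 * k) (kl D.rev.Ω) D.rev.V := by
    have := hP.rev
    rwa [← show D.rev.V = fun n => D.V (-n) from funext D.rev_V] at this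
  rw [← alphaVal_rev, ← gammaLen_rev]
  exact T.rev.two_mul_alphaVal_lt hPr ((inscribedIn_rev D Q).2 hQ) hne

end IsThin

/-- **Characterization of admissible domains** (Lemma `lem:JS`, from [R]):
a convex semi-ideal polygonal domain satisfying the horocycle-distance condition (i)
is admissible iff every interior vertex `p_{2j}`, other than the two neighbors of the
ideal vertex `p_{2i−1}`, lies outside the closed horodisk `D_{2i−1}` at `p_{2i−1}`
passing through those two neighbors. -/
theorem admissible_iff_vertices_outside_horodisks {k : ℕ} (D : SemiIdealDomain k)
    (hconv : HypConvex D.Ω)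
    (H : ZMod k → Horocycle) (hpt : ∀ i, (H i).pt = D.pI i)
    (hdisj : ∀ i j, i ≠ j → Disjoint (H i).circle (H j).circle)
    (hdist : ∀ i, hDistSet (D.pB (i - 1)) (H i).circle = hDistSet (D.pB i) (H i).circle)
    -- `Dh i` is the horodisk at the ideal vertex `pI i` whose boundary horocycle passes
    -- through both neighboring interior vertices `pB (i-1)` and `pB i`.
    (Dh : ZMod k → Horocycle)
    (hDh : ∀ i, (Dh i).pt = D.pI i ∧ D.pB (i - 1) ∈ (Dh i).circle ∧ D.pB i ∈ (Dh i).circle) :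
    Admissible D ↔
      ∀ i j : ZMod k, j ≠ i → j ≠ i - 1 → D.pB j ∈ Disk \ closure (Dh i).horodisk := by
  constructor
  · rintro ⟨-, H', hpt', hdisj', -, hΦ⟩ i j hij hij'
    have h := D.vertices_outside_of_fluxIneq hconv hpt' hdisj' hΦ hDh hij hij'
    exact ⟨D.inter j, fun hc => h.not_ge (((Dh i).ht_nonpos_iff (D.inter j)).2 hc)⟩
  · intro hout
    obtain ⟨H', T⟩ := D.exists_isThin hDh fun i j hij hij' => lt_of_not_ge fun hc =>
      (hout i j hij hij').2 (((Dh i).ht_nonpos_iff (D.inter j)).1 hc)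
    refine ⟨hconv, H', T.pt, fun i j hij => ?_, fun i => ?_, T.fluxIneq (D.kPoly hconv Dh hDh)⟩
    · exact (H' i).disjoint_circle_of_gap_pos (H' j) (T.pt_ne i j hij) (T.gap_pos hij)
    · rw [hDistSet_circle (D.inter _), hDistSet_circle (D.inter _)]

end
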